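/- arXiv:1705.01360 — 3 statements merged into one kernel-verified Lean document; each statement's English description precedes it below -/
import Mathlib

section
/- Let ∅ ≠ E ⊂ ℝ^n be a closed set with dim_A(E) < n (ℝ^n equipped with the Euclidean metric and Lebesgue measure), let α ∈ ℝ, and set w = δ_E^{-α}. Then: (A) for 1 < p < ∞, w belongs to the Muckenhoupt class A_p if and only if (1−p)(n − dim_A(E)) < α < n − dim_A(E); and (B) w belongs to A_1 if and only if 0 ≤ α < n − dim_A(E). -/
open MeasureTheory Metric Set
open scoped ENNReal NNReal

namespace ApDistance

noncomputable section

variable {X : Type*} [MetricSpace X] [MeasurableSpace X] [BorelSpace X]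

/-- All balls of positive radius have positive and finite measure. -/
def BallsPosFinite (μ : Measure X) : Prop :=
  ∀ (x : X) (r : ℝ), 0 < r → 0 < μ (ball x r) ∧ μ (ball x r) < ∞

/-- The measure `μ` is doubling with constant `C`. -/
def DoublingWith (μ : Measure X) (C : ℝ) : Prop :=
  ∀ (x : X) (r : ℝ), 0 < r → μ (ball x (2 * r)) ≤ ENNReal.ofReal C * μ (ball x r)

/-- The measure `μ` is doubling. -/
def Doubling (μ : Measure X) : Prop :=
  ∃ C : ℝ, 0 < C ∧ DoublingWith μ C

/-- The (quantitative) reverse doubling condition with exponent `η`. -/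
def ReverseDoubling (μ : Measure X) (η : ℝ) : Prop :=
  ∃ C : ℝ, 0 < C ∧ ∀ (x y : X) (r R : ℝ), 0 < r → 0 < R → ball y r ⊆ ball x R →
    μ (ball y r) ≤ ENNReal.ofReal (C * (r / R) ^ η) * μ (ball x R)

/-- Standing assumptions (S1)-(S2): `X` is unbounded, points have measure zero,
and all annuli are nonempty. -/
def StandingAssumptions (μ : Measure X) : Prop :=
  ¬ Bornology.IsBounded (univ : Set X) ∧ (∀ x : X, μ {x} = 0) ∧
    ∀ (x : X) (r R : ℝ), 0 < r → r < R → (ball x R \ ball x r).Nonempty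

/-- Ahlfors `Q`-regularity of the metric measure space. -/
def AhlforsRegular (μ : Measure X) (Q : ℝ) : Prop :=
  ∃ C : ℝ, 1 ≤ C ∧ ∀ (x : X) (r : ℝ), 0 < r → ENNReal.ofReal r < EMetric.diam (univ : Set X) →
    ENNReal.ofReal (C⁻¹ * r ^ Q) ≤ μ (ball x r) ∧ μ (ball x r) ≤ ENNReal.ofReal (C * r ^ Q)

/-- The set of admissible exponents in the definition of the (upper) Assouad dimension:
`E ∩ B(x,R)` can be covered by at most `C (R/r)^s` balls of radius `r`. -/
def assouadDimBddSet (E : Set X) : Set ℝ :=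
  {s : ℝ | 0 ≤ s ∧ ∃ C : ℝ, 1 ≤ C ∧ ∀ x ∈ E, ∀ r R : ℝ, 0 < r → r < R →
    ENNReal.ofReal R < 2 * EMetric.diam (univ : Set X) →
    ∃ F : Finset X, (F.card : ℝ) ≤ C * (R / r) ^ s ∧ E ∩ ball x R ⊆ ⋃ y ∈ F, ball y r}

/-- The (upper) Assouad dimension of a set `E`. -/
def assouadDim (E : Set X) : ℝ := sInf (assouadDimBddSet E)

/-- The set of admissible exponents in the definition of the lower Assouad codimension. -/
def assouadCodimBddSet (μ : Measure X) (E : Set X) : Set ℝ :=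
  {ρ : ℝ | 0 ≤ ρ ∧ ∃ C : ℝ, 1 ≤ C ∧ ∀ x ∈ E, ∀ r R : ℝ, 0 < r → r < R →
    ENNReal.ofReal R < 2 * EMetric.diam (univ : Set X) →
    μ ({y : X | infDist y E < r} ∩ ball x R) ≤
      ENNReal.ofReal (C * (r / R) ^ ρ) * μ (ball x R)}

/-- The lower Assouad codimension of a set `E` with respect to `μ`. -/
def assouadCodim (μ : Measure X) (E : Set X) : ℝ := sSup (assouadCodimBddSet μ E)

/-- Porosity of a set `E ⊆ X`. -/
def IsPorous (E : Set X) : Prop :=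
  ∃ c : ℝ, 0 < c ∧ c < 1 ∧ ∀ x ∈ E, ∀ r : ℝ, 0 < r →
    ENNReal.ofReal r < 2 * EMetric.diam (univ : Set X) →
    ∃ y : X, ball y (c * r) ⊆ ball x r \ E

/-- A weight: measurable, a.e. positive and finite, locally integrable on balls. -/
def IsWeight (μ : Measure X) (w : X → ℝ≥0∞) : Prop :=
  Measurable w ∧ (∀ᵐ x ∂μ, 0 < w x ∧ w x ≠ ∞) ∧
    ∀ (x : X) (r : ℝ), 0 < r → ∫⁻ y in ball x r, w y ∂μ ≠ ∞

/-- Membership in the Muckenhoupt class `A_p`, `1 < p < ∞`. -/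
def MemAp (μ : Measure X) (w : X → ℝ≥0∞) (p : ℝ) : Prop :=
  IsWeight μ w ∧ ∃ A : ℝ, 0 < A ∧ ∀ (x : X) (r : ℝ), 0 < r →
    ((∫⁻ y in ball x r, w y ∂μ) / μ (ball x r)) *
      ((∫⁻ y in ball x r, w y ^ (-(1 / (p - 1))) ∂μ) / μ (ball x r)) ^ (p - 1) ≤
      ENNReal.ofReal A

/-- Membership in the Muckenhoupt class `A_1`. -/
def MemA1 (μ : Measure X) (w : X → ℝ≥0∞) : Prop :=
  IsWeight μ w ∧ ∃ A : ℝ, 0 < A ∧ ∀ (x : X) (r : ℝ), 0 < r →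
    ((∫⁻ y in ball x r, w y ∂μ) / μ (ball x r)) *
      essSup (fun y => (w y)⁻¹) (μ.restrict (ball x r)) ≤ ENNReal.ofReal A

/-- Membership in the Muckenhoupt class `A_∞`. -/
def MemAinfty (μ : Measure X) (w : X → ℝ≥0∞) : Prop :=
  IsWeight μ w ∧ ∃ C d : ℝ, 0 < C ∧ 0 < d ∧ ∀ (x : X) (r : ℝ), 0 < r →
    ∀ F : Set X, MeasurableSet F → F ⊆ ball x r →
      ∫⁻ y in F, w y ∂μ ≤
        ENNReal.ofReal C * (μ F / μ (ball x r)) ^ d * ∫⁻ y in ball x r, w y ∂μ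

/-- The weight `w = δ_E^{-α} = dist(·,E)^{-α}` (with values in `ℝ≥0∞`). -/
def distWeight (E : Set X) (α : ℝ) : X → ℝ≥0∞ :=
  fun x => ENNReal.ofReal (infDist x E) ^ (-α)

/-- The Aikawa condition with exponent `α` and constant `C`. -/
def AikawaCondition (μ : Measure X) (E : Set X) (α C : ℝ) : Prop :=
  ∀ x ∈ E, ∀ r : ℝ, 0 < r → ENNReal.ofReal r < 2 * EMetric.diam (univ : Set X) →
    ∫⁻ y in ball x r, ENNReal.ofReal (infDist y E) ^ (-α) ∂μ ≤
      ENNReal.ofReal (C * r ^ (-α)) * μ (ball x r)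

/-- The Riesz potential `I_s f`. -/
def rieszPotential (μ : Measure X) (s : ℝ) (f : X → ℝ≥0∞) (x : X) : ℝ≥0∞ :=
  ∫⁻ y, f y * ENNReal.ofReal (dist x y ^ s) / μ (ball x (dist x y)) ∂μ

/-- `Lip_0(X)`: Lipschitz functions vanishing outside some ball. -/
def MemLip0 (f : X → ℝ) : Prop :=
  (∃ K : ℝ≥0, LipschitzWith K f) ∧ ∃ (x : X) (r : ℝ), ∀ y : X, y ∉ ball x r → f y = 0

/-- The `λ`-chain condition. -/
def ChainCondition (X : Type*) [MetricSpace X] (lam : ℝ) : Prop :=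
  ∃ M : ℝ, 1 ≤ M ∧ ∀ (x : X) (r R : ℝ), 0 < r → r < R →
    ∃ (k : ℕ) (c : ℕ → X) (ρ : ℕ → ℝ),
      (∀ i ≤ k, 0 < ρ i) ∧
      ball (c 0) (lam * ρ 0) ⊆ (ball x R)ᶜ ∧
      ball (c k) (lam * ρ k) ⊆ ball x r ∧
      (∀ i ≤ k,
        M⁻¹ * Metric.diam (ball (c i) (lam * ρ i)) ≤ infDist x (ball (c i) (lam * ρ i)) ∧
        infDist x (ball (c i) (lam * ρ i)) ≤ M * Metric.diam (ball (c i) (lam * ρ i))) ∧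
      (∀ i < k, ∃ (z : X) (t : ℝ), 0 < t ∧
        ball z t ⊆ ball (c i) (ρ i) ∩ ball (c (i + 1)) (ρ (i + 1)) ∧
        ball (c i) (ρ i) ∪ ball (c (i + 1)) (ρ (i + 1)) ⊆ ball z (M * t)) ∧
      (∀ y : X, (({i : ℕ | i ≤ k ∧ y ∈ ball (c i) (lam * ρ i)}).ncard : ℝ) ≤ M)

/-- The inner integral appearing in fractional Hardy–Sobolev inequalities:
`y ↦ ∫_X |f(y)-f(z)|^t / (d(y,z)^{st} μ(B(y,d(y,z)))) dμ(z)`. -/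
def fracEnergyKernel (μ : Measure X) (s t : ℝ) (f : X → ℝ) (y : X) : ℝ≥0∞ :=
  ∫⁻ z, ENNReal.ofReal (|f y - f z| ^ t) /
    (ENNReal.ofReal (dist y z ^ (s * t)) * μ (ball y (dist y z))) ∂μ


/-- Euclidean space, abbreviated. -/
abbrev Eu (n : ℕ) := EuclideanSpace ℝ (Fin n)

/-- Volume of the unit ball. -/
def uvol (n : ℕ) : ℝ := (volume (ball (0 : Eu n) 1)).toReal

lemma uvol_pos (n : ℕ) : 0 < uvol n := by
  unfold uvol
  exact ENNReal.toReal_pos (measure_ball_pos volume _ one_pos).ne' measure_ball_lt_top.ne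

lemma vol_ball {n : ℕ} [Nontrivial (Eu n)] (x : Eu n) {r : ℝ} (hr : 0 < r) :
    volume (ball x r) = ENNReal.ofReal (uvol n * r ^ (n : ℝ)) := by
  rw [Measure.addHaar_ball volume x hr.le, mul_comm (uvol n), ENNReal.ofReal_mul (by positivity), uvol,
    ENNReal.ofReal_toReal measure_ball_lt_top.ne]
  simp

lemma ediam_top {n : ℕ} [Nontrivial (Eu n)] : EMetric.diam (univ : Set (Eu n)) = ∞ := by
  have : NoncompactSpace (Eu n) := NormedSpace.noncompactSpace ℝ (Eu n)
  exact Metric.ediam_univ_of_noncompact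

lemma mem_bddSet {n : ℕ} [Nontrivial (Eu n)] {E : Set (Eu n)} {s : ℝ} :
    s ∈ assouadDimBddSet E ↔ 0 ≤ s ∧ ∃ C : ℝ, 1 ≤ C ∧ ∀ x ∈ E, ∀ r R : ℝ, 0 < r → r < R →
    ∃ F : Finset (Eu n), (F.card : ℝ) ≤ C * (R / r) ^ s ∧ E ∩ ball x R ⊆ ⋃ y ∈ F, ball y r := by
  have h : (2 : ℝ≥0∞) * ∞ = ∞ := by simp
  simp only [assouadDimBddSet, Set.mem_ofPred_eq, ediam_top, h, ENNReal.ofReal_lt_top, forall_true_left]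

lemma packing {n : ℕ} [Nontrivial (Eu n)] (E : Set (Eu n)) (x : Eu n) (R t : ℝ) (ht : 0 < t) :
    ∃ F : Finset (Eu n), (∀ y ∈ F, y ∈ E ∩ ball x R) ∧ E ∩ ball x R ⊆ ⋃ y ∈ F, ball y t ∧
      (F.card : ℝ≥0∞) * ENNReal.ofReal (uvol n * (t / 2) ^ (n : ℝ)) ≤
        volume ({y | infDist y E < t / 2} ∩ ball x (R + t / 2)) := by
  classical
  set P : Finset (Eu n) → Prop := fun F => (∀ y ∈ F, y ∈ E ∩ ball x R) ∧
    ∀ y ∈ F, ∀ z ∈ F, y ≠ z → t ≤ dist y z with hP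
  have key : ∀ F, P F → (F.card : ℝ≥0∞) * ENNReal.ofReal (uvol n * (t / 2) ^ (n : ℝ)) ≤
        volume ({y | infDist y E < t / 2} ∩ ball x (R + t / 2)) := by
    rintro F ⟨h1, h2⟩
    have : volume (⋃ y ∈ F, ball y (t / 2)) = ∑ y ∈ F, volume (ball y (t / 2)) := by
      apply measure_biUnion_finset
      · intro y hy z hz hyz
        exact ball_disjoint_ball (by linarith [h2 y hy z hz hyz])
      · intro b _
        exact measurableSet_ball
    rw [Finset.sum_congr rfl (fun y _ => vol_ball y (half_pos ht)), Finset.sum_const,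
      nsmul_eq_mul] at this
    rw [← this]
    apply measure_mono
    apply iUnion₂_subset
    intro y hy z hz
    rw [mem_ball] at hz
    have := h1 y hy
    refine ⟨(infDist_le_dist_of_mem this.1).trans_lt hz, ?_⟩
    have h3 := this.2
    rw [mem_ball] at h3 ⊢
    linarith [dist_triangle z y x]
  have hc : 0 < uvol n * (t / 2) ^ (n : ℝ) := mul_pos (uvol_pos n) (Real.rpow_pos_of_pos (by linarith) _)
  set S : Set ℕ := {m | ∃ F, P F ∧ F.card = m} with hS
  have hbdd : BddAbove S := by
    refine ⟨⌊(volume (ball x (R + t / 2))).toReal / (uvol n * (t / 2) ^ (n : ℝ))⌋₊, ?_⟩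
    rintro m ⟨F, hF, rfl⟩
    apply Nat.le_floor
    rw [le_div_iff₀ hc]
    have := (key F hF).trans (measure_mono inter_subset_right)
    have := ENNReal.toReal_mono measure_ball_lt_top.ne this
    rwa [ENNReal.toReal_mul, ENNReal.toReal_natCast, ENNReal.toReal_ofReal hc.le] at this
  have hne : S.Nonempty := ⟨0, ∅, by simp [hP], by simp⟩
  obtain ⟨F, hF, hFc⟩ := Nat.sSup_mem hne hbdd
  refine ⟨F, hF.1, ?_, key F hF⟩
  intro z hz
  by_contra hcon
  simp only [mem_iUnion, mem_ball, not_exists, not_lt] at hcon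
  have hzF : z ∉ F := fun h => by
    have := hcon z h
    simp at this
    linarith
  have : (insert z F).card ∈ S := by
    refine ⟨_, ⟨?_, ?_⟩, rfl⟩
    · intro y hy
      rcases Finset.mem_insert.1 hy with rfl | hy
      · exact hz
      · exact hF.1 y hy
    · intro y hy w hw hyw
      rcases Finset.mem_insert.1 hy with hy' | hy' <;> rcases Finset.mem_insert.1 hw with hw' | hw'
      · exact absurd (hy'.trans hw'.symm) hyw
      · rw [hy']; exact hcon w hw'
      · rw [hw', dist_comm]; exact hcon y hy'
      · exact hF.2 y hy' w hw' hyw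
  have := le_csSup hbdd this
  rw [Finset.card_insert_of_notMem hzF] at this
  omega

lemma natCast_mem_bddSet {n : ℕ} [Nontrivial (Eu n)] (E : Set (Eu n)) :
    (n : ℝ) ∈ assouadDimBddSet E := by
  rw [mem_bddSet]
  refine ⟨Nat.cast_nonneg n, 4 ^ (n : ℝ), Real.one_le_rpow (by norm_num) (Nat.cast_nonneg n), ?_⟩
  intro x _ r R hr hrR
  obtain ⟨F, _, h2, h3⟩ := packing E x R r hr
  refine ⟨F, ?_, h2⟩
  have h4 := (h3.trans (measure_mono inter_subset_right)).trans
    (measure_mono (ball_subset_ball (show R + r / 2 ≤ 2 * R by linarith)))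
  rw [vol_ball x (by linarith)] at h4
  have hc : 0 < uvol n * (r / 2) ^ (n : ℝ) := mul_pos (uvol_pos n) (Real.rpow_pos_of_pos (by linarith) _)
  have h5 := ENNReal.toReal_mono ENNReal.ofReal_ne_top h4
  have hR : 0 < R := hr.trans hrR
  have hu := uvol_pos n
  rw [ENNReal.toReal_mul, ENNReal.toReal_natCast, ENNReal.toReal_ofReal hc.le,
    ENNReal.toReal_ofReal (by positivity), ← le_div_iff₀ hc] at h5
  refine h5.trans (le_of_eq ?_)
  rw [mul_div_mul_left _ _ hu.ne', ← Real.div_rpow (by positivity) (by positivity),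
    ← Real.mul_rpow (by positivity) (by positivity)]
  congr 1
  field_simp
  norm_num

/-- measure bound for tubular neighbourhoods. -/
lemma tube_bound {n : ℕ} [Nontrivial (Eu n)] {E : Set (Eu n)} (hE : E.Nonempty) {s : ℝ}
    (hs : s ∈ assouadDimBddSet E) :
    ∃ C : ℝ, 0 < C ∧ ∀ x ∈ E, ∀ t R : ℝ, 0 < t → t ≤ R →
      volume ({y | infDist y E < t} ∩ ball x R) ≤
        ENNReal.ofReal (C * (t / R) ^ (n - s)) * volume (ball x R) := by
  obtain ⟨hs0, C, hC1, hC⟩ := mem_bddSet.1 hs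
  have hu := uvol_pos n
  refine ⟨C * 2 ^ (s + n), by positivity, ?_⟩
  intro x hx t R ht htR
  have hR : 0 < R := by linarith
  obtain ⟨F, hF1, hF2⟩ := hC x hx t (2 * R) ht (by linarith)
  have hsub : {y | infDist y E < t} ∩ ball x R ⊆ ⋃ z ∈ F, ball z (2 * t) := by
    rintro y ⟨hy1, hy2⟩
    obtain ⟨e, he, hye⟩ := (infDist_lt_iff hE).1 hy1
    have he2 : e ∈ E ∩ ball x (2 * R) := by
      refine ⟨he, ?_⟩
      rw [mem_ball] at hy2 ⊢
      linarith [dist_triangle e y x, dist_comm e y]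
    have := hF2 he2
    simp only [mem_iUnion, mem_ball] at this ⊢
    obtain ⟨z, hz, hez⟩ := this
    exact ⟨z, hz, by linarith [dist_triangle y e z]⟩
  refine (measure_mono hsub).trans ((measure_biUnion_finset_le _ _).trans ?_)
  rw [Finset.sum_congr rfl (fun y _ => vol_ball y (show 0 < 2 * t by linarith)), Finset.sum_const,
      nsmul_eq_mul, vol_ball x hR, ← ENNReal.ofReal_mul (by positivity),
      ← ENNReal.ofReal_natCast, ← ENNReal.ofReal_mul (by positivity)]
  apply ENNReal.ofReal_le_ofReal
  calc (F.card : ℝ) * (uvol n * (2 * t) ^ (n : ℝ))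
      ≤ (C * (2 * R / t) ^ s) * (uvol n * (2 * t) ^ (n : ℝ)) := by gcongr
    _ = _ := by
      rw [Real.rpow_add (by norm_num), Real.rpow_sub (by positivity),
        Real.mul_rpow (by positivity) (by positivity), Real.div_rpow (by positivity) (by positivity),
        Real.mul_rpow (by positivity) (by positivity), Real.div_rpow (by positivity) (by positivity),
        Real.div_rpow (by positivity) (by positivity)]
      field_simp

lemma measurable_distWeight {n : ℕ} (E : Set (Eu n)) (β : ℝ) : Measurable (distWeight E β) := by
  unfold distWeight
  exact (ENNReal.measurable_ofReal.comp (measurable_infDist)).pow_const _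

/-- geometric domination of the distance weight. -/
lemma distWeight_le_tsum {n : ℕ} (E : Set (Eu n)) {β : ℝ} (hβ : 0 < β)
    {R : ℝ} (hR : 0 < R) (y : Eu n) (hy : infDist y E < R) :
    distWeight E β y ≤ ∑' k : ℕ, ({z : Eu n | infDist z E < (1 / 2) ^ k * R}).indicator
      (fun _ => ENNReal.ofReal ((4 * 2 ^ k / R) ^ β)) y := by
  rcases (infDist_nonneg (x := y) (s := E)).eq_or_lt with h0 | h0
  · have : (∑' k : ℕ, ({z : Eu n | infDist z E < (1 / 2) ^ k * R}).indicator
      (fun _ => ENNReal.ofReal ((4 * 2 ^ k / R) ^ β)) y) = ∞ := by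
      rw [eq_top_iff]
      calc ∞ = ∑' k : ℕ, ENNReal.ofReal ((1 / R) ^ β) := by
            rw [ENNReal.tsum_const_eq_top_of_ne_zero]
            rw [ENNReal.ofReal_ne_zero_iff]
            positivity
        _ ≤ _ := by
            apply ENNReal.tsum_le_tsum
            intro k
            rw [indicator_of_mem]
            · apply ENNReal.ofReal_le_ofReal
              apply Real.rpow_le_rpow (by positivity) _ hβ.le
              gcongr
              nlinarith [one_le_pow₀ (M₀ := ℝ) (n := k) (a := 2) (by norm_num)]
            · change infDist y E < _
              rw [← h0]; positivity
    rw [this]; exact le_top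
  · obtain ⟨k, hk1, hk2⟩ : ∃ k : ℕ, (1 / 2 : ℝ) ^ k * R / 4 ≤ infDist y E ∧
        infDist y E < (1 / 2) ^ k * R := by
      obtain ⟨k, h1, h2⟩ := exists_nat_pow_near_of_lt_one (x := infDist y E / R) (y := (1 / 2 : ℝ))
        (by positivity) (by rw [div_le_one hR]; exact hy.le) (by norm_num) (by norm_num)
      rw [lt_div_iff₀ hR] at h1
      rw [div_le_iff₀ hR] at h2
      cases k with
      | zero => exact ⟨0, by simp at h1 ⊢; linarith, by simpa using hy⟩
      | succ k =>
        refine ⟨k, by rw [pow_succ, pow_succ] at h1; linarith, lt_of_le_of_lt h2 ?_⟩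
        rw [pow_succ]
        nlinarith [show 0 < (1 / 2 : ℝ) ^ k * R by positivity]
    refine le_trans ?_ (ENNReal.le_tsum k)
    rw [indicator_of_mem (by exact hk2)]
    unfold distWeight
    rw [ENNReal.ofReal_rpow_of_pos h0]
    apply ENNReal.ofReal_le_ofReal
    rw [Real.rpow_neg h0.le, ← Real.inv_rpow h0.le]
    apply Real.rpow_le_rpow (by positivity) _ hβ.le
    rw [inv_le_comm₀ h0 (by positivity)]
    refine le_trans (le_of_eq ?_) hk1
    rw [one_div, inv_pow]
    field_simp

lemma aikawa {n : ℕ} [Nontrivial (Eu n)] {E : Set (Eu n)} (hE : E.Nonempty) {s : ℝ}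
    (hs : s ∈ assouadDimBddSet E) {β : ℝ} (hβ : 0 < β) (hβs : β < n - s) :
    ∃ C : ℝ, 0 < C ∧ ∀ x ∈ E, ∀ R : ℝ, 0 < R →
      ∫⁻ y in ball x R, distWeight E β y ≤
        ENNReal.ofReal (C * R ^ (-β)) * volume (ball x R) := by
  obtain ⟨C, hC, hT⟩ := tube_bound hE hs
  set q : ℝ := 2 ^ β * (1 / 2) ^ (n - s) with hq
  have hq0 : 0 < q := by positivity
  have hq1 : q < 1 := by
    rw [hq, one_div, Real.inv_rpow (by norm_num), ← Real.rpow_neg (by norm_num),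
      ← Real.rpow_add (by norm_num)]
    exact Real.rpow_lt_one_of_one_lt_of_neg (by norm_num) (by linarith)
  have hq2 : 0 < 1 - q := by linarith
  refine ⟨C * 4 ^ β * (1 - q)⁻¹, by positivity, ?_⟩
  intro x hx R hR
  have hm : ∀ k : ℕ, MeasurableSet {z : Eu n | infDist z E < (1 / 2) ^ k * R} := fun k =>
    measurableSet_lt measurable_infDist measurable_const
  calc ∫⁻ y in ball x R, distWeight E β y
      ≤ ∫⁻ y in ball x R, ∑' k : ℕ, ({z : Eu n | infDist z E < (1 / 2) ^ k * R}).indicator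
          (fun _ => ENNReal.ofReal ((4 * 2 ^ k / R) ^ β)) y := by
        apply setLIntegral_mono' measurableSet_ball
        intro y hy
        exact distWeight_le_tsum E hβ hR y ((infDist_le_dist_of_mem hx).trans_lt hy)
    _ = ∑' k : ℕ, ENNReal.ofReal ((4 * 2 ^ k / R) ^ β) *
          volume ({z : Eu n | infDist z E < (1 / 2) ^ k * R} ∩ ball x R) := by
        rw [lintegral_tsum]
        · congr 1
          ext k
          rw [lintegral_indicator (hm k), setLIntegral_const, Measure.restrict_apply (hm k)]
        · intro k
          exact (measurable_const.indicator (hm k)).aemeasurable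
    _ ≤ ∑' k : ℕ, ENNReal.ofReal (C * 4 ^ β * R ^ (-β)) * ENNReal.ofReal q ^ k *
          volume (ball x R) := by
        apply ENNReal.tsum_le_tsum
        intro k
        have hk : (1 / 2 : ℝ) ^ k ≤ 1 := pow_le_one₀ (by norm_num) (by norm_num)
        refine (mul_le_mul_right (hT x hx ((1 / 2) ^ k * R) R (by positivity)
          (by nlinarith)) _).trans ?_
        rw [← mul_assoc]
        refine mul_le_mul_left (le_of_eq ?_) _
        rw [← ENNReal.ofReal_pow hq0.le, ← ENNReal.ofReal_mul (by positivity),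
          ← ENNReal.ofReal_mul (by positivity)]
        congr 1
        rw [mul_div_cancel_right₀ _ hR.ne', hq, mul_pow, Real.div_rpow (by positivity) hR.le,
          Real.mul_rpow (by positivity) (by positivity), Real.rpow_neg hR.le,
          ← Real.rpow_natCast, ← Real.rpow_natCast, ← Real.rpow_mul (by norm_num),
          ← Real.rpow_mul (by norm_num), mul_comm (k : ℝ) β, mul_comm (k : ℝ) (n - s),
          Real.rpow_mul (by norm_num), Real.rpow_mul (by norm_num), Real.rpow_natCast,
          Real.rpow_natCast]
        ring
    _ = ENNReal.ofReal (C * 4 ^ β * (1 - q)⁻¹ * R ^ (-β)) * volume (ball x R) := by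
        rw [ENNReal.tsum_mul_right, ENNReal.tsum_mul_left, ENNReal.tsum_geometric]
        congr 1
        rw [← ENNReal.ofReal_one, ← ENNReal.ofReal_sub _ hq0.le,
          ← ENNReal.ofReal_inv_of_pos (by linarith), ← ENNReal.ofReal_mul (by positivity)]
        congr 1
        ring

lemma avg_bound {n : ℕ} [Nontrivial (Eu n)] {E : Set (Eu n)} (hE : E.Nonempty) {s : ℝ}
    (hs : s ∈ assouadDimBddSet E) {β : ℝ} (hβs : β < n - s) :
    ∃ C : ℝ, 0 < C ∧ ∀ (x : Eu n) (r : ℝ), 0 < r →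
      ∫⁻ y in ball x r, distWeight E β y ≤
        ENNReal.ofReal (C * (max r (infDist x E)) ^ (-β)) * volume (ball x r) := by
  have ptwise : ∀ (x : Eu n) (r : ℝ) (c : ℝ≥0∞), (∀ y ∈ ball x r, distWeight E β y ≤ c) →
      ∫⁻ y in ball x r, distWeight E β y ≤ c * volume (ball x r) := by
    intro x r c h
    rw [← setLIntegral_const]
    exact setLIntegral_mono' measurableSet_ball h
  rcases le_or_gt β 0 with hβ | hβ
  · refine ⟨2 ^ (-β), by positivity, ?_⟩
    intro x r hr
    apply ptwise
    intro y hy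
    unfold distWeight
    rw [ENNReal.ofReal_rpow_of_nonneg infDist_nonneg (by linarith)]
    apply ENNReal.ofReal_le_ofReal
    rw [← Real.mul_rpow (by norm_num) (by positivity)]
    apply Real.rpow_le_rpow infDist_nonneg _ (by linarith)
    rw [mem_ball] at hy
    have := infDist_le_infDist_add_dist (x := y) (y := x) (s := E)
    linarith [le_max_left r (infDist x E), le_max_right r (infDist x E)]
  · obtain ⟨C, hC, hA⟩ := aikawa hE hs hβ hβs
    refine ⟨max (2 ^ β) (C * 3 ^ (n - β) * 2 ^ β), by positivity, ?_⟩
    intro x r hr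
    have hm : 0 < max r (infDist x E) := by positivity
    rcases le_or_gt (2 * r) (infDist x E) with h | h
    · apply ptwise
      intro y hy
      rw [mem_ball] at hy
      have := infDist_le_infDist_add_dist (x := x) (y := y) (s := E)
      have h1 : infDist x E / 2 ≤ infDist y E := by linarith [dist_comm x y]
      have h2 : 0 < infDist y E := by linarith
      unfold distWeight
      rw [ENNReal.ofReal_rpow_of_pos h2]
      apply ENNReal.ofReal_le_ofReal
      have h3 : max r (infDist x E) = infDist x E := max_eq_right (by linarith)
      calc infDist y E ^ (-β) ≤ (infDist x E / 2) ^ (-β) :=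
            Real.rpow_le_rpow_of_nonpos (by linarith) h1 (by linarith)
        _ = 2 ^ β * (max r (infDist x E)) ^ (-β) := by
            rw [h3, Real.div_rpow infDist_nonneg (by norm_num), Real.rpow_neg (by norm_num : (0:ℝ) ≤ 2)]
            field_simp
        _ ≤ _ := by
            gcongr
            exact le_max_left _ _
    · obtain ⟨e, he, hxe⟩ := (infDist_lt_iff hE).1 h
      have hsub : ball x r ⊆ ball e (3 * r) := ball_subset_ball' (by linarith)
      refine (lintegral_mono_set hsub).trans ((hA e he (3 * r) (by positivity)).trans ?_)
      have hu := uvol_pos n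
      rw [vol_ball _ hr, vol_ball _ (by positivity), ← ENNReal.ofReal_mul (by positivity),
        ← ENNReal.ofReal_mul (by positivity)]
      apply ENNReal.ofReal_le_ofReal
      have h1 : max r (infDist x E) ≤ 2 * r := max_le (by linarith) h.le
      have h2 : r ^ (-β) ≤ 2 ^ β * (max r (infDist x E)) ^ (-β) := by
        calc r ^ (-β) ≤ (max r (infDist x E) / 2) ^ (-β) :=
            Real.rpow_le_rpow_of_nonpos (by linarith) (by linarith) (by linarith)
        _ = _ := by
            rw [Real.div_rpow hm.le (by norm_num), Real.rpow_neg (by norm_num : (0:ℝ) ≤ 2)]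
            field_simp
      calc C * (3 * r) ^ (-β) * (uvol n * (3 * r) ^ (n : ℝ))
          = (C * 3 ^ (n - β)) * r ^ (-β) * (uvol n * r ^ (n : ℝ)) := by
            rw [Real.mul_rpow (by norm_num) hr.le, Real.mul_rpow (by norm_num) hr.le,
              sub_eq_add_neg, Real.rpow_add (by norm_num)]
            ring
        _ ≤ (C * 3 ^ (n - β)) * (2 ^ β * (max r (infDist x E)) ^ (-β)) * (uvol n * r ^ (n : ℝ)) := by
            gcongr
        _ = (C * 3 ^ (n - β) * 2 ^ β) * (max r (infDist x E)) ^ (-β) * (uvol n * r ^ (n : ℝ)) := by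
            ring
        _ ≤ _ := by
            gcongr
            exact le_max_right _ _

lemma half_bound {n : ℕ} [Nontrivial (Eu n)] {E : Set (Eu n)} (hE : E.Nonempty) {s : ℝ}
    (hs : s ∈ assouadDimBddSet E) (hsn : s < n) :
    ∃ c : ℝ, 0 < c ∧ ∀ x ∈ E, ∀ R : ℝ, 0 < R →
      volume (ball x R) ≤ 2 * volume ({y | c * R ≤ infDist y E} ∩ ball x R) := by
  obtain ⟨C, hC, hT⟩ := tube_bound hE hs
  have hns : 0 < n - s := by linarith
  set C' := max C 1 with hC'
  have hC'1 : 1 ≤ C' := le_max_right _ _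
  have hC'0 : 0 < C' := by linarith
  set c : ℝ := (1 / (2 * C')) ^ (1 / (n - s)) with hc
  have hc0 : 0 < c := by positivity
  have hc1 : c ≤ 1 := by
    apply Real.rpow_le_one (by positivity) _ (by positivity)
    rw [div_le_one (by positivity)]; linarith
  have hcs : c ^ (n - s) = 1 / (2 * C') := by
    rw [hc, ← Real.rpow_mul (by positivity), one_div_mul_cancel hns.ne', Real.rpow_one]
  refine ⟨c, hc0, ?_⟩
  intro x hx R hR
  have h1 := hT x hx (c * R) R (by positivity) (by nlinarith)
  have h2 : C * (c * R / R) ^ (n - s) ≤ 1 / 2 := by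
    rw [mul_div_assoc, div_self hR.ne', mul_one, hcs]
    calc C * (1 / (2 * C')) ≤ C' * (1 / (2 * C')) := by
          gcongr; exact le_max_left _ _
      _ = 1 / 2 := by field_simp
  have h3 : volume ({y | infDist y E < c * R} ∩ ball x R) ≤ volume (ball x R) / 2 := by
    refine h1.trans ?_
    rw [ENNReal.div_eq_inv_mul]
    gcongr
    refine (ENNReal.ofReal_le_ofReal h2).trans ?_
    rw [one_div, ENNReal.ofReal_inv_of_pos (by norm_num)]
    simp
  have hfin : volume (ball x R) ≠ ∞ := measure_ball_lt_top.ne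
  have h4 : volume (ball x R) ≤ volume ({y | infDist y E < c * R} ∩ ball x R) +
      volume ({y | c * R ≤ infDist y E} ∩ ball x R) := by
    refine (measure_mono ?_).trans (measure_union_le _ _)
    intro y hy
    rcases lt_or_ge (infDist y E) (c * R) with h | h
    · exact Or.inl ⟨h, hy⟩
    · exact Or.inr ⟨h, hy⟩
  have h5 : volume (ball x R) / 2 + volume (ball x R) / 2 ≤ volume (ball x R) / 2 +
      volume ({y | c * R ≤ infDist y E} ∩ ball x R) := by
    rw [ENNReal.add_halves]
    exact h4.trans (by gcongr)
  have h6 := (ENNReal.add_le_add_iff_left (ENNReal.div_ne_top hfin (by norm_num))).1 h5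
  calc volume (ball x R) = 2 * (volume (ball x R) / 2) := by
        rw [ENNReal.mul_div_cancel (by norm_num) (by norm_num)]
    _ ≤ _ := by gcongr

lemma geom_sum_le {α b u : ℝ} (hα : 0 < α) (hb : 0 < b) (hu : 0 < u) (K : ℕ) :
    ∑ k ∈ Finset.range K, (if b * 2 ^ (k + 1) < u then (b * 2 ^ (k + 1)) ^ α else 0) ≤
      (1 - 2 ^ (-α))⁻¹ * (min (b * 2 ^ K) u) ^ α := by
  have hq : (2 : ℝ) ^ (-α) < 1 := Real.rpow_lt_one_of_one_lt_of_neg (by norm_num) (by linarith)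
  have hD : 0 < 1 - (2 : ℝ) ^ (-α) := by linarith
  induction K with
  | zero =>
    simp only [Finset.range_zero, Finset.sum_empty]
    positivity
  | succ K ih =>
    rw [Finset.sum_range_succ]
    split_ifs with h
    · have h1 : min (b * 2 ^ (K + 1)) u = b * 2 ^ (K + 1) := min_eq_left h.le
      have h2 : (min (b * 2 ^ K) u) ^ α ≤ (b * 2 ^ (K + 1)) ^ α * 2 ^ (-α) := by
        calc (min (b * 2 ^ K) u) ^ α ≤ (b * 2 ^ K) ^ α :=
              Real.rpow_le_rpow (by positivity) (min_le_left _ _) hα.le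
          _ = _ := by
              rw [pow_succ, ← mul_assoc,
                Real.mul_rpow (x := b * 2 ^ K) (by positivity) (by norm_num),
                mul_assoc, ← Real.rpow_add (by norm_num)]
              simp
      rw [h1]
      calc _ ≤ (1 - 2 ^ (-α))⁻¹ * ((b * 2 ^ (K + 1)) ^ α * 2 ^ (-α)) + (b * 2 ^ (K + 1)) ^ α := by
            gcongr
            exact ih.trans (by gcongr)
        _ = _ := by
            field_simp
            ring
    · rw [add_zero]
      refine ih.trans ?_
      gcongr
      · norm_num
      · omega

lemma indicator_sum_le {n : ℕ} (E : Set (Eu n)) {α : ℝ} (hα : 0 < α)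
    {R : ℝ} (hR : 0 < R) (K : ℕ) (y : Eu n) :
    ∑ k ∈ Finset.range K, ({z : Eu n | infDist z E < (1 / 2) ^ (k + 1) * R}).indicator
      (fun _ => ENNReal.ofReal ((1 / R * 2 ^ (k + 1)) ^ α)) y ≤
      ENNReal.ofReal ((1 - 2 ^ (-α))⁻¹) * distWeight E α y := by
  have hq : (2 : ℝ) ^ (-α) < 1 := Real.rpow_lt_one_of_one_lt_of_neg (by norm_num) (by linarith)
  have hD : 0 < 1 - (2 : ℝ) ^ (-α) := by linarith
  rcases (infDist_nonneg (x := y) (s := E)).eq_or_lt with h0 | h0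
  · have : distWeight E α y = ∞ := by
      unfold distWeight
      rw [← h0, ENNReal.ofReal_zero, ENNReal.zero_rpow_of_neg (by linarith)]
    rw [this, ENNReal.mul_top]
    · exact le_top
    · rw [ENNReal.ofReal_ne_zero_iff]; positivity
  · have h := geom_sum_le hα (show 0 < 1 / R by positivity) (inv_pos.2 h0) K
    have h2 : ∀ k, ({z : Eu n | infDist z E < (1 / 2) ^ (k + 1) * R}).indicator
      (fun _ => ENNReal.ofReal ((1 / R * 2 ^ (k + 1)) ^ α)) y =
        ENNReal.ofReal (if 1 / R * 2 ^ (k + 1) < (infDist y E)⁻¹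
          then (1 / R * 2 ^ (k + 1)) ^ α else 0) := by
      intro k
      have : infDist y E < (1 / 2) ^ (k + 1) * R ↔ 1 / R * 2 ^ (k + 1) < (infDist y E)⁻¹ := by
        rw [lt_inv_comm₀ (by positivity) h0, one_div, one_div, mul_inv, inv_inv, inv_pow, mul_comm]
      by_cases hk : infDist y E < (1 / 2) ^ (k + 1) * R
      · rw [indicator_of_mem (by exact hk), if_pos (this.1 hk)]
      · rw [indicator_of_notMem (by exact hk), if_neg (by rwa [← this])]
        simp
    simp_rw [h2]
    rw [← ENNReal.ofReal_sum_of_nonneg (fun k _ => by positivity)]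
    unfold distWeight
    rw [ENNReal.ofReal_rpow_of_pos h0, ← ENNReal.ofReal_mul (by positivity)]
    apply ENNReal.ofReal_le_ofReal
    refine h.trans ?_
    rw [Real.rpow_neg h0.le, ← Real.inv_rpow h0.le]
    gcongr
    exact min_le_right _ _

lemma self_step {n : ℕ} [Nontrivial (Eu n)] {E : Set (Eu n)} {α : ℝ} (hα : 0 < α)
    {C : ℝ} (hC : 0 < C) (hA : ∀ x ∈ E, ∀ R : ℝ, 0 < R →
      ∫⁻ y in ball x R, distWeight E α y ≤
        ENNReal.ofReal (C * R ^ (-α)) * volume (ball x R)) :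
    ∃ K : ℕ, 1 ≤ K ∧ ∀ x ∈ E, ∀ R : ℝ, 0 < R → ∃ k : ℕ, 1 ≤ k ∧ k ≤ K ∧
      ∃ F : Finset (Eu n), (∀ y ∈ F, y ∈ E) ∧ (F.card : ℝ) ≤ 1 / 2 * (2 ^ k) ^ (n - α) ∧
        E ∩ ball x R ⊆ ⋃ y ∈ F, ball y ((1 / 2) ^ k * R) := by
  have hq : (2 : ℝ) ^ (-α) < 1 := Real.rpow_lt_one_of_one_lt_of_neg (by norm_num) (by linarith)
  have hD : 0 < 1 - (2 : ℝ) ^ (-α) := by linarith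
  have hu := uvol_pos n
  set D := (1 - (2 : ℝ) ^ (-α))⁻¹ with hDdef
  have hD0 : 0 < D := by positivity
  obtain ⟨K, hK⟩ := exists_nat_gt (2 * 2 ^ (n : ℝ) * D * C * 2 ^ (-α) * 2 ^ (n : ℝ))
  refine ⟨K, ?_, ?_⟩
  · have : (0 : ℝ) < K := lt_trans (by positivity) hK
    exact_mod_cast this
  intro x hx R hR
  by_contra hcon
  push Not at hcon
  have hm : ∀ k : ℕ, MeasurableSet {z : Eu n | infDist z E < (1 / 2) ^ (k + 1) * R} := fun k =>
    measurableSet_lt measurable_infDist measurable_const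
  have hk : ∀ k ∈ Finset.range K, ENNReal.ofReal (1 / 2 * uvol n * (R / 2) ^ (n : ℝ) * R ^ (-α)) ≤
      ENNReal.ofReal ((1 / R * 2 ^ (k + 1)) ^ α) *
        volume ({z : Eu n | infDist z E < (1 / 2) ^ (k + 1) * R} ∩ ball x (2 * R)) := by
    intro k hk
    have ht : 0 < (1 / 2 : ℝ) ^ (k + 1) * R := by positivity
    obtain ⟨F, hF1, hF2, hF3⟩ := packing E x R _ ht
    have hcard : 1 / 2 * ((2 : ℝ) ^ (k + 1)) ^ (n - α) ≤ F.card := by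
      by_contra hlt
      exact hcon (k + 1) (by omega) (by have := Finset.mem_range.1 hk; omega) F
        (fun y hy => (hF1 y hy).1) (not_le.1 hlt).le hF2
    have hle : (1 / 2 : ℝ) ^ (k + 1) ≤ 1 := pow_le_one₀ (by norm_num) (by norm_num)
    have h1 : volume ({y | infDist y E < (1 / 2) ^ (k + 1) * R / 2} ∩
        ball x (R + (1 / 2) ^ (k + 1) * R / 2)) ≤
        volume ({z : Eu n | infDist z E < (1 / 2) ^ (k + 1) * R} ∩ ball x (2 * R)) := by
      apply measure_mono
      apply inter_subset_inter
      · intro y hy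
        exact lt_trans (show infDist y E < _ from hy) (by linarith)
      · exact ball_subset_ball (by nlinarith)
    refine le_trans ?_ (mul_le_mul_right (hF3.trans h1) _)
    rw [← ENNReal.ofReal_natCast, ← ENNReal.ofReal_mul (by positivity),
      ← ENNReal.ofReal_mul (by positivity)]
    apply ENNReal.ofReal_le_ofReal
    calc 1 / 2 * uvol n * (R / 2) ^ (n : ℝ) * R ^ (-α)
        = (1 / R * 2 ^ (k + 1)) ^ α * ((1 / 2 * ((2 : ℝ) ^ (k + 1)) ^ (n - α)) *
          (uvol n * ((1 / 2) ^ (k + 1) * R / 2) ^ (n : ℝ))) := by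
          have hP : (0 : ℝ) < 2 ^ (k + 1) := by positivity
          rw [one_div_pow, Real.rpow_sub hP, Real.rpow_neg hR.le, mul_div_assoc _ R,
            Real.mul_rpow (by positivity) (by positivity),
            Real.mul_rpow (by positivity) (by positivity), Real.div_rpow (by positivity) hP.le,
            Real.div_rpow (by positivity) hR.le, Real.one_rpow, Real.one_rpow]
          field_simp
      _ ≤ _ := by gcongr
  have h2 := Finset.sum_le_sum hk
  rw [Finset.sum_const, Finset.card_range, nsmul_eq_mul] at h2
  have h3 : ∑ k ∈ Finset.range K, ENNReal.ofReal ((1 / R * 2 ^ (k + 1)) ^ α) *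
        volume ({z : Eu n | infDist z E < (1 / 2) ^ (k + 1) * R} ∩ ball x (2 * R)) =
      ∫⁻ y in ball x (2 * R), ∑ k ∈ Finset.range K,
        ({z : Eu n | infDist z E < (1 / 2) ^ (k + 1) * R}).indicator
          (fun _ => ENNReal.ofReal ((1 / R * 2 ^ (k + 1)) ^ α)) y := by
    rw [lintegral_finsetSum]
    · apply Finset.sum_congr rfl
      intro k _
      rw [lintegral_indicator (hm k), setLIntegral_const, Measure.restrict_apply (hm k)]
    · intro k _
      exact measurable_const.indicator (hm k)
  rw [h3] at h2
  have h4 := h2.trans (setLIntegral_mono' measurableSet_ball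
    (fun y _ => indicator_sum_le E hα hR K y))
  rw [lintegral_const_mul _ (measurable_distWeight E α)] at h4
  have h5 := h4.trans (mul_le_mul_right (hA x hx (2 * R) (by positivity)) _)
  rw [vol_ball x (by positivity), ← ENNReal.ofReal_natCast, ← ENNReal.ofReal_mul (by positivity),
    ← ENNReal.ofReal_mul (by positivity), ← ENNReal.ofReal_mul (by positivity),
    ENNReal.ofReal_le_ofReal_iff (by positivity)] at h5
  have h6 : 0 < uvol n * R ^ (n : ℝ) * R ^ (-α) / (2 * 2 ^ (n : ℝ)) := by positivity
  have h7 := mul_lt_mul_of_pos_right hK h6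
  apply absurd h5
  rw [not_le]
  refine lt_of_le_of_lt (le_of_eq ?_) (h7.trans_le (le_of_eq ?_))
  · rw [Real.mul_rpow (by norm_num) hR.le, Real.mul_rpow (by norm_num) hR.le, ← hDdef]
    field_simp
  · rw [Real.div_rpow hR.le (by norm_num)]
    field_simp

lemma dim_lt_of_aikawa {n : ℕ} [Nontrivial (Eu n)] {E : Set (Eu n)} (hE : E.Nonempty)
    {α : ℝ} (hα : 0 < α)
    {C : ℝ} (hC : 0 < C) (hA : ∀ x ∈ E, ∀ R : ℝ, 0 < R →
      ∫⁻ y in ball x R, distWeight E α y ≤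
        ENNReal.ofReal (C * R ^ (-α)) * volume (ball x R)) :
    α < n - assouadDim E := by
  classical
  obtain ⟨K, hK1, hK⟩ := self_step hα hC hA
  have hK0 : (0 : ℝ) < K := by exact_mod_cast hK1
  set s : ℝ := n - α - 1 / K with hs
  have hcount : ∀ k : ℕ, k ≤ K → 1 / 2 * ((2 : ℝ) ^ k) ^ (n - α) ≤ (2 ^ k) ^ s := by
    intro k hk
    rw [← Real.rpow_natCast, ← Real.rpow_mul (by norm_num), ← Real.rpow_mul (by norm_num), one_div,
      ← Real.rpow_neg_one, ← Real.rpow_add (by norm_num)]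
    apply Real.rpow_le_rpow_of_exponent_le (by norm_num)
    rw [hs]
    have : (k : ℝ) * (1 / K) ≤ 1 := by
      rw [mul_one_div, div_le_one hK0]
      exact_mod_cast hk
    linarith
  set M : ℝ := max 1 ((2 ^ K) ^ s) with hM
  have hM1 : 1 ≤ M := le_max_left _ _
  have hbase : ∀ x ∈ E, ∀ r R : ℝ, 0 < r → (1 / 2) ^ K * r ≤ R → R ≤ r →
      ∃ F : Finset (Eu n), (F.card : ℝ) ≤ M * (R / r) ^ s ∧ E ∩ ball x R ⊆ ⋃ y ∈ F, ball y r := by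
    intro x hx r R hr h1 h2
    refine ⟨{x}, ?_, ?_⟩
    · have hR : 0 < R := lt_of_lt_of_le (by positivity) h1
      have hRr : (1 / 2) ^ K ≤ R / r := by rwa [le_div_iff₀ hr]
      have hRr1 : R / r ≤ 1 := by rwa [div_le_one hr]
      rw [Finset.card_singleton, Nat.cast_one]
      rcases le_or_gt 0 s with h | h
      · calc (1 : ℝ) = (2 ^ K) ^ s * ((1 / 2) ^ K) ^ s := by
              rw [← Real.mul_rpow (by positivity) (by positivity), ← mul_pow]
              norm_num
          _ ≤ _ := by
              gcongr
              exact le_max_right _ _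
      · have := Real.one_le_rpow_of_pos_of_le_one_of_nonpos (show 0 < R / r by positivity) hRr1 h.le
        nlinarith
    · rintro y ⟨_, hy⟩
      simp only [Finset.mem_singleton, iUnion_iUnion_eq_left]
      exact ball_subset_ball h2 hy
  have hind : ∀ j : ℕ, ∀ x ∈ E, ∀ r R : ℝ, 0 < r → (1 / 2) ^ K * r ≤ R → R ≤ 2 ^ j * r →
      ∃ F : Finset (Eu n), (F.card : ℝ) ≤ M * (R / r) ^ s ∧ E ∩ ball x R ⊆ ⋃ y ∈ F, ball y r := by
    intro j
    induction j with
    | zero =>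
      intro x hx r R hr h1 h2
      exact hbase x hx r R hr h1 (by simpa using h2)
    | succ j ih =>
      intro x hx r R hr h1 h2
      rcases le_or_gt R r with h | h
      · exact hbase x hx r R hr h1 h
      have hR : 0 < R := by linarith
      obtain ⟨k, hk1, hkK, F, hFE, hFc, hFcov⟩ := hK x hx R hR
      have hp : (1 / 2 : ℝ) ^ K ≤ (1 / 2) ^ k := pow_le_pow_of_le_one (by norm_num) (by norm_num) hkK
      have hp1 : (1 / 2 : ℝ) ^ k ≤ (1 / 2) ^ 1 := pow_le_pow_of_le_one (by norm_num) (by norm_num) hk1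
      have hG : ∀ y : Eu n, ∃ G : Finset (Eu n), y ∈ F →
          (G.card : ℝ) ≤ M * ((1 / 2) ^ k * R / r) ^ s ∧
          E ∩ ball y ((1 / 2) ^ k * R) ⊆ ⋃ z ∈ G, ball z r := by
        intro y
        by_cases hy : y ∈ F
        · obtain ⟨G, hG⟩ := ih y (hFE y hy) r ((1 / 2) ^ k * R) hr (by gcongr) (by
            rw [pow_succ] at h2
            nlinarith)
          exact ⟨G, fun _ => hG⟩
        · exact ⟨∅, fun h => absurd h hy⟩
      choose G hG using hG
      refine ⟨F.biUnion G, ?_, ?_⟩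
      · calc (((F.biUnion G).card : ℕ) : ℝ) ≤ ((∑ y ∈ F, (G y).card : ℕ) : ℝ) := by
              exact_mod_cast Finset.card_biUnion_le
          _ = ∑ y ∈ F, ((G y).card : ℝ) := by push_cast; rfl
          _ ≤ ∑ y ∈ F, M * ((1 / 2) ^ k * R / r) ^ s := Finset.sum_le_sum (fun y hy => (hG y hy).1)
          _ = F.card * (M * ((1 / 2) ^ k * R / r) ^ s) := by
              rw [Finset.sum_const, nsmul_eq_mul]
          _ ≤ (2 ^ k) ^ s * (M * ((1 / 2) ^ k * R / r) ^ s) := by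
              gcongr
              exact hFc.trans (hcount k hkK)
          _ = M * (R / r) ^ s := by
              rw [mul_left_comm, ← Real.mul_rpow (by positivity) (by positivity), mul_div_assoc,
                ← mul_assoc, ← mul_pow]
              norm_num
      · rintro y ⟨hyE, hy⟩
        have := hFcov ⟨hyE, hy⟩
        simp only [mem_iUnion] at this
        obtain ⟨z, hz, hyz⟩ := this
        have := (hG z hz).2 ⟨hyE, hyz⟩
        simp only [mem_iUnion] at this ⊢
        obtain ⟨w, hw, hyw⟩ := this
        exact ⟨w, Finset.mem_biUnion.2 ⟨z, hz, hw⟩, hyw⟩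
  have hs0 : 0 ≤ s := by
    by_contra hneg
    push Not at hneg
    obtain ⟨x, hx⟩ := hE
    have h2s : (2 : ℝ) ^ s < 1 := Real.rpow_lt_one_of_one_lt_of_neg (by norm_num) hneg
    obtain ⟨j, hj⟩ := exists_pow_lt_of_lt_one (show 0 < 1 / M by positivity) h2s
    obtain ⟨F, hF1, hF2⟩ := hind j x hx 1 (2 ^ j) one_pos (by
      rw [mul_one]
      exact (pow_le_one₀ (by norm_num) (by norm_num)).trans (one_le_pow₀ (by norm_num))) (by simp)
    have hxF := hF2 ⟨hx, mem_ball_self (by positivity)⟩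
    simp only [mem_iUnion] at hxF
    obtain ⟨z, hz, _⟩ := hxF
    have h1 : 1 ≤ F.card := Finset.card_pos.2 ⟨z, hz⟩
    have h1' : (1 : ℝ) ≤ F.card := by exact_mod_cast h1
    have he : ((2 : ℝ) ^ j) ^ s = (2 ^ s) ^ j := by
      rw [← Real.rpow_natCast, ← Real.rpow_natCast, ← Real.rpow_mul (by norm_num),
        ← Real.rpow_mul (by norm_num), mul_comm]
    rw [div_one, he] at hF1
    rw [lt_div_iff₀ (by positivity)] at hj
    linarith
  have hmem : s ∈ assouadDimBddSet E := by
    rw [mem_bddSet]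
    refine ⟨hs0, M, hM1, ?_⟩
    intro x hx r R hr hrR
    obtain ⟨j, hj⟩ := pow_unbounded_of_one_lt (R / r) (show (1 : ℝ) < 2 by norm_num)
    rw [div_lt_iff₀ hr] at hj
    refine hind j x hx r R hr ?_ hj.le
    have : (1 / 2 : ℝ) ^ K ≤ 1 := pow_le_one₀ (by norm_num) (by norm_num)
    nlinarith
  have : assouadDim E ≤ s := csInf_le ⟨0, fun t ht => ht.1⟩ hmem
  have h1K : 0 < 1 / (K : ℝ) := by positivity
  rw [hs] at this
  linarith

lemma dual_distWeight {n : ℕ} (E : Set (Eu n)) (α p : ℝ) (y : Eu n) :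
    distWeight E α y ^ (-(1 / (p - 1))) = distWeight E (-α / (p - 1)) y := by
  unfold distWeight
  rw [← ENNReal.rpow_mul]
  congr 1
  ring

lemma ae_infDist_pos {n : ℕ} [Nontrivial (Eu n)] {E : Set (Eu n)} (hE : E.Nonempty) {s : ℝ}
    (hs : s ∈ assouadDimBddSet E) (hsn : s < n) : ∀ᵐ y : Eu n, 0 < infDist y E := by
  obtain ⟨C, hC, hA⟩ := aikawa hE hs (β := (n - s) / 2) (by linarith) (by linarith)
  obtain ⟨x, hx⟩ := hE
  rw [← Measure.restrict_univ (μ := (volume : Measure (Eu n))), ← iUnion_ball_nat_succ x,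
    ae_restrict_iUnion_iff]
  intro k
  have h1 : ∫⁻ y in ball x ((k : ℝ) + 1), distWeight E ((n - s) / 2) y ≠ ∞ :=
    ((hA x hx (k + 1) (by positivity)).trans_lt
      (ENNReal.mul_lt_top ENNReal.ofReal_lt_top measure_ball_lt_top)).ne
  filter_upwards [ae_lt_top (measurable_distWeight E _) h1] with y hy
  refine infDist_nonneg.lt_of_ne' ?_
  intro h0
  unfold distWeight at hy
  rw [h0, ENNReal.ofReal_zero, ENNReal.zero_rpow_of_neg (by linarith)] at hy
  exact lt_irrefl _ hy

lemma isWeight_distWeight {n : ℕ} [Nontrivial (Eu n)] {E : Set (Eu n)} (hE : E.Nonempty) {s : ℝ}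
    (hs : s ∈ assouadDimBddSet E) (hsn : s < n) {β : ℝ} (hβ : β < n - s) :
    IsWeight volume (distWeight E β) := by
  refine ⟨measurable_distWeight E β, ?_, ?_⟩
  · filter_upwards [ae_infDist_pos hE hs hsn] with y hy
    unfold distWeight
    rw [ENNReal.ofReal_rpow_of_pos hy]
    exact ⟨by rw [ENNReal.ofReal_pos]; positivity, ENNReal.ofReal_ne_top⟩
  · obtain ⟨C, hC, h⟩ := avg_bound hE hs hβ
    intro x r hr
    exact ((h x r hr).trans_lt
      (ENNReal.mul_lt_top ENNReal.ofReal_lt_top measure_ball_lt_top)).ne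

lemma memAp_of_lt {n : ℕ} [Nontrivial (Eu n)] {E : Set (Eu n)} (hE : E.Nonempty) {s : ℝ}
    (hs : s ∈ assouadDimBddSet E) (hsn : s < n) {α p : ℝ} (hp : 1 < p) (h1 : α < n - s)
    (h2 : -α / (p - 1) < n - s) : MemAp volume (distWeight E α) p := by
  refine ⟨isWeight_distWeight hE hs hsn h1, ?_⟩
  obtain ⟨C, hC, hA⟩ := avg_bound hE hs h1
  obtain ⟨C', hC', hA'⟩ := avg_bound hE hs h2
  have hp0 : 0 < p - 1 := by linarith
  refine ⟨C * C' ^ (p - 1), by positivity, ?_⟩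
  intro x r hr
  simp_rw [dual_distWeight]
  have hm : 0 < max r (infDist x E) := by positivity
  set m := max r (infDist x E) with hmdef
  calc _ ≤ ENNReal.ofReal (C * m ^ (-α)) * ENNReal.ofReal (C' * m ^ (-(-α / (p - 1)))) ^ (p - 1) := by
        gcongr
        · exact ENNReal.div_le_of_le_mul (hA x r hr)
        · exact ENNReal.div_le_of_le_mul (hA' x r hr)
    _ = _ := by
        rw [ENNReal.ofReal_rpow_of_pos (by positivity), ← ENNReal.ofReal_mul (by positivity)]
        congr 1
        rw [Real.mul_rpow hC'.le (by positivity), ← Real.rpow_mul hm.le,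
          show -(-α / (p - 1)) * (p - 1) = α by field_simp, Real.rpow_neg hm.le]
        field_simp

lemma lower_avg {n : ℕ} [Nontrivial (Eu n)] {E : Set (Eu n)} (hE : E.Nonempty) {s : ℝ}
    (hs : s ∈ assouadDimBddSet E) (hsn : s < n) :
    ∃ c : ℝ, 0 < c ∧ ∀ γ : ℝ, 0 ≤ γ → ∀ x ∈ E, ∀ R : ℝ, 0 < R →
      ENNReal.ofReal ((c * R) ^ γ / 2) ≤
        (∫⁻ y in ball x R, distWeight E (-γ) y) / volume (ball x R) := by
  obtain ⟨c, hc, h⟩ := half_bound hE hs hsn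
  refine ⟨c, hc, ?_⟩
  intro γ hγ x hx R hR
  have hV : volume (ball x R) ≠ ∞ := measure_ball_lt_top.ne
  have hV0 : volume (ball x R) ≠ 0 := (measure_ball_pos volume x hR).ne'
  rw [ENNReal.le_div_iff_mul_le (Or.inl hV0) (Or.inl hV)]
  have hms : MeasurableSet ({y | c * R ≤ infDist y E} ∩ ball x R) :=
    (measurableSet_le measurable_const measurable_infDist).inter measurableSet_ball
  calc ENNReal.ofReal ((c * R) ^ γ / 2) * volume (ball x R)
      ≤ ENNReal.ofReal ((c * R) ^ γ / 2) * (2 * volume ({y | c * R ≤ infDist y E} ∩ ball x R)) := by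
        gcongr; exact h x hx R hR
    _ = ENNReal.ofReal ((c * R) ^ γ) * volume ({y | c * R ≤ infDist y E} ∩ ball x R) := by
        rw [← mul_assoc]
        congr 1
        rw [show (2 : ℝ≥0∞) = ENNReal.ofReal 2 by simp, ← ENNReal.ofReal_mul (by positivity)]
        congr 1
        ring
    _ = ∫⁻ y in ({y | c * R ≤ infDist y E} ∩ ball x R), ENNReal.ofReal ((c * R) ^ γ) := by
        rw [setLIntegral_const]
    _ ≤ ∫⁻ y in ({y | c * R ≤ infDist y E} ∩ ball x R), distWeight E (-γ) y := by
        apply setLIntegral_mono' hms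
        rintro y ⟨hy, _⟩
        have hy' : c * R ≤ infDist y E := hy
        unfold distWeight
        rw [neg_neg, ENNReal.ofReal_rpow_of_nonneg infDist_nonneg hγ]
        gcongr
    _ ≤ _ := lintegral_mono_set inter_subset_right

lemma lt_of_Ap {n : ℕ} [Nontrivial (Eu n)] {E : Set (Eu n)} (hE : E.Nonempty) {s : ℝ}
    (hs : s ∈ assouadDimBddSet E) (hsn : s < n) {α q : ℝ} (hα : 0 < α) (hq : 0 < q)
    {A : ℝ} (hA0 : 0 < A) (hA : ∀ x ∈ E, ∀ R : ℝ, 0 < R →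
      ((∫⁻ y in ball x R, distWeight E α y) / volume (ball x R)) *
      ((∫⁻ y in ball x R, distWeight E (-(α * q)) y) / volume (ball x R)) ^ (1 / q) ≤
        ENNReal.ofReal A) : α < n - assouadDim E := by
  obtain ⟨c, hc, hlow⟩ := lower_avg hE hs hsn
  refine dim_lt_of_aikawa hE hα (C := A / (c ^ α * (1 / 2) ^ (1 / q))) (by positivity) ?_
  intro x hx R hR
  have hV : volume (ball x R) ≠ ∞ := measure_ball_lt_top.ne
  have hV0 : volume (ball x R) ≠ 0 := (measure_ball_pos volume x hR).ne'
  have h1 := ENNReal.rpow_le_rpow (hlow (α * q) (by positivity) x hx R hR)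
    (show 0 ≤ 1 / q by positivity)
  have h2 := (mul_le_mul_right h1 _).trans (hA x hx R hR)
  rw [ENNReal.ofReal_rpow_of_pos (by positivity)] at h2
  have h3 : ((c * R) ^ (α * q) / 2) ^ (1 / q) = c ^ α * (1 / 2) ^ (1 / q) * R ^ α := by
    rw [div_eq_mul_one_div, Real.mul_rpow (by positivity) (by positivity),
      ← Real.rpow_mul (by positivity), mul_assoc α, mul_one_div_cancel hq.ne', mul_one,
      Real.mul_rpow hc.le hR.le]
    ring
  have h4 : 0 < c ^ α * (1 / 2) ^ (1 / q) * R ^ α := by positivity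
  rw [h3, ← ENNReal.le_div_iff_mul_le (Or.inl (by rw [ENNReal.ofReal_ne_zero_iff]; exact h4))
    (Or.inl ENNReal.ofReal_ne_top), ← ENNReal.ofReal_div_of_pos h4,
    ENNReal.div_le_iff hV0 hV] at h2
  refine h2.trans (le_of_eq ?_)
  rw [Real.rpow_neg hR.le]
  congr 2
  field_simp

lemma necessity {n : ℕ} [Nontrivial (Eu n)] {E : Set (Eu n)} (hE : E.Nonempty) {s : ℝ}
    (hs : s ∈ assouadDimBddSet E) (hsn : s < n) {α p : ℝ} (hp : 1 < p) {A : ℝ} (hA0 : 0 < A)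
    (hdim : assouadDim E < n)
    (hA : ∀ (x : Eu n) (r : ℝ), 0 < r →
    ((∫⁻ y in ball x r, distWeight E α y) / volume (ball x r)) *
      ((∫⁻ y in ball x r, distWeight E α y ^ (-(1 / (p - 1)))) / volume (ball x r)) ^ (p - 1) ≤
      ENNReal.ofReal A) :
    (1 - p) * (n - assouadDim E) < α ∧ α < n - assouadDim E := by
  have hp0 : 0 < p - 1 := by linarith
  have hd : 0 < n - assouadDim E := by linarith
  simp_rw [dual_distWeight] at hA
  constructor
  · rcases lt_or_ge α 0 with hα | hα
    · have hβ : 0 < -α / (p - 1) := div_pos (by linarith) hp0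
      have key := lt_of_Ap hE hs hsn (q := p - 1) (A := A ^ (1 / (p - 1))) hβ hp0 (by positivity) (by
        intro x _ R hR
        have h := ENNReal.rpow_le_rpow (hA x R hR) (show 0 ≤ 1 / (p - 1) by positivity)
        rw [ENNReal.mul_rpow_of_nonneg _ _ (by positivity), ← ENNReal.rpow_mul,
          mul_one_div_cancel hp0.ne', ENNReal.rpow_one, ENNReal.ofReal_rpow_of_pos hA0, mul_comm] at h
        rwa [show -(-α / (p - 1) * (p - 1)) = α by field_simp])
      rw [div_lt_iff₀ hp0] at key
      nlinarith
    · nlinarith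
  · rcases lt_or_ge 0 α with hα | hα
    · refine lt_of_Ap hE hs hsn (q := 1 / (p - 1)) hα (by positivity) hA0 ?_
      intro x _ R hR
      have h := hA x R hR
      rwa [show -(α * (1 / (p - 1))) = -α / (p - 1) by ring, one_div_one_div]
    · linarith

lemma Ap_of_A1 {n : ℕ} [Nontrivial (Eu n)] {w : Eu n → ℝ≥0∞} {p : ℝ} (hp : 1 < p) {A : ℝ≥0∞}
    (x : Eu n) {r : ℝ} (hr : 0 < r)
    (hA : ((∫⁻ y in ball x r, w y) / volume (ball x r)) *
      essSup (fun y => (w y)⁻¹) (volume.restrict (ball x r)) ≤ A) :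
    ((∫⁻ y in ball x r, w y) / volume (ball x r)) *
      ((∫⁻ y in ball x r, w y ^ (-(1 / (p - 1)))) / volume (ball x r)) ^ (p - 1) ≤ A := by
  have hp0 : 0 < p - 1 := by linarith
  refine le_trans ?_ hA
  gcongr
  set S := essSup (fun y => (w y)⁻¹) (volume.restrict (ball x r)) with hS
  have h1 : ∫⁻ y in ball x r, w y ^ (-(1 / (p - 1))) ≤ ∫⁻ y in ball x r, S ^ (1 / (p - 1)) := by
    apply lintegral_mono_ae
    filter_upwards [ENNReal.ae_le_essSup (μ := volume.restrict (ball x r)) (fun y => (w y)⁻¹)] with y hy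
    rw [ENNReal.rpow_neg, ← ENNReal.inv_rpow]
    exact ENNReal.rpow_le_rpow hy (by positivity)
  rw [setLIntegral_const] at h1
  have h2 := ENNReal.rpow_le_rpow (ENNReal.div_le_of_le_mul h1) hp0.le
  refine h2.trans (le_of_eq ?_)
  rw [← ENNReal.rpow_mul, one_div_mul_cancel hp0.ne', ENNReal.rpow_one]

theorem distWeight_memAp_iff_euclidean (n : ℕ)
    (E : Set (EuclideanSpace ℝ (Fin n))) (hE : E.Nonempty) (hEc : IsClosed E)
    (hdim : assouadDim E < n) (α : ℝ) :
    (∀ p : ℝ, 1 < p →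
      (MemAp volume (distWeight E α) p ↔
        (1 - p) * (n - assouadDim E) < α ∧ α < n - assouadDim E)) ∧
    (MemA1 volume (distWeight E α) ↔ 0 ≤ α ∧ α < n - assouadDim E) := by
  have hd0 : 0 ≤ assouadDim E := Real.sInf_nonneg (fun s hs => hs.1)
  have hn : 0 < n := by
    have : (0 : ℝ) < n := by linarith
    exact_mod_cast this
  have : Nonempty (Fin n) := ⟨⟨0, hn⟩⟩
  have : Nontrivial (Eu n) := inferInstance
  have hne : (assouadDimBddSet E).Nonempty := ⟨_, natCast_mem_bddSet E⟩
  obtain ⟨s, hs, hsn⟩ := exists_lt_of_csInf_lt hne hdim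
  have hd : 0 < n - assouadDim E := by linarith
  refine ⟨?_, ?_, ?_⟩
  · intro p hp
    have hp0 : 0 < p - 1 := by linarith
    constructor
    · rintro ⟨_, A, hA0, hA⟩
      exact necessity hE hs hsn hp hA0 hdim hA
    · rintro ⟨h1, h2⟩
      have h3 : -α / (p - 1) < n - assouadDim E := by
        rw [div_lt_iff₀ hp0]
        nlinarith
      obtain ⟨t, ht, htn⟩ := exists_lt_of_csInf_lt hne
        (show assouadDim E < min (n : ℝ) (min (n - α) (n - (-α / (p - 1)))) from
          lt_min hdim (lt_min (by linarith) (by linarith)))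
      rw [lt_min_iff, lt_min_iff] at htn
      exact memAp_of_lt hE ht htn.1 hp (by linarith) (by linarith)
  · rintro ⟨_, A, hA0, hA⟩
    have key : ∀ p : ℝ, 1 < p → (1 - p) * (n - assouadDim E) < α ∧ α < n - assouadDim E :=
      fun p hp => necessity hE hs hsn hp hA0 hdim (fun x r hr => Ap_of_A1 hp x hr (hA x r hr))
    refine ⟨?_, (key 2 (by norm_num)).2⟩
    by_contra hα
    push Not at hα
    have h := (key (1 + -α / (n - assouadDim E)) (by
      have : 0 < -α / (n - assouadDim E) := div_pos (by linarith) hd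
      linarith)).1
    rw [show (1 - (1 + -α / (n - assouadDim E))) * (n - assouadDim E) = α by
      field_simp; ring] at h
    exact lt_irrefl _ h
  · rintro ⟨h1, h2⟩
    obtain ⟨t, ht, htn⟩ := exists_lt_of_csInf_lt hne
        (show assouadDim E < min (n : ℝ) (n - α) from lt_min hdim (by linarith))
    rw [lt_min_iff] at htn
    have h3 : α < n - t := by linarith
    refine ⟨isWeight_distWeight hE ht htn.1 h3, ?_⟩
    obtain ⟨C, hC, hA⟩ := avg_bound hE ht h3
    refine ⟨C * 2 ^ α, by positivity, ?_⟩
    intro x r hr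
    have hm : 0 < max r (infDist x E) := by positivity
    have hm1 := le_max_left r (infDist x E)
    have hm2 := le_max_right r (infDist x E)
    set m := max r (infDist x E) with hmdef
    calc _ ≤ ENNReal.ofReal (C * m ^ (-α)) * ENNReal.ofReal ((2 * m) ^ α) := by
          gcongr
          · exact ENNReal.div_le_of_le_mul (hA x r hr)
          · refine essSup_le_of_ae_le _ ?_
            filter_upwards [ae_restrict_mem measurableSet_ball] with y hy
            unfold distWeight
            rw [ENNReal.rpow_neg, inv_inv, ENNReal.ofReal_rpow_of_nonneg infDist_nonneg h1]
            rw [mem_ball] at hy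
            have := infDist_le_infDist_add_dist (x := y) (y := x) (s := E)
            exact ENNReal.ofReal_le_ofReal (Real.rpow_le_rpow infDist_nonneg (by linarith) h1)
      _ = _ := by
          rw [← ENNReal.ofReal_mul (by positivity)]
          congr 1
          rw [Real.mul_rpow (by norm_num) hm.le, Real.rpow_neg hm.le]
          field_simp

end
end ApDistance
end

section
/- Let ∅ ≠ E ⊂ X be a closed set that satisfies the Aikawa condition with an exponent α > 0 and a constant C_0 ≥ 1. Then there exist δ > 0 and C ≥ 1, depending only on α, C_0 and the doubling constant of μ, such that E satisfies the Aikawa condition with the exponent α + δ and the constant C. -/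
open MeasureTheory Metric Set
open scoped ENNReal NNReal

namespace ApDistance

noncomputable section

variable {X : Type*} [MetricSpace X] [MeasurableSpace X] [BorelSpace X]

/-- The truncated neighbourhood of `E`. -/
def nbhdSet (E : Set X) (t : ℝ) : Set X := {y : X | infDist y E < t}

lemma measurableSet_nbhdSet (E : Set X) (t : ℝ) : MeasurableSet (nbhdSet E t) :=
  measurableSet_lt measurable_infDist measurable_const

lemma measurable_distWeight_s9 (E : Set X) (α : ℝ) : Measurable (distWeight E α) := by
  unfold distWeight
  exact (measurable_infDist.ennreal_ofReal).pow_const _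

lemma exists_cover (μ : Measure X) (hpf : BallsPosFinite μ) (E : Set X) (hE : E.Nonempty)
    (x : X) (R t : ℝ) (hR : 0 < R) (ht : 0 < t) :
    ∃ u : Set X, u ⊆ E ∧ u.Countable ∧ u.PairwiseDisjoint (fun z => ball z t) ∧
      (∀ z ∈ u, ball z t ⊆ ball x (R + 2 * t)) ∧
      nbhdSet E t ∩ ball x R ⊆ ⋃ z ∈ u, ball z (3 * t) := by
  obtain ⟨u, hu, hdisj, hcov⟩ := Vitali.exists_disjoint_subfamily_covering_enlargement
    (fun z : X => ball z t) (E ∩ ball x (R + t)) (fun _ => (1 : ℝ)) 2 (by norm_num)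
    (fun _ _ => zero_le_one) 1 (fun _ _ => le_rfl) (fun a _ => ⟨a, mem_ball_self ht⟩)
  have hsub : ∀ z ∈ u, ball z t ⊆ ball x (R + 2 * t) := by
    intro z hz
    apply ball_subset_ball'
    have := (hu hz).2
    rw [mem_ball] at this
    linarith
  refine ⟨u, fun z hz => (hu hz).1, ?_, hdisj, hsub, ?_⟩
  · have h := Measure.countable_meas_pos_of_disjoint_of_meas_iUnion_ne_top μ
      (As := fun z : u => ball (z : X) t) (fun _ => measurableSet_ball)
      (fun a b hab => hdisj a.2 b.2 (fun h => hab (Subtype.ext h)))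
      (ne_top_of_le_ne_top (hpf x (R + 2 * t) (by linarith)).2.ne
        (measure_mono (iUnion_subset fun z => hsub z z.2)))
    have h2 : {i : u | 0 < μ (ball (i : X) t)} = univ := by
      ext i
      simp [(hpf i t ht).1]
    rw [h2] at h
    exact countable_univ_iff.1 h
  · rintro y ⟨hy, hyR⟩
    obtain ⟨e, he, hye⟩ := (infDist_lt_iff hE).1 hy
    rw [mem_ball] at hyR
    have heR : e ∈ E ∩ ball x (R + t) := by
      refine ⟨he, ?_⟩
      rw [mem_ball]
      have := dist_triangle e y x
      rw [dist_comm e y] at this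
      linarith
    obtain ⟨b, hb, ⟨c, hc1, hc2⟩, -⟩ := hcov e heR
    simp only [mem_iUnion]
    refine ⟨b, hb, ?_⟩
    rw [mem_ball] at *
    have h1 := dist_triangle y e b
    have h2 := dist_triangle e c b
    rw [dist_comm e c] at h2
    linarith

/-- Lower bound of the weight on the neighbourhood. -/
lemma le_distWeight (E : Set X) (α : ℝ) (hα : 0 < α) (t : ℝ) (ht : 0 < t) (y : X)
    (hy : infDist y E < t) : ENNReal.ofReal (t ^ (-α)) ≤ distWeight E α y := by
  unfold distWeight
  rw [← ENNReal.ofReal_rpow_of_pos ht]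
  rw [ENNReal.rpow_neg, ENNReal.rpow_neg, ENNReal.inv_le_inv]
  exact ENNReal.rpow_le_rpow (ENNReal.ofReal_le_ofReal hy.le) hα.le

lemma mul_measure_le (μ : Measure X) (E : Set X) (α : ℝ) (hα : 0 < α) (t : ℝ) (ht : 0 < t)
    (S : Set X) (hS : MeasurableSet S) (hSt : S ⊆ nbhdSet E t) :
    ENNReal.ofReal (t ^ (-α)) * μ S ≤ μ.withDensity (distWeight E α) S := by
  rw [withDensity_apply _ hS, ← setLIntegral_const]
  exact setLIntegral_mono' hS fun y hy => le_distWeight E α hα t ht y (hSt hy)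

lemma aikawa_measure {μ : Measure X} {E : Set X} {α C : ℝ} (h : AikawaCondition μ E α C)
    {x : X} (hx : x ∈ E) {r : ℝ} (hr : 0 < r)
    (hr2 : ENNReal.ofReal r < 2 * EMetric.diam (univ : Set X)) :
    μ.withDensity (distWeight E α) (ball x r) ≤ ENNReal.ofReal (C * r ^ (-α)) * μ (ball x r) := by
  rw [withDensity_apply _ measurableSet_ball]
  exact h x hx r hr hr2

lemma half_ball {μ : Measure X} (hpf : BallsPosFinite μ) {E : Set X} {α C : ℝ} (hα : 0 < α)
    (hC : 1 ≤ C) (h : AikawaCondition μ E α C) {ε : ℝ} (hε : 0 < ε)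
    (hεC : C * ε ^ α ≤ 1 / 2) {z : X} (hz : z ∈ E) {t : ℝ} (ht : 0 < t)
    (ht2 : ENNReal.ofReal t < 2 * EMetric.diam (univ : Set X)) :
    ENNReal.ofReal (t ^ (-α)) * μ (ball z t) ≤
      2 * μ.withDensity (distWeight E α) (ball z t \ nbhdSet E (ε * t)) := by
  have hsub : ball z t ⊆ nbhdSet E t := fun y hy =>
    lt_of_le_of_lt (infDist_le_dist_of_mem hz) hy
  have hfin := (hpf z t ht).2.ne
  have hεt : 0 < ε * t := mul_pos hε ht
  have hm := measurableSet_nbhdSet E (ε * t)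
  have h1 : ENNReal.ofReal ((ε * t) ^ (-α)) * μ (ball z t ∩ nbhdSet E (ε * t)) ≤
      ENNReal.ofReal (C * t ^ (-α)) * μ (ball z t) :=
    (mul_measure_le μ E α hα _ hεt _ (measurableSet_ball.inter hm) inter_subset_right).trans
      ((measure_mono inter_subset_left).trans (aikawa_measure h hz ht ht2))
  have h2 : μ (ball z t ∩ nbhdSet E (ε * t)) ≤ ENNReal.ofReal (1 / 2) * μ (ball z t) := by
    have hp : (0 : ℝ) < (ε * t) ^ α := Real.rpow_pos_of_pos hεt _
    calc μ (ball z t ∩ nbhdSet E (ε * t))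
        = ENNReal.ofReal ((ε * t) ^ α) *
          (ENNReal.ofReal ((ε * t) ^ (-α)) * μ (ball z t ∩ nbhdSet E (ε * t))) := by
          rw [← mul_assoc, ← ENNReal.ofReal_mul hp.le, ← Real.rpow_add hεt]
          simp
      _ ≤ ENNReal.ofReal ((ε * t) ^ α) * (ENNReal.ofReal (C * t ^ (-α)) * μ (ball z t)) := by
          gcongr
      _ = ENNReal.ofReal (C * ε ^ α) * μ (ball z t) := by
          rw [← mul_assoc, ← ENNReal.ofReal_mul hp.le]
          congr 2
          rw [Real.mul_rpow hε.le ht.le, Real.rpow_neg ht.le]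
          have := (Real.rpow_pos_of_pos ht α).ne'
          field_simp
      _ ≤ _ := by gcongr
  have h3 : μ (ball z t) ≤ 2 * μ (ball z t \ nbhdSet E (ε * t)) := by
    have h4 := measure_inter_add_diff (μ := μ) (ball z t) hm
    have h5 : μ (ball z t ∩ nbhdSet E (ε * t)) ≠ ∞ :=
      ne_top_of_le_ne_top hfin (measure_mono inter_subset_left)
    have h6 : μ (ball z t \ nbhdSet E (ε * t)) ≠ ∞ :=
      ne_top_of_le_ne_top hfin (measure_mono diff_subset)
    lift μ (ball z t) to ℝ≥0 using hfin with a
    lift μ (ball z t ∩ nbhdSet E (ε * t)) to ℝ≥0 using h5 with b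
    lift μ (ball z t \ nbhdSet E (ε * t)) to ℝ≥0 using h6 with c
    have h2' : (b : ℝ) ≤ 1 / 2 * a := by
      have := ENNReal.toReal_mono (by finiteness) h2
      rw [ENNReal.toReal_mul, ENNReal.toReal_ofReal (by norm_num)] at this
      simpa using this
    have h4' : (b : ℝ) + c = a := by exact_mod_cast h4
    have : (a : ℝ) ≤ 2 * c := by linarith
    exact_mod_cast this
  calc ENNReal.ofReal (t ^ (-α)) * μ (ball z t)
      ≤ ENNReal.ofReal (t ^ (-α)) * (2 * μ (ball z t \ nbhdSet E (ε * t))) := by gcongr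
    _ = 2 * (ENNReal.ofReal (t ^ (-α)) * μ (ball z t \ nbhdSet E (ε * t))) := by ring
    _ ≤ _ := by
      gcongr
      exact mul_measure_le μ E α hα t ht _ (measurableSet_ball.diff hm)
        (diff_subset.trans hsub)

lemma covering_estimates {μ : Measure X} (hpf : BallsPosFinite μ) {CD : ℝ} (hCD : 0 < CD)
    (hD : DoublingWith μ CD) {E : Set X} (hE : E.Nonempty) {α C : ℝ} (hα : 0 < α)
    (hC : 1 ≤ C) (h : AikawaCondition μ E α C) {ε : ℝ} (hε : 0 < ε)
    (hεC : C * ε ^ α ≤ 1 / 2) (x : X) {R t : ℝ} (hR : 0 < R) (ht : 0 < t)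
    (ht2 : ENNReal.ofReal (3 * t) < 2 * EMetric.diam (univ : Set X)) :
    μ.withDensity (distWeight E α) (nbhdSet E t ∩ ball x R) ≤
      ENNReal.ofReal (C * CD ^ 2) * (ENNReal.ofReal (t ^ (-α)) * μ (ball x (R + 2 * t))) ∧
    μ.withDensity (distWeight E α) (nbhdSet E t ∩ ball x R) ≤
      ENNReal.ofReal (C * CD ^ 2) * (2 * μ.withDensity (distWeight E α)
        ((nbhdSet E t ∩ ball x (R + 2 * t)) \ nbhdSet E (ε * t))) := by
  obtain ⟨u, huE, hcount, hdisj, hsub, hcov⟩ := exists_cover μ hpf E hE x R t hR ht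
  have ht2' : ENNReal.ofReal t < 2 * EMetric.diam (univ : Set X) :=
    lt_of_le_of_lt (ENNReal.ofReal_le_ofReal (by linarith)) ht2
  have hball : ∀ z ∈ u, ball z t ⊆ nbhdSet E t := fun z hz y hy =>
    lt_of_le_of_lt (infDist_le_dist_of_mem (huE hz)) hy
  have key : μ.withDensity (distWeight E α) (nbhdSet E t ∩ ball x R) ≤
      ENNReal.ofReal (C * CD ^ 2) * ∑' z : u, ENNReal.ofReal (t ^ (-α)) * μ (ball (z : X) t) := by
    refine (measure_mono hcov).trans ((measure_biUnion_le _ hcount _).trans ?_)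
    rw [← ENNReal.tsum_mul_left]
    refine ENNReal.tsum_le_tsum fun z => ?_
    refine (aikawa_measure h (huE z.2) (by linarith) ht2).trans ?_
    have hd : μ (ball (z : X) (3 * t)) ≤ ENNReal.ofReal (CD ^ 2) * μ (ball (z : X) t) := by
      calc μ (ball (z : X) (3 * t)) ≤ μ (ball (z : X) (2 * (2 * t))) :=
            measure_mono (ball_subset_ball (by linarith))
        _ ≤ ENNReal.ofReal CD * μ (ball (z : X) (2 * t)) := hD _ _ (by linarith)
        _ ≤ ENNReal.ofReal CD * (ENNReal.ofReal CD * μ (ball (z : X) t)) := by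
            gcongr
            exact hD _ _ ht
        _ = _ := by rw [← mul_assoc, ← ENNReal.ofReal_mul hCD.le, sq]
    have h3 : (3 * t) ^ (-α) ≤ t ^ (-α) :=
      Real.rpow_le_rpow_of_nonpos ht (by linarith) (by linarith)
    calc ENNReal.ofReal (C * (3 * t) ^ (-α)) * μ (ball (z : X) (3 * t))
        ≤ ENNReal.ofReal (C * t ^ (-α)) * (ENNReal.ofReal (CD ^ 2) * μ (ball (z : X) t)) := by
          gcongr
      _ = _ := by
          rw [ENNReal.ofReal_mul (by linarith), ENNReal.ofReal_mul (by linarith)]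
          ring
  constructor
  · refine key.trans ?_
    gcongr
    rw [ENNReal.tsum_mul_left]
    gcongr
    rw [← measure_biUnion hcount hdisj (fun _ _ => measurableSet_ball)]
    exact measure_mono (iUnion₂_subset hsub)
  · refine key.trans ?_
    gcongr
    calc ∑' z : u, ENNReal.ofReal (t ^ (-α)) * μ (ball (z : X) t)
        ≤ ∑' z : u, 2 * μ.withDensity (distWeight E α) (ball (z : X) t \ nbhdSet E (ε * t)) :=
          ENNReal.tsum_le_tsum fun z => half_ball hpf hα hC h hε hεC (huE z.2) ht ht2'
      _ = 2 * μ.withDensity (distWeight E α) (⋃ z ∈ u, ball z t \ nbhdSet E (ε * t)) := by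
          rw [ENNReal.tsum_mul_left, measure_biUnion hcount]
          · exact fun a ha b hb hab => (hdisj ha hb hab).mono diff_subset diff_subset
          · exact fun _ _ => measurableSet_ball.diff (measurableSet_nbhdSet _ _)
      _ ≤ _ := by
          gcongr
          exact iUnion₂_subset fun z hz =>
            diff_subset_diff_left (subset_inter (hball z hz) (hsub z hz))

/-- One-step decay, multiplied out. -/
lemma decay_step {μ : Measure X} (hpf : BallsPosFinite μ) {CD : ℝ} (hCD : 0 < CD)
    (hD : DoublingWith μ CD) {E : Set X} (hE : E.Nonempty) {α C : ℝ} (hα : 0 < α)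
    (hC : 1 ≤ C) (h : AikawaCondition μ E α C) {ε : ℝ} (hε : 0 < ε) (hε1 : ε ≤ 1 / 2)
    (hεC : C * ε ^ α ≤ 1 / 2) {K : ℝ} (hK : K = C * CD ^ 2 * 2)
    (x : X) {R t : ℝ} (hR : 0 < R) (ht : 0 < t)
    (ht2 : ENNReal.ofReal (3 * t) < 2 * EMetric.diam (univ : Set X)) :
    μ.withDensity (distWeight E α) (nbhdSet E (ε * t) ∩ ball x R) ≤
      ENNReal.ofReal (K / (1 + K)) *
        μ.withDensity (distWeight E α) (nbhdSet E t ∩ ball x (R + 2 * t)) := by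
  have hK0 : 0 < K := by rw [hK]; positivity
  have hst : nbhdSet E (ε * t) ⊆ nbhdSet E t := by
    intro y hy
    have hy' : infDist y E < ε * t := hy
    show infDist y E < t
    nlinarith
  set ν := μ.withDensity (distWeight E α) with hν
  have h1 := (covering_estimates hpf hCD hD hE hα hC h hε hεC x hR ht ht2).2
  rw [← hν] at h1
  set L := ν ((nbhdSet E t ∩ ball x (R + 2 * t)) \ nbhdSet E (ε * t)) with hL
  set m := ν (nbhdSet E (ε * t) ∩ ball x R) with hm
  set M := ν (nbhdSet E t ∩ ball x (R + 2 * t)) with hM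
  have h2 : m ≤ ENNReal.ofReal K * L := by
    calc m ≤ ν (nbhdSet E t ∩ ball x R) := measure_mono (inter_subset_inter_left _ hst)
      _ ≤ _ := h1
      _ = _ := by
        rw [hK, ENNReal.ofReal_mul (by positivity) (q := 2), ← mul_assoc]
        simp
  have h3 : m + L ≤ M := by
    rw [hM, ← measure_inter_add_diff (nbhdSet E t ∩ ball x (R + 2 * t))
      (measurableSet_nbhdSet E (ε * t))]
    gcongr
    exact measure_mono fun y hy => ⟨⟨hst hy.1, ball_subset_ball (by linarith) hy.2⟩, hy.1⟩
  have h4 : ENNReal.ofReal (1 + K) * m ≤ ENNReal.ofReal K * M := by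
    calc ENNReal.ofReal (1 + K) * m = m + ENNReal.ofReal K * m := by
          rw [ENNReal.ofReal_add zero_le_one hK0.le, ENNReal.ofReal_one, add_mul, one_mul]
      _ ≤ ENNReal.ofReal K * L + ENNReal.ofReal K * m := by gcongr
      _ = ENNReal.ofReal K * (m + L) := by ring
      _ ≤ _ := by gcongr
  calc m = ENNReal.ofReal (1 + K)⁻¹ * (ENNReal.ofReal (1 + K) * m) := by
        rw [← mul_assoc, ← ENNReal.ofReal_mul (by positivity), inv_mul_cancel₀ (by positivity)]
        simp
    _ ≤ ENNReal.ofReal (1 + K)⁻¹ * (ENNReal.ofReal K * M) := by gcongr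
    _ = _ := by
        rw [← mul_assoc, ← ENNReal.ofReal_mul (by positivity)]
        congr 2
        field_simp

lemma decay {μ : Measure X} (hpf : BallsPosFinite μ) {CD : ℝ} (hCD : 0 < CD)
    (hD : DoublingWith μ CD) {E : Set X} (hE : E.Nonempty) {α C : ℝ} (hα : 0 < α)
    (hC : 1 ≤ C) (h : AikawaCondition μ E α C) {ε : ℝ} (hε : 0 < ε) (hε1 : ε ≤ 1 / 2)
    (hεC : C * ε ^ α ≤ 1 / 2) {K : ℝ} (hK : K = C * CD ^ 2 * 2) (x : X) (n : ℕ) :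
    ∀ {R t : ℝ}, 0 < R → 0 < t →
    ENNReal.ofReal (3 * t) < 2 * EMetric.diam (univ : Set X) →
    μ.withDensity (distWeight E α) (nbhdSet E (ε ^ n * t) ∩ ball x R) ≤
      ENNReal.ofReal (K / (1 + K)) ^ n *
        μ.withDensity (distWeight E α) (nbhdSet E t ∩ ball x (R + 4 * t)) := by
  induction n with
  | zero =>
    intro R t hR ht ht2
    simp only [pow_zero, one_mul]
    exact measure_mono (inter_subset_inter_right _ (ball_subset_ball (by linarith)))
  | succ n ih =>
    intro R t hR ht ht2
    have hεt : ε * t ≤ 1 / 2 * t := by gcongr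
    have h0 : 0 < ε * t := mul_pos hε ht
    have h1 := ih (R := R) (t := ε * t) hR h0
      (lt_of_le_of_lt (ENNReal.ofReal_le_ofReal (by linarith)) ht2)
    have h2 := decay_step hpf hCD hD hE hα hC h hε hε1 hεC hK x
      (R := R + 4 * (ε * t)) (t := t) (by linarith) ht ht2
    rw [pow_succ, mul_assoc, pow_succ, mul_assoc]
    refine h1.trans ?_
    gcongr
    refine h2.trans ?_
    refine mul_le_mul_right (measure_mono (inter_subset_inter_right _ (ball_subset_ball ?_))) _
    linarith

lemma distWeight_le (E : Set X) {δ ε t : ℝ} (hδ : 0 < δ) (hε : 0 < ε) (hε1 : ε < 1)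
    (ht : 0 < t) (y : X) :
    distWeight E δ y ≤ ENNReal.ofReal (t ^ (-δ)) +
      ∑' n : ℕ, ENNReal.ofReal ((ε ^ (n + 1) * t) ^ (-δ)) *
        (nbhdSet E (ε ^ n * t)).indicator 1 y := by
  have hd0 : 0 ≤ infDist y E := infDist_nonneg
  rcases hd0.eq_or_lt with h0 | hpos
  · have : ∑' n : ℕ, ENNReal.ofReal ((ε ^ (n + 1) * t) ^ (-δ)) *
        (nbhdSet E (ε ^ n * t)).indicator 1 y = ∞ := by
      rw [← top_le_iff, ← ENNReal.tsum_const_eq_top_of_ne_zero (α := ℕ)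
        (c := ENNReal.ofReal (t ^ (-δ)))
        (ENNReal.ofReal_pos.2 (Real.rpow_pos_of_pos ht _)).ne']
      refine ENNReal.tsum_le_tsum fun n => ?_
      have hy : y ∈ nbhdSet E (ε ^ n * t) := by
        show infDist y E < _
        rw [← h0]; positivity
      rw [indicator_of_mem hy, Pi.one_apply, mul_one]
      apply ENNReal.ofReal_le_ofReal
      apply Real.rpow_le_rpow_of_nonpos (by positivity) _ (by linarith)
      have := pow_le_one₀ (n := n + 1) hε.le hε1.le
      nlinarith
    rw [this]; simp
  · have hw : distWeight E δ y = ENNReal.ofReal (infDist y E ^ (-δ)) := by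
      unfold distWeight
      rw [ENNReal.ofReal_rpow_of_pos hpos]
    rw [hw]
    by_cases hdt : t ≤ infDist y E
    · refine le_trans (ENNReal.ofReal_le_ofReal ?_) le_self_add
      exact Real.rpow_le_rpow_of_nonpos ht hdt (by linarith)
    · push Not at hdt
      have hex : ∃ k : ℕ, ε ^ k * t ≤ infDist y E := by
        obtain ⟨k, hk⟩ := exists_pow_lt_of_lt_one (div_pos hpos ht) hε1
        exact ⟨k, ((lt_div_iff₀ ht).1 hk).le⟩
      classical
      obtain ⟨k, hk, hmin⟩ : ∃ k : ℕ, ε ^ k * t ≤ infDist y E ∧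
          ∀ m < k, ¬ ε ^ m * t ≤ infDist y E :=
        ⟨Nat.find hex, Nat.find_spec hex, fun m hm => Nat.find_min hex hm⟩
      cases k with
      | zero => simp at hk; linarith
      | succ k =>
        refine le_trans ?_ le_add_self
        refine le_trans ?_ (ENNReal.le_tsum k)
        have hy : y ∈ nbhdSet E (ε ^ k * t) := not_le.1 (hmin k (Nat.lt_succ_self k))
        rw [indicator_of_mem hy, Pi.one_apply, mul_one]
        apply ENNReal.ofReal_le_ofReal
        exact Real.rpow_le_rpow_of_nonpos (by positivity) hk (by linarith)

lemma distWeight_add (E : Set X) {α δ : ℝ} (hα : 0 < α) (hδ : 0 < δ) (y : X) :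
    distWeight E (α + δ) y = distWeight E α y * distWeight E δ y := by
  unfold distWeight
  by_cases h : ENNReal.ofReal (infDist y E) = 0
  · rw [h, ENNReal.zero_rpow_of_neg (by linarith), ENNReal.zero_rpow_of_neg (by linarith),
      ENNReal.zero_rpow_of_neg (by linarith)]
    simp
  · rw [← ENNReal.rpow_add _ _ h ENNReal.ofReal_ne_top]
    congr 1; ring

lemma lintegral_bound (μ : Measure X) (E : Set X) {α δ ε t : ℝ} (hα : 0 < α) (hδ : 0 < δ)
    (hε : 0 < ε) (hε1 : ε < 1) (ht : 0 < t) (x : X) (R : ℝ) :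
    ∫⁻ y in ball x R, distWeight E (α + δ) y ∂μ ≤
      ENNReal.ofReal (t ^ (-δ)) * μ.withDensity (distWeight E α) (ball x R) +
      ∑' n : ℕ, ENNReal.ofReal ((ε ^ (n + 1) * t) ^ (-δ)) *
        μ.withDensity (distWeight E α) (nbhdSet E (ε ^ n * t) ∩ ball x R) := by
  have hm : ∀ n : ℕ, Measurable fun y => ENNReal.ofReal ((ε ^ (n + 1) * t) ^ (-δ)) *
        (nbhdSet E (ε ^ n * t)).indicator (1 : X → ℝ≥0∞) y := fun n =>
    (measurable_one.indicator (measurableSet_nbhdSet _ _)).const_mul _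
  calc ∫⁻ y in ball x R, distWeight E (α + δ) y ∂μ
      = ∫⁻ y in ball x R, distWeight E δ y ∂(μ.withDensity (distWeight E α)) := by
        rw [restrict_withDensity measurableSet_ball,
          lintegral_withDensity_eq_lintegral_mul _ (measurable_distWeight_s9 E α)
            (measurable_distWeight_s9 E δ)]
        exact lintegral_congr fun y => distWeight_add E hα hδ y
    _ ≤ ∫⁻ y in ball x R, (ENNReal.ofReal (t ^ (-δ)) +
      ∑' n : ℕ, ENNReal.ofReal ((ε ^ (n + 1) * t) ^ (-δ)) *
        (nbhdSet E (ε ^ n * t)).indicator 1 y) ∂(μ.withDensity (distWeight E α)) :=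
        lintegral_mono fun y => distWeight_le E hδ hε hε1 ht y
    _ = _ := by
        rw [lintegral_add_left measurable_const, setLIntegral_const,
          lintegral_tsum fun n => (hm n).aemeasurable]
        congr 2
        ext n
        rw [lintegral_const_mul _ (measurable_one.indicator (measurableSet_nbhdSet _ _)),
          lintegral_indicator_one (measurableSet_nbhdSet _ _),
          Measure.restrict_apply (measurableSet_nbhdSet _ _)]

theorem aikawa_self_improvement (α C₀ CD : ℝ) (hα : 0 < α) (hC₀ : 1 ≤ C₀) (hCD : 0 < CD) :
    ∃ δ C : ℝ, 0 < δ ∧ 1 ≤ C ∧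
      ∀ (Y : Type*) [MetricSpace Y] [MeasurableSpace Y] [BorelSpace Y] (μ : Measure Y),
        Nontrivial Y → BallsPosFinite μ → DoublingWith μ CD →
        ∀ E : Set Y, E.Nonempty → IsClosed E →
          AikawaCondition μ E α C₀ → AikawaCondition μ E (α + δ) C := by
  obtain ⟨ε, hε, hε1, hεC⟩ : ∃ ε : ℝ, 0 < ε ∧ ε ≤ 1 / 2 ∧ C₀ * ε ^ α ≤ 1 / 2 := by
    refine ⟨min (1 / 2) ((1 / (2 * C₀)) ^ (1 / α)), by positivity, min_le_left _ _, ?_⟩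
    have h1 : (min (1 / 2) ((1 / (2 * C₀)) ^ (1 / α))) ^ α ≤ 1 / (2 * C₀) := by
      calc _ ≤ ((1 / (2 * C₀)) ^ (1 / α)) ^ α :=
            Real.rpow_le_rpow (by positivity) (min_le_right _ _) hα.le
        _ = _ := by
            rw [← Real.rpow_mul (by positivity), one_div_mul_cancel hα.ne', Real.rpow_one]
    calc _ ≤ C₀ * (1 / (2 * C₀)) := by gcongr
      _ = 1 / 2 := by field_simp
  obtain ⟨K, hK⟩ : ∃ K : ℝ, K = C₀ * CD ^ 2 * 2 := ⟨_, rfl⟩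
  have hK0 : 0 < K := by rw [hK]; positivity
  obtain ⟨θ, hθ⟩ : ∃ θ : ℝ, θ = K / (1 + K) := ⟨_, rfl⟩
  have hθ0 : 0 < θ := by rw [hθ]; positivity
  have hθ1 : θ < 1 := by rw [hθ, div_lt_one (by positivity)]; linarith
  obtain ⟨s, hs⟩ : ∃ s : ℝ, s = Real.sqrt θ := ⟨_, rfl⟩
  have hs0 : 0 < s := by rw [hs]; positivity
  have hs1 : s < 1 := by rw [hs, Real.sqrt_lt' one_pos]; simpa using hθ1
  have hss : s * s = θ := by rw [hs]; exact Real.mul_self_sqrt hθ0.le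
  obtain ⟨δ, hδ⟩ : ∃ δ : ℝ, δ = Real.log s / Real.log ε := ⟨_, rfl⟩
  have hlogε : Real.log ε < 0 := Real.log_neg hε (by linarith)
  have hδ0 : 0 < δ := by
    rw [hδ]; exact div_pos_of_neg_of_neg (Real.log_neg hs0 hs1) hlogε
  have hεδ : ε ^ (-δ) = s⁻¹ := by
    rw [Real.rpow_neg hε.le, Real.rpow_def_of_pos hε, hδ, mul_div_cancel₀ _ hlogε.ne,
      Real.exp_log hs0]
  obtain ⟨B, hB⟩ : ∃ B : ℝ, B = (1 / 6) ^ (-δ) * C₀ +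
      (1 - s)⁻¹ * (s⁻¹ * (1 / 6) ^ (-δ) * (C₀ * CD ^ 2 * (1 / 6) ^ (-α) * CD)) := ⟨_, rfl⟩
  have h1s : 0 < 1 - s := by linarith
  refine ⟨δ, max 1 B, hδ0, le_max_left _ _, ?_⟩
  intro Y _ _ _ μ _ hpf hD E hE _ hA x hx R hR hR2
  obtain ⟨t, ht⟩ : ∃ t : ℝ, t = R * (1 / 6) := ⟨_, rfl⟩
  have ht0 : 0 < t := by rw [ht]; positivity
  have ht2 : ENNReal.ofReal (3 * t) < 2 * EMetric.diam (univ : Set Y) :=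
    lt_of_le_of_lt (ENNReal.ofReal_le_ofReal (by linarith)) hR2
  have hb := lintegral_bound μ E hα hδ0 hε (by linarith) ht0 x R
  have hM : μ.withDensity (distWeight E α) (nbhdSet E t ∩ ball x (R + 4 * t)) ≤
      ENNReal.ofReal (C₀ * CD ^ 2 * t ^ (-α) * CD) * μ (ball x R) := by
    refine (covering_estimates hpf hCD hD hE hα hC₀ hA hε hεC x (by linarith) ht0 ht2).1.trans ?_
    have : R + 4 * t + 2 * t = 2 * R := by rw [ht]; ring
    rw [this, ENNReal.ofReal_mul (q := CD) (by positivity),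
      ENNReal.ofReal_mul (q := t ^ (-α)) (by positivity), mul_assoc, mul_assoc]
    gcongr
    exact hD x R hR
  have hterm : ∀ n : ℕ, ENNReal.ofReal ((ε ^ (n + 1) * t) ^ (-δ)) *
        μ.withDensity (distWeight E α) (nbhdSet E (ε ^ n * t) ∩ ball x R) ≤
      ENNReal.ofReal s ^ n * (ENNReal.ofReal (s⁻¹ * t ^ (-δ) *
        (C₀ * CD ^ 2 * t ^ (-α) * CD)) * μ (ball x R)) := by
    intro n
    have h1 := decay hpf hCD hD hE hα hC₀ hA hε hε1 hεC hK x n hR ht0 ht2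
    rw [← hθ] at h1
    have h2 : (ε ^ (n + 1) * t) ^ (-δ) = (s⁻¹) ^ (n + 1) * t ^ (-δ) := by
      rw [Real.mul_rpow (by positivity) ht0.le, ← hεδ, ← Real.rpow_natCast, ← Real.rpow_natCast,
        ← Real.rpow_mul hε.le, ← Real.rpow_mul hε.le, mul_comm (-δ)]
    calc _ ≤ ENNReal.ofReal ((ε ^ (n + 1) * t) ^ (-δ)) * (ENNReal.ofReal θ ^ n *
          (ENNReal.ofReal (C₀ * CD ^ 2 * t ^ (-α) * CD) * μ (ball x R))) := by
          gcongr
          exact h1.trans (by gcongr)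
      _ = _ := by
          rw [h2, ← mul_assoc, ← mul_assoc, ← mul_assoc, ← ENNReal.ofReal_pow hθ0.le,
            ← ENNReal.ofReal_pow hs0.le, ← ENNReal.ofReal_mul (by positivity),
            ← ENNReal.ofReal_mul (by positivity), ← ENNReal.ofReal_mul (by positivity), ← hss]
          congr 2
          rw [mul_pow, pow_succ, inv_pow]
          field_simp
  have hsum : ∑' n : ℕ, ENNReal.ofReal ((ε ^ (n + 1) * t) ^ (-δ)) *
        μ.withDensity (distWeight E α) (nbhdSet E (ε ^ n * t) ∩ ball x R) ≤
      ENNReal.ofReal (1 - s)⁻¹ * (ENNReal.ofReal (s⁻¹ * t ^ (-δ) *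
        (C₀ * CD ^ 2 * t ^ (-α) * CD)) * μ (ball x R)) := by
    refine (ENNReal.tsum_le_tsum hterm).trans ?_
    rw [ENNReal.tsum_mul_right, ENNReal.tsum_geometric, ENNReal.ofReal_inv_of_pos h1s,
      ENNReal.ofReal_sub _ hs0.le, ENNReal.ofReal_one]
  calc _ ≤ _ := hb
    _ ≤ ENNReal.ofReal (t ^ (-δ)) * (ENNReal.ofReal (C₀ * R ^ (-α)) * μ (ball x R)) +
        ENNReal.ofReal (1 - s)⁻¹ * (ENNReal.ofReal (s⁻¹ * t ^ (-δ) *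
        (C₀ * CD ^ 2 * t ^ (-α) * CD)) * μ (ball x R)) := by
        gcongr
        exact aikawa_measure hA hx hR hR2
    _ = ENNReal.ofReal (B * R ^ (-(α + δ))) * μ (ball x R) := by
        rw [← mul_assoc, ← mul_assoc, ← add_mul, ← ENNReal.ofReal_mul (by positivity),
          ← ENNReal.ofReal_mul (by positivity), ← ENNReal.ofReal_add (by positivity)
            (by positivity)]
        congr 2
        rw [hB, ht, Real.mul_rpow hR.le (by norm_num), Real.mul_rpow hR.le (by norm_num),
          neg_add, Real.rpow_add hR]
        ring
    _ ≤ _ := by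
        gcongr
        exact le_max_right _ _

end
end ApDistance
end

section
/- Let s > 0. Assume the standing assumptions, that μ satisfies the reverse doubling condition with exponent η = s, and that there is Q > s such that μ(B) ≥ c·rad(B)^Q for all balls B ⊂ X with rad(B) ≥ 1. Let 0 < t < p ≤ q < ∞, and let w and v be weights such that w ∈ A_P for some 1 ≤ P < ∞ and h := v^{t/(t−p)} ∈ A_P' for some 1 ≤ P' < ∞. If there exists K > 0 such that rad(B)^s · (∫_B w dμ)^{t/q} · (∫_B h dμ)^{(p−t)/p} ≤ K·μ(B) for all balls B ⊂ X, then there is a constant C > 0 such that (∫_X (I_s f)^{q/t} w dμ)^{t/q} ≤ C (∫_X f^{p/t} v dμ)^{t/p} for all measurable functions f ≥ 0 on X. -/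
open MeasureTheory Metric Set
open scoped ENNReal NNReal

namespace ApDistance

noncomputable section

variable {X : Type*} [MetricSpace X] [MeasurableSpace X] [BorelSpace X]

lemma zgeom {y : ℝ≥0∞} (hy : 1 < y) (hy' : y ≠ ∞) : ∃ c : ℝ≥0∞, c ≠ ∞ ∧ 1 ≤ c ∧ ∀ m : ℤ,
    ∑' j : ℤ, (if j ≤ m then y ^ j else 0) ≤ c * y ^ m := by
  have hy0 : y ≠ 0 := (zero_lt_one.trans hy).ne'
  have hlt : y⁻¹ < 1 := ENNReal.inv_lt_one.2 hy
  refine ⟨(1 - y⁻¹)⁻¹, ?_, ?_, fun m => ?_⟩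
  · rw [ENNReal.inv_ne_top]; exact (tsub_pos_of_lt hlt).ne'
  · rw [ENNReal.one_le_inv]; exact tsub_le_self
  · have hinj : Function.Injective (fun n : ℕ => m - (n : ℤ)) := by
      intro a b h; simp at h; exact h
    rw [← hinj.tsum_eq (f := fun j : ℤ => if j ≤ m then y ^ j else 0), ← ENNReal.tsum_geometric,
      ← ENNReal.tsum_mul_right]
    · refine ENNReal.tsum_le_tsum fun n => ?_
      have : m - (n : ℤ) ≤ m := by omega
      simp only [this, if_true]
      rw [sub_eq_add_neg, ENNReal.zpow_add hy0 hy', mul_comm, ENNReal.zpow_neg, zpow_natCast,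
        ENNReal.inv_pow]
    · intro j hj
      simp only [Function.mem_support, ne_eq, ite_eq_right_iff, Classical.not_imp] at hj
      refine ⟨(m - j).toNat, ?_⟩
      have := hj.1
      simp only
      omega

/-- positivity and finiteness on balls is `BallsPosFinite`; sigma-finiteness follows -/
lemma sfin [Nonempty X] {ν : Measure X} (h : BallsPosFinite ν) : SigmaFinite ν := by
  obtain ⟨x0⟩ := ‹Nonempty X›
  refine ⟨⟨{ set := fun n => ball x0 (n + 1), set_mem := fun _ => mem_univ _, finite := fun n => (h x0 (n+1) (by positivity)).2, spanning := ?_ }⟩⟩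
  rw [eq_univ_iff_forall]
  intro x
  obtain ⟨n, hn⟩ := exists_nat_gt (dist x x0)
  exact mem_iUnion.2 ⟨n, by rw [mem_ball]; linarith⟩

lemma countable_of_disjoint [Nonempty X] {ν : Measure X} (h : BallsPosFinite ν) {ι : Type*}
    (u : Set ι) (z : ι → X) (r : ι → ℝ) (hr : ∀ i ∈ u, 0 < r i)
    (hd : u.PairwiseDisjoint (fun i => ball (z i) (r i))) : u.Countable := by
  haveI := sfin h
  have := Measure.countable_meas_pos_of_disjoint_iUnion (μ := ν)
    (As := fun i : u => ball (z i) (r i)) (fun i => measurableSet_ball) (by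
      intro a b hab
      exact hd a.2 b.2 (fun h => hab (Subtype.ext h)))
  have h2 : {i : u | 0 < ν (ball (z i) (r i))} = univ := by
    rw [eq_univ_iff_forall]; intro i; exact (h _ _ (hr _ i.2)).1
  rw [h2] at this
  exact Set.countable_coe_iff.1 (Set.countable_univ_iff.1 this)

/-- the superlevel set of the uncentered maximal function -/
def Om (ν : Measure X) (f : X → ℝ≥0∞) (l : ℝ≥0∞) : Set X :=
  ⋃ i ∈ {i : X × ℝ | 0 < i.2 ∧ l * ν (ball i.1 i.2) < ∫⁻ y in ball i.1 i.2, f y ∂ν}, ball i.1 i.2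

lemma isOpen_Om (ν : Measure X) (f : X → ℝ≥0∞) (l : ℝ≥0∞) : IsOpen (Om ν f l) :=
  isOpen_biUnion fun _ _ => isOpen_ball

lemma mem_Om {ν : Measure X} {f : X → ℝ≥0∞} {l : ℝ≥0∞} {x : X} :
    x ∈ Om ν f l ↔ ∃ z r, 0 < r ∧ l * ν (ball z r) < ∫⁻ y in ball z r, f y ∂ν ∧ x ∈ ball z r := by
  simp [Om, and_assoc]

lemma weak_type [Nonempty X] {ν : Measure X} (h : BallsPosFinite ν) {C : ℝ≥0∞}
    (hC : ∀ (x : X) (r : ℝ), 0 < r → ν (ball x (5 * r)) ≤ C * ν (ball x r))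
    (f : X → ℝ≥0∞) (l : ℝ≥0∞) : l * ν (Om ν f l) ≤ C * ∫⁻ x, f x ∂ν := by
  let t : ℕ → Set (X × ℝ) := fun n =>
    {i | 0 < i.2 ∧ i.2 ≤ n ∧ l * ν (ball i.1 i.2) < ∫⁻ y in ball i.1 i.2, f y ∂ν}
  let U : ℕ → Set X := fun n => ⋃ i ∈ t n, ball i.1 i.2
  have hU : Om ν f l = ⋃ n, U n := by
    ext x
    rw [mem_Om]
    simp only [U, t, mem_iUnion, mem_setOf_eq, Prod.exists, exists_prop]
    constructor
    · rintro ⟨z, r, h1, h2, h3⟩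
      obtain ⟨n, hn⟩ := exists_nat_ge r
      exact ⟨n, z, r, ⟨h1, hn, h2⟩, h3⟩
    · rintro ⟨n, z, r, ⟨h1, hn, h2⟩, h3⟩
      exact ⟨z, r, h1, h2, h3⟩
  have hmono : Monotone U := by
    intro n m hnm
    refine biUnion_subset_biUnion_left ?_
    rintro i ⟨h1, h2, h3⟩
    exact ⟨h1, h2.trans (by exact_mod_cast hnm), h3⟩
  rw [hU, hmono.measure_iUnion, ENNReal.mul_iSup]
  refine iSup_le fun n => ?_
  obtain ⟨u, hut, hud, hcov⟩ := Vitali.exists_disjoint_subfamily_covering_enlargement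
    (fun i : X × ℝ => ball i.1 i.2) (t n) (fun i => i.2) 2 (by norm_num) (fun a ha => ha.1.le) n
    (fun a ha => ha.2.1) (fun a ha => ⟨a.1, mem_ball_self ha.1⟩)
  have hc : u.Countable := countable_of_disjoint h u (fun i => i.1) (fun i => i.2)
    (fun i hi => (hut hi).1) hud
  have hsub : U n ⊆ ⋃ i ∈ u, ball i.1 (5 * i.2) := by
    refine iUnion₂_subset fun a ha => ?_
    obtain ⟨b, hb, ⟨p, hpa, hpb⟩, hab⟩ := hcov a ha
    refine subset_trans ?_ (subset_biUnion_of_mem (u := fun i : X × ℝ => ball i.1 (5 * i.2)) hb)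
    intro x hx
    rw [mem_ball] at *
    have := dist_triangle x a.1 b.1
    have := dist_triangle a.1 p b.1
    rw [dist_comm] at hpa
    linarith
  calc l * ν (U n) ≤ l * ∑' i : u, ν (ball (i : X × ℝ).1 (5 * (i : X × ℝ).2)) := by
        gcongr
        exact (measure_mono hsub).trans (measure_biUnion_le _ hc _)
    _ = ∑' i : u, l * ν (ball (i : X × ℝ).1 (5 * (i : X × ℝ).2)) := by rw [ENNReal.tsum_mul_left]
    _ ≤ ∑' i : u, C * ∫⁻ y in ball (i : X × ℝ).1 (i : X × ℝ).2, f y ∂ν := by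
        refine ENNReal.tsum_le_tsum fun i => ?_
        have hi := hut i.2
        calc _ ≤ l * (C * ν (ball (i : X × ℝ).1 (i : X × ℝ).2)) := by gcongr; exact hC _ _ hi.1
          _ = C * (l * ν (ball (i : X × ℝ).1 (i : X × ℝ).2)) := by ring
          _ ≤ _ := by gcongr; exact hi.2.2.le
    _ = C * ∫⁻ y in ⋃ i ∈ u, ball i.1 i.2, f y ∂ν := by
        rw [ENNReal.tsum_mul_left, lintegral_biUnion hc (fun _ _ => measurableSet_ball) hud]
    _ ≤ _ := by gcongr; exact Measure.restrict_le_self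

/-- uncentered maximal function -/
def Mx (ν : Measure X) (f : X → ℝ≥0∞) (x : X) : ℝ≥0∞ :=
  ⨆ i ∈ {i : X × ℝ | 0 < i.2 ∧ x ∈ ball i.1 i.2}, (∫⁻ y in ball i.1 i.2, f y ∂ν) / ν (ball i.1 i.2)

lemma lt_Mx {ν : Measure X} (h : BallsPosFinite ν) {f : X → ℝ≥0∞} {l : ℝ≥0∞} {x : X} :
    l < Mx ν f x ↔ x ∈ Om ν f l := by
  rw [mem_Om]
  simp only [Mx, lt_iSup_iff, mem_setOf_eq, Prod.exists, exists_prop]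
  constructor
  · rintro ⟨z, r, ⟨h1, h2⟩, h3⟩
    refine ⟨z, r, h1, ?_, h2⟩
    rwa [ENNReal.lt_div_iff_mul_lt (Or.inl (h z r h1).1.ne') (Or.inl (h z r h1).2.ne)] at h3
  · rintro ⟨z, r, h1, h3, h2⟩
    refine ⟨z, r, ⟨h1, h2⟩, ?_⟩
    rwa [ENNReal.lt_div_iff_mul_lt (Or.inl (h z r h1).1.ne') (Or.inl (h z r h1).2.ne)]

lemma measurable_Mx {ν : Measure X} (h : BallsPosFinite ν) (f : X → ℝ≥0∞) : Measurable (Mx ν f) := by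
  refine measurable_of_Ioi fun l => ?_
  have : Mx ν f ⁻¹' Ioi l = Om ν f l := by ext x; simp [lt_Mx h]
  rw [this]; exact (isOpen_Om _ _ _).measurableSet

lemma le_Mx {ν : Measure X} (f : X → ℝ≥0∞) {x z : X} {r : ℝ} (hr : 0 < r) (hx : x ∈ ball z r) :
    (∫⁻ y in ball z r, f y ∂ν) / ν (ball z r) ≤ Mx ν f x :=
  le_iSup₂_of_le (f := fun (i : X × ℝ) (_ : i ∈ {i : X × ℝ | 0 < i.2 ∧ x ∈ ball i.1 i.2}) =>
    (∫⁻ y in ball i.1 i.2, f y ∂ν) / ν (ball i.1 i.2)) (z, r) ⟨hr, hx⟩ le_rfl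

lemma two_zpow_rpow (a : ℝ) (l : ℤ) : ((2 : ℝ≥0∞) ^ l) ^ a = ((2 : ℝ≥0∞) ^ a) ^ l := by
  rw [← ENNReal.rpow_intCast, ← ENNReal.rpow_intCast, ← ENNReal.rpow_mul, ← ENNReal.rpow_mul, mul_comm]

lemma level_low {e : ℝ} (he : 0 < e) : ∃ c : ℝ≥0∞, c ≠ ∞ ∧ ∀ g : ℝ≥0∞,
    ∑' l : ℤ, (if (2 : ℝ≥0∞) ^ l < g then ((2 : ℝ≥0∞) ^ l) ^ e else 0) ≤ c * g ^ e := by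
  have h2 : (1 : ℝ≥0∞) < 2 ^ e := ENNReal.one_lt_rpow (by norm_num) he
  obtain ⟨c, hc, hc1, hcm⟩ := zgeom h2 (ENNReal.rpow_ne_top_of_nonneg he.le (by norm_num))
  refine ⟨c, hc, fun g => ?_⟩
  rcases eq_or_ne g 0 with rfl | h0
  · simp
  rcases eq_or_ne g ∞ with rfl | ht
  · rw [ENNReal.top_rpow_of_pos he, ENNReal.mul_top (zero_lt_one.trans_le hc1).ne']; exact le_top
  obtain ⟨n, hn1, hn2⟩ := ENNReal.exists_mem_Ioc_zpow h0 ht (y := 2) (by norm_num) (by norm_num)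
  calc _ ≤ ∑' l : ℤ, (if l ≤ n then ((2 : ℝ≥0∞) ^ e) ^ l else 0) := by
        refine ENNReal.tsum_le_tsum fun l => ?_
        by_cases hl : (2 : ℝ≥0∞) ^ l < g
        · have : l ≤ n := by
            by_contra hcon
            exact absurd (hn2.trans (ENNReal.zpow_le_of_le (x := 2) (by norm_num) (by omega : n + 1 ≤ l))) (not_le.2 hl)
          simp [hl, this, two_zpow_rpow]
        · simp [hl]
    _ ≤ c * ((2 : ℝ≥0∞) ^ e) ^ n := hcm n
    _ ≤ _ := by rw [← two_zpow_rpow]; gcongr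

lemma level_up {a : ℝ} (ha : 0 < a) (m : ℝ≥0∞) :
    m ^ a ≤ ∑' l : ℤ, (if (2 : ℝ≥0∞) ^ (l + 1) < m then ((2 : ℝ≥0∞) ^ (l + 2)) ^ a else 0) := by
  rcases eq_or_ne m 0 with rfl | h0
  · rw [ENNReal.zero_rpow_of_pos ha]; exact zero_le
  rcases eq_or_ne m ∞ with rfl | ht
  · have : ∑' n : ℕ, (1 : ℝ≥0∞) = ∞ := ENNReal.tsum_const_eq_top_of_ne_zero one_ne_zero
    refine le_top.trans (this.symm.le.trans ?_)
    refine le_trans ?_ (ENNReal.tsum_comp_le_tsum_of_injective (f := fun n : ℕ => (n : ℤ)) Nat.cast_injective _)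
    refine ENNReal.tsum_le_tsum fun n => ?_
    have h1 : (2 : ℝ≥0∞) ^ ((n : ℤ) + 1) < ∞ := ENNReal.zpow_lt_top (by norm_num) (by norm_num) _
    simp only [h1, if_true]
    refine ENNReal.one_le_rpow ?_ ha
    have := ENNReal.zpow_le_of_le (x := 2) (by norm_num) (by omega : (0 : ℤ) ≤ (n : ℤ) + 2)
    simpa using this
  obtain ⟨n, hn1, hn2⟩ := ENNReal.exists_mem_Ioc_zpow h0 ht (y := 2) (by norm_num) (by norm_num)
  refine le_trans ?_ (ENNReal.le_tsum (n - 1))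
  have e1 : n - 1 + 1 = n := by ring
  have e2 : n - 1 + 2 = n + 1 := by ring
  rw [e1, e2, if_pos hn1]
  gcongr

theorem HL [Nonempty X] {ν : Measure X} (h : BallsPosFinite ν) {C : ℝ≥0∞} (hCt : C ≠ ∞)
    (hC : ∀ (x : X) (r : ℝ), 0 < r → ν (ball x (5 * r)) ≤ C * ν (ball x r)) {a : ℝ} (ha : 1 < a) :
    ∃ H : ℝ≥0∞, H ≠ ∞ ∧ ∀ g : X → ℝ≥0∞, Measurable g →
      ∫⁻ x, Mx ν g x ^ a ∂ν ≤ H * ∫⁻ x, g x ^ a ∂ν := by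
  obtain ⟨c, hc, hcg⟩ := level_low (e := a - 1) (by linarith)
  refine ⟨4 ^ a * C * c, ?_, fun g hg => ?_⟩
  · exact ENNReal.mul_ne_top (ENNReal.mul_ne_top (ENNReal.rpow_ne_top_of_nonneg (by linarith) (by norm_num)) hCt) hc
  have hz0 : ∀ l : ℤ, (2 : ℝ≥0∞) ^ l ≠ 0 := fun l => (ENNReal.zpow_pos (by norm_num) (by norm_num) l).ne'
  have hzt : ∀ l : ℤ, (2 : ℝ≥0∞) ^ l ≠ ∞ := fun l => (ENNReal.zpow_lt_top (by norm_num) (by norm_num) l).ne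
  let gl : ℤ → X → ℝ≥0∞ := fun l x => if (2 : ℝ≥0∞) ^ l < g x then g x else 0
  have hgl : ∀ l, Measurable (gl l) := fun l =>
    Measurable.ite (measurableSet_lt measurable_const hg) hg measurable_const
  have hkey : ∀ l : ℤ, (2 : ℝ≥0∞) ^ l * ν (Om ν g ((2 : ℝ≥0∞) ^ (l + 1))) ≤ C * ∫⁻ x, gl l x ∂ν := by
    intro l
    refine le_trans ?_ (weak_type h hC (gl l) ((2 : ℝ≥0∞) ^ l))
    gcongr
    intro x hx
    rw [mem_Om] at hx ⊢
    obtain ⟨z, r, hr, h1, hxr⟩ := hx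
    refine ⟨z, r, hr, ?_, hxr⟩
    have h2 : ∫⁻ y in ball z r, g y ∂ν ≤ ∫⁻ y in ball z r, gl l y ∂ν + (2 : ℝ≥0∞) ^ l * ν (ball z r) := by
      calc _ ≤ ∫⁻ y in ball z r, (gl l y + (2 : ℝ≥0∞) ^ l) ∂ν := by
            refine lintegral_mono fun y => ?_
            by_cases hy : (2 : ℝ≥0∞) ^ l < g y
            · simp [gl, hy]
            · simp only [gl, hy, if_false, zero_add]; exact not_lt.1 hy
        _ = _ := by rw [lintegral_add_left (hgl l)]; simp
    have h3 : (2 : ℝ≥0∞) ^ (l + 1) * ν (ball z r) = (2 : ℝ≥0∞) ^ l * ν (ball z r) + (2 : ℝ≥0∞) ^ l * ν (ball z r) := by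
      rw [ENNReal.zpow_add (by norm_num) (by norm_num), zpow_one]; ring
    rw [h3] at h1
    exact lt_of_add_lt_add_right (h1.trans_le h2)
  have hOm : ∀ l, MeasurableSet (Om ν g l) := fun l => (isOpen_Om _ _ _).measurableSet
  calc ∫⁻ x, Mx ν g x ^ a ∂ν
      ≤ ∫⁻ x, ∑' l : ℤ, (Om ν g ((2 : ℝ≥0∞) ^ (l + 1))).indicator (fun _ => ((2 : ℝ≥0∞) ^ (l + 2)) ^ a) x ∂ν := by
        refine lintegral_mono fun x => (level_up (by linarith) _).trans (ENNReal.tsum_le_tsum fun l => ?_)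
        by_cases hx : (2 : ℝ≥0∞) ^ (l + 1) < Mx ν g x
        · rw [if_pos hx, indicator_of_mem ((lt_Mx h).1 hx)]
        · rw [if_neg hx]; exact zero_le
    _ = ∑' l : ℤ, ((2 : ℝ≥0∞) ^ (l + 2)) ^ a * ν (Om ν g ((2 : ℝ≥0∞) ^ (l + 1))) := by
        rw [lintegral_tsum fun l => (measurable_const.indicator (hOm _)).aemeasurable]
        congr 1; ext l; rw [lintegral_indicator_const (hOm _)]
    _ ≤ ∑' l : ℤ, 4 ^ a * C * (((2 : ℝ≥0∞) ^ l) ^ (a - 1) * ∫⁻ x, gl l x ∂ν) := by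
        refine ENNReal.tsum_le_tsum fun l => ?_
        have e : ((2 : ℝ≥0∞) ^ (l + 2)) ^ a = 4 ^ a * ((2 : ℝ≥0∞) ^ l) ^ (a - 1) * (2 : ℝ≥0∞) ^ l := by
          rw [ENNReal.zpow_add (by norm_num) (by norm_num), ENNReal.mul_rpow_of_nonneg _ _ (by linarith)]
          have : ((2 : ℝ≥0∞) ^ l) ^ a = ((2 : ℝ≥0∞) ^ l) ^ (a - 1) * (2 : ℝ≥0∞) ^ l := by
            conv_rhs => rw [← ENNReal.rpow_one ((2 : ℝ≥0∞) ^ l), ENNReal.rpow_one ((2 : ℝ≥0∞) ^ l)]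
            nth_rewrite 3 [← ENNReal.rpow_one ((2 : ℝ≥0∞) ^ l)]
            rw [← ENNReal.rpow_add _ _ (hz0 l) (hzt l)]; congr 1; ring
          rw [this]
          have : (2 : ℝ≥0∞) ^ (2 : ℤ) = 4 := by norm_cast
          rw [this]; ring
        rw [e]
        calc _ = 4 ^ a * ((2 : ℝ≥0∞) ^ l) ^ (a - 1) * ((2 : ℝ≥0∞) ^ l * ν (Om ν g ((2 : ℝ≥0∞) ^ (l + 1)))) := by ring
          _ ≤ 4 ^ a * ((2 : ℝ≥0∞) ^ l) ^ (a - 1) * (C * ∫⁻ x, gl l x ∂ν) := mul_le_mul' le_rfl (hkey l)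
          _ = _ := by ring
    _ = 4 ^ a * C * ∫⁻ x, ∑' l : ℤ, ((2 : ℝ≥0∞) ^ l) ^ (a - 1) * gl l x ∂ν := by
        rw [ENNReal.tsum_mul_left, lintegral_tsum fun l => ((hgl l).const_mul _).aemeasurable]
        congr 2; ext l; rw [lintegral_const_mul _ (hgl l)]
    _ ≤ 4 ^ a * C * ∫⁻ x, c * g x ^ a ∂ν := by
        gcongr with x
        calc ∑' l : ℤ, ((2 : ℝ≥0∞) ^ l) ^ (a - 1) * gl l x
            = (∑' l : ℤ, (if (2 : ℝ≥0∞) ^ l < g x then ((2 : ℝ≥0∞) ^ l) ^ (a - 1) else 0)) * g x := by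
              rw [← ENNReal.tsum_mul_right]; congr 1; ext l
              by_cases hx : (2 : ℝ≥0∞) ^ l < g x <;> simp [gl, hx]
          _ ≤ c * g x ^ (a - 1) * g x := by gcongr; exact hcg _
          _ = c * g x ^ a := by
              rw [mul_assoc]; congr 1
              rcases eq_or_ne (g x) 0 with h0 | h0
              · rw [h0, ENNReal.zero_rpow_of_pos (by linarith : 0 < a)]; simp
              rcases eq_or_ne (g x) ∞ with h1 | h1
              · rw [h1, ENNReal.top_rpow_of_pos (by linarith : 0 < a), ENNReal.top_rpow_of_pos (by linarith)]; simp
              nth_rewrite 2 [← ENNReal.rpow_one (g x)]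
              rw [← ENNReal.rpow_add _ _ h0 h1]; congr 1; ring
    _ = _ := by rw [lintegral_const_mul _ (hg.pow_const _)]; ring


lemma tsum_holder {ι : Type*} {a a' : ℝ} (h : a.HolderConjugate a') (x y : ι → ℝ≥0∞) :
    ∑' i, x i * y i ≤ (∑' i, x i ^ a) ^ (1 / a) * (∑' i, y i ^ a') ^ (1 / a') := by
  letI : MeasurableSpace ι := ⊤
  have := ENNReal.lintegral_mul_le_Lp_mul_Lq (Measure.count : Measure ι) h
    (f := x) (g := y) measurable_from_top.aemeasurable measurable_from_top.aemeasurable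
  simpa [lintegral_count] using this

lemma tsum_rpow_le {ι : Type*} {θ : ℝ} (h : 1 ≤ θ) (z : ι → ℝ≥0∞) :
    ∑' i, z i ^ θ ≤ (∑' i, z i) ^ θ := by
  have e : ∀ u : ℝ≥0∞, u ^ θ = u * u ^ (θ - 1) := by
    intro u
    have := ENNReal.rpow_add_of_nonneg (x := u) 1 (θ - 1) zero_le_one (by linarith)
    rw [ENNReal.rpow_one] at this
    rw [← this]; congr 1; ring
  rw [e (∑' i, z i), ← ENNReal.tsum_mul_right]
  refine ENNReal.tsum_le_tsum fun i => ?_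
  rw [e]
  exact mul_le_mul' le_rfl (ENNReal.rpow_le_rpow (ENNReal.le_tsum i) (by linarith))

lemma carleson {ν : Measure X} (h : BallsPosFinite ν) {a : ℝ} (ha : 1 < a) {H : ℝ≥0∞}
    (hH : ∀ g : X → ℝ≥0∞, Measurable g → ∫⁻ x, Mx ν g x ^ a ∂ν ≤ H * ∫⁻ x, g x ^ a ∂ν)
    {ι : Type*} [Countable ι] (z : ι → X) (R : ι → ℝ) (hR : ∀ i, 0 < R i) (E : ι → Set X)
    (hEm : ∀ i, MeasurableSet (E i)) (hEd : Pairwise (Function.onFun Disjoint E))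
    (hEs : ∀ i, E i ⊆ ball (z i) (R i)) {C : ℝ≥0∞} (hC : ∀ i, ν (ball (z i) (R i)) ≤ C * ν (E i))
    (g : X → ℝ≥0∞) (hg : Measurable g) :
    ∑' i, ν (ball (z i) (R i)) * ((∫⁻ y in ball (z i) (R i), g y ∂ν) / ν (ball (z i) (R i))) ^ a
      ≤ C * H * ∫⁻ x, g x ^ a ∂ν := by
  calc _ ≤ ∑' i, C * ∫⁻ x in E i, Mx ν g x ^ a ∂ν := by
        refine ENNReal.tsum_le_tsum fun i => ?_
        set A := ((∫⁻ y in ball (z i) (R i), g y ∂ν) / ν (ball (z i) (R i))) with hA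
        calc _ ≤ C * ν (E i) * A ^ a := by gcongr; exact hC i
          _ = C * (A ^ a * ν (E i)) := by ring
          _ = C * ∫⁻ x in E i, A ^ a ∂ν := by simp
          _ ≤ _ := by
            gcongr C * ?_
            refine setLIntegral_mono ((measurable_Mx h g).pow_const _) fun x hx => ?_
            gcongr
            exact le_Mx g (hR i) (hEs i hx)
    _ = C * ∫⁻ x in ⋃ i, E i, Mx ν g x ^ a ∂ν := by
        rw [ENNReal.tsum_mul_left, lintegral_iUnion hEm hEd]
    _ ≤ C * (H * ∫⁻ x, g x ^ a ∂ν) := by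
        gcongr C * ?_
        exact (setLIntegral_le_lintegral _ _).trans (hH g hg)
    _ = _ := by ring

lemma sparse_form {μ ν τ : Measure X} (hμ : BallsPosFinite μ) (hν : BallsPosFinite ν)
    (hτ : BallsPosFinite τ) {s a a' b b' : ℝ} (haa : a.HolderConjugate a')
    (hbb : b.HolderConjugate b') (hab : a ≤ b) {K : ℝ≥0∞}
    (hmix : ∀ (x : X) (r : ℝ), 0 < r → ENNReal.ofReal (r ^ s) * ν (ball x r) ^ (1 / b) *
      τ (ball x r) ^ (1 / a') ≤ K * μ (ball x r)) {H1 H2 : ℝ≥0∞}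
    (hH1 : ∀ g : X → ℝ≥0∞, Measurable g → ∫⁻ x, Mx τ g x ^ a ∂τ ≤ H1 * ∫⁻ x, g x ^ a ∂τ)
    (hH2 : ∀ g : X → ℝ≥0∞, Measurable g → ∫⁻ x, Mx ν g x ^ b' ∂ν ≤ H2 * ∫⁻ x, g x ^ b' ∂ν)
    {ι : Type*} [Countable ι] (z : ι → X) (R : ι → ℝ) (hR : ∀ i, 0 < R i) (E : ι → Set X)
    (hEm : ∀ i, MeasurableSet (E i)) (hEd : Pairwise (Function.onFun Disjoint E))
    (hEs : ∀ i, E i ⊆ ball (z i) (R i)) {C1 C2 : ℝ≥0∞}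
    (hC1 : ∀ i, τ (ball (z i) (R i)) ≤ C1 * τ (E i))
    (hC2 : ∀ i, ν (ball (z i) (R i)) ≤ C2 * ν (E i))
    (g G : X → ℝ≥0∞) (hg : Measurable g) (hG : Measurable G) :
    ∑' i, ENNReal.ofReal (R i ^ s) * (∫⁻ y in ball (z i) (R i), g y ∂τ) / μ (ball (z i) (R i)) *
        (∫⁻ y in ball (z i) (R i), G y ∂ν)
      ≤ K * ((C1 * H1 * ∫⁻ x, g x ^ a ∂τ) ^ (1 / a) * (C2 * H2 * ∫⁻ x, G x ^ b' ∂ν) ^ (1 / b')) := by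
  have ha := haa.lt
  have ha' := haa.symm.lt
  have hb' := hbb.symm.lt
  have ha0 : 0 < a := by linarith
  have ha'0 : 0 < a' := by linarith
  have hb'0 : 0 < b' := by linarith
  have hb'a' : b' ≤ a' := by
    have h1 := haa.inv_add_inv_eq_one
    have h2 := hbb.inv_add_inv_eq_one
    have h3 : b⁻¹ ≤ a⁻¹ := by gcongr
    have h4 : a'⁻¹ ≤ b'⁻¹ := by linarith
    rwa [inv_le_inv₀ ha'0 hb'0] at h4
  set m : ι → ℝ≥0∞ := fun i => τ (ball (z i) (R i)) with hm
  set n : ι → ℝ≥0∞ := fun i => ν (ball (z i) (R i)) with hn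
  set x : ι → ℝ≥0∞ := fun i => (∫⁻ y in ball (z i) (R i), g y ∂τ) / m i with hx
  set y : ι → ℝ≥0∞ := fun i => (∫⁻ y in ball (z i) (R i), G y ∂ν) / n i with hy
  have c1 := carleson hτ ha hH1 z R hR E hEm hEd hEs hC1 g hg
  have c2 := carleson hν hb' hH2 z R hR E hEm hEd hEs hC2 G hG
  have hm0 : ∀ i, m i ≠ 0 := fun i => (hτ _ _ (hR i)).1.ne'
  have hmt : ∀ i, m i ≠ ∞ := fun i => (hτ _ _ (hR i)).2.ne
  have hn0 : ∀ i, n i ≠ 0 := fun i => (hν _ _ (hR i)).1.ne'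
  have hnt : ∀ i, n i ≠ ∞ := fun i => (hν _ _ (hR i)).2.ne
  calc _ ≤ ∑' i, K * ((m i ^ (1 / a) * x i) * (n i ^ (1 / b') * y i)) := by
        refine ENNReal.tsum_le_tsum fun i => ?_
        have e1 : (∫⁻ y in ball (z i) (R i), g y ∂τ) = m i * x i := by
          rw [hx]; simp only; rw [ENNReal.mul_div_cancel (hm0 i) (hmt i)]
        have e2 : (∫⁻ y in ball (z i) (R i), G y ∂ν) = n i * y i := by
          rw [hy]; simp only; rw [ENNReal.mul_div_cancel (hn0 i) (hnt i)]
        have e3 : m i = m i ^ (1 / a) * m i ^ (1 / a') := by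
          rw [← ENNReal.rpow_add _ _ (hm0 i) (hmt i)]
          have := haa.inv_add_inv_eq_one
          rw [one_div, one_div, this, ENNReal.rpow_one]
        have e4 : n i = n i ^ (1 / b') * n i ^ (1 / b) := by
          rw [← ENNReal.rpow_add _ _ (hn0 i) (hnt i)]
          have := hbb.symm.inv_add_inv_eq_one
          rw [one_div, one_div, this, ENNReal.rpow_one]
        rw [e1, e2]
        have hμ0 := (hμ (z i) (R i) (hR i)).1.ne'
        have hμt := (hμ (z i) (R i) (hR i)).2.ne
        calc _ = ENNReal.ofReal (R i ^ s) * (m i ^ (1 / a) * m i ^ (1 / a') * x i) / μ (ball (z i) (R i)) *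
              (n i ^ (1 / b') * n i ^ (1 / b) * y i) := by rw [← e3, ← e4]
          _ = (ENNReal.ofReal (R i ^ s) * n i ^ (1 / b) * m i ^ (1 / a')) / μ (ball (z i) (R i)) *
              ((m i ^ (1 / a) * x i) * (n i ^ (1 / b') * y i)) := by
              simp only [div_eq_mul_inv]; ring
          _ ≤ (K * μ (ball (z i) (R i))) / μ (ball (z i) (R i)) *
              ((m i ^ (1 / a) * x i) * (n i ^ (1 / b') * y i)) := by
              exact mul_le_mul' (ENNReal.div_le_div_right (hmix _ _ (hR i)) _) le_rfl
          _ = _ := by rw [ENNReal.mul_div_cancel_right hμ0 hμt]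
    _ = K * ∑' i, ((m i ^ (1 / a) * x i) * (n i ^ (1 / b') * y i)) := by rw [ENNReal.tsum_mul_left]
    _ ≤ K * ((∑' i, (m i ^ (1 / a) * x i) ^ a) ^ (1 / a) *
          (∑' i, (n i ^ (1 / b') * y i) ^ a') ^ (1 / a')) := by
        gcongr; exact tsum_holder haa _ _
    _ ≤ _ := by
        gcongr K * (?_ * ?_)
        · gcongr
          refine le_trans (le_of_eq ?_) c1
          congr 1; ext i
          rw [ENNReal.mul_rpow_of_nonneg _ _ ha0.le, ← ENNReal.rpow_mul, one_div_mul_cancel ha0.ne',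
            ENNReal.rpow_one]
        · have h5 : ∑' i, (n i ^ (1 / b') * y i) ^ a' ≤ (∑' i, n i * y i ^ b') ^ (a' / b') := by
            refine le_trans (le_of_eq ?_) (tsum_rpow_le ((one_le_div hb'0).2 hb'a') _)
            congr 1; ext i
            rw [ENNReal.mul_rpow_of_nonneg _ _ ha'0.le, ENNReal.mul_rpow_of_nonneg _ _ (by positivity),
              ← ENNReal.rpow_mul, ← ENNReal.rpow_mul]
            congr 2 <;> field_simp
          calc _ ≤ ((∑' i, n i * y i ^ b') ^ (a' / b')) ^ (1 / a') := by gcongr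
            _ = (∑' i, n i * y i ^ b') ^ (1 / b') := by
              rw [← ENNReal.rpow_mul]; congr 1; field_simp
            _ ≤ _ := by gcongr

/-- dualisation -/
lemma dualize [Nonempty X] {ν : Measure X} (hν : BallsPosFinite ν) {b b' : ℝ}
    (hbb : b.HolderConjugate b') (T : X → ℝ≥0∞) (hT : Measurable T) (N : ℝ≥0∞)
    (h : ∀ G : X → ℝ≥0∞, Measurable G → ∫⁻ x, T x * G x ∂ν ≤ N * (∫⁻ x, G x ^ b' ∂ν) ^ (1 / b')) :
    ∫⁻ x, T x ^ b ∂ν ≤ N ^ b := by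
  have hb := hbb.lt
  have hb'0 : 0 < b' := by linarith [hbb.symm.lt]
  obtain ⟨x0⟩ := ‹Nonempty X›
  let Tn : ℕ → X → ℝ≥0∞ := fun n => (ball x0 (n + 1)).indicator (fun x => min (T x) n)
  have hTn : ∀ n, Measurable (Tn n) := fun n => (hT.min measurable_const).indicator measurableSet_ball
  have hTle : ∀ n x, Tn n x ≤ T x := by
    intro n x
    by_cases hx : x ∈ ball x0 (n + 1)
    · simp [Tn, indicator_of_mem hx]
    · simp [Tn, indicator_of_notMem hx]
  have hmono : Monotone Tn := by
    intro n m hnm x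
    have hnm' : (n : ℝ) ≤ m := by exact_mod_cast hnm
    by_cases hx : x ∈ ball x0 (n + 1)
    · have hx' : x ∈ ball x0 (m + 1) := ball_subset_ball (by linarith) hx
      simp only [Tn, indicator_of_mem hx, indicator_of_mem hx']
      gcongr
    · simp [Tn, indicator_of_notMem hx]
  have hsup : ∀ x, ⨆ n, Tn n x = T x := by
    intro x
    refine le_antisymm (iSup_le fun n => hTle n x) ?_
    obtain ⟨n0, hn0⟩ := exists_nat_gt (dist x x0)
    refine le_of_forall_lt fun c hc => ?_
    obtain ⟨n1, hn1⟩ := ENNReal.exists_nat_gt (hc.ne_top)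
    refine lt_iSup_iff.2 ⟨max n0 n1, ?_⟩
    have hx : x ∈ ball x0 ((max n0 n1 : ℕ) + 1) := by
      rw [mem_ball]
      have : (n0 : ℝ) ≤ (max n0 n1 : ℕ) := by exact_mod_cast le_max_left _ _
      linarith
    simp only [Tn, indicator_of_mem hx]
    refine lt_min hc (hn1.trans_le ?_)
    exact_mod_cast le_max_right _ _
  have hn : ∀ n, ∫⁻ x, Tn n x ^ b ∂ν ≤ N ^ b := by
    intro n
    set S := ∫⁻ x, Tn n x ^ b ∂ν with hS
    have hSt : S ≠ ∞ := by
      have : S ≤ ∫⁻ x, (ball x0 (n + 1)).indicator (fun _ => (n : ℝ≥0∞) ^ b) x ∂ν := by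
        refine lintegral_mono fun x => ?_
        by_cases hx : x ∈ ball x0 (n + 1)
        · simp only [Tn, indicator_of_mem hx]
          gcongr
          exact min_le_right _ _
        · simp only [Tn, indicator_of_notMem hx]
          rw [ENNReal.zero_rpow_of_pos (by linarith)]
      rw [lintegral_indicator_const measurableSet_ball] at this
      refine ne_top_of_le_ne_top (ENNReal.mul_ne_top ?_ (hν x0 (n + 1) (by positivity)).2.ne) this
      exact ENNReal.rpow_ne_top_of_nonneg (by linarith) (ENNReal.natCast_ne_top n)
    rcases eq_or_ne S 0 with h0 | h0
    · rw [h0]; exact zero_le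
    have hG := h (fun x => Tn n x ^ (b - 1)) ((hTn n).pow_const _)
    have e1 : ∫⁻ x, (Tn n x ^ (b - 1)) ^ b' ∂ν = S := by
      rw [hS]; congr 1; ext x
      rw [← ENNReal.rpow_mul, hbb.sub_one_mul_conj]
    rw [e1] at hG
    have h1 : S ≤ N * S ^ (1 / b') := by
      refine le_trans ?_ hG
      refine lintegral_mono fun x => ?_
      calc Tn n x ^ b = Tn n x * Tn n x ^ (b - 1) := by
            have := ENNReal.rpow_add_of_nonneg (x := Tn n x) 1 (b - 1) zero_le_one (by linarith)
            rw [ENNReal.rpow_one] at this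
            rw [← this]; congr 1; ring
        _ ≤ _ := by gcongr; exact hTle n x
    have e2 : S = S ^ (1 / b) * S ^ (1 / b') := by
      rw [← ENNReal.rpow_add _ _ h0 hSt]
      have := hbb.inv_add_inv_eq_one
      rw [one_div, one_div, this, ENNReal.rpow_one]
    have h2 : S ^ (1 / b) ≤ N := by
      have hp0 : S ^ (1 / b') ≠ 0 := (ENNReal.rpow_pos (pos_iff_ne_zero.2 h0) hSt).ne'
      have hpt : S ^ (1 / b') ≠ ∞ := ENNReal.rpow_ne_top_of_nonneg (by positivity) hSt
      have h3 : S ^ (1 / b) * S ^ (1 / b') ≤ N * S ^ (1 / b') := e2.symm.le.trans h1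
      exact (ENNReal.mul_le_mul_iff_left hp0 hpt).1 h3
    calc S = (S ^ (1 / b)) ^ b := by
          rw [← ENNReal.rpow_mul, one_div_mul_cancel (by linarith), ENNReal.rpow_one]
      _ ≤ _ := by gcongr
  have : ∫⁻ x, T x ^ b ∂ν = ⨆ n, ∫⁻ x, Tn n x ^ b ∂ν := by
    rw [← lintegral_iSup (fun n => (hTn n).pow_const _)]
    · congr 1; ext x
      rw [← hsup x]
      exact (ENNReal.orderIsoRpow b (by linarith)).map_iSup _
    · intro n m hnm x
      exact ENNReal.rpow_le_rpow (hmono hnm x) (by linarith)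
  rw [this]
  exact iSup_le hn

lemma sparse_bound [Nonempty X] {μ ν τ : Measure X} (hμ : BallsPosFinite μ) (hν : BallsPosFinite ν)
    (hτ : BallsPosFinite τ) {s a a' b b' : ℝ} (haa : a.HolderConjugate a')
    (hbb : b.HolderConjugate b') (hab : a ≤ b) {K : ℝ≥0∞}
    (hmix : ∀ (x : X) (r : ℝ), 0 < r → ENNReal.ofReal (r ^ s) * ν (ball x r) ^ (1 / b) *
      τ (ball x r) ^ (1 / a') ≤ K * μ (ball x r)) {H1 H2 : ℝ≥0∞}
    (hH1 : ∀ g : X → ℝ≥0∞, Measurable g → ∫⁻ x, Mx τ g x ^ a ∂τ ≤ H1 * ∫⁻ x, g x ^ a ∂τ)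
    (hH2 : ∀ g : X → ℝ≥0∞, Measurable g → ∫⁻ x, Mx ν g x ^ b' ∂ν ≤ H2 * ∫⁻ x, g x ^ b' ∂ν)
    {ι : Type*} [Countable ι] (z : ι → X) (R : ι → ℝ) (hR : ∀ i, 0 < R i) (E : ι → Set X)
    (hEm : ∀ i, MeasurableSet (E i)) (hEd : Pairwise (Function.onFun Disjoint E))
    (hEs : ∀ i, E i ⊆ ball (z i) (R i)) {C1 C2 : ℝ≥0∞}
    (hC1 : ∀ i, τ (ball (z i) (R i)) ≤ C1 * τ (E i))
    (hC2 : ∀ i, ν (ball (z i) (R i)) ≤ C2 * ν (E i))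
    (g : X → ℝ≥0∞) (hg : Measurable g) (c : ι → ℝ≥0∞) (L : ℝ≥0∞)
    (hc : ∀ i, c i * μ (ball (z i) (R i)) ≤ L * ∫⁻ y in ball (z i) (R i), g y ∂τ) :
    ∫⁻ x, (∑' i, (ball (z i) (R i)).indicator (fun _ => c i * ENNReal.ofReal (R i ^ s)) x) ^ b ∂ν ≤
      (L * K * (C1 * H1 * ∫⁻ x, g x ^ a ∂τ) ^ (1 / a) * (C2 * H2) ^ (1 / b')) ^ b := by
  have hm : ∀ i, Measurable ((ball (z i) (R i)).indicator
      (fun _ => c i * ENNReal.ofReal (R i ^ s))) := fun i => measurable_const.indicator measurableSet_ball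
  have hb'0 : 0 < b' := by linarith [hbb.symm.lt]
  refine dualize hν hbb _ (Measurable.tsum hm) _ fun G hG => ?_
  have hsf := sparse_form hμ hν hτ haa hbb hab hmix hH1 hH2 z R hR E hEm hEd hEs hC1 hC2 g G hg hG
  calc _ = ∑' i, c i * ENNReal.ofReal (R i ^ s) * ∫⁻ x in ball (z i) (R i), G x ∂ν := by
        simp_rw [← ENNReal.tsum_mul_right]
        rw [lintegral_tsum (f := fun i x => (ball (z i) (R i)).indicator
          (fun x => c i * ENNReal.ofReal (R i ^ s)) x * G x) fun i => ((hm i).mul hG).aemeasurable]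
        congr 1; ext i
        rw [← lintegral_indicator measurableSet_ball, ← lintegral_const_mul _ (hG.indicator measurableSet_ball)]
        congr 1; ext x
        by_cases hx : x ∈ ball (z i) (R i)
        · simp only [indicator_of_mem hx]
        · simp only [indicator_of_notMem hx]; simp
    _ ≤ ∑' i, L * (ENNReal.ofReal (R i ^ s) * (∫⁻ y in ball (z i) (R i), g y ∂τ) / μ (ball (z i) (R i)) *
        (∫⁻ y in ball (z i) (R i), G y ∂ν)) := by
        refine ENNReal.tsum_le_tsum fun i => ?_
        have hμ0 := (hμ (z i) (R i) (hR i)).1.ne'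
        have hμt := (hμ (z i) (R i) (hR i)).2.ne
        have := (ENNReal.le_div_iff_mul_le (Or.inl hμ0) (Or.inl hμt)).2 (hc i)
        calc _ ≤ L * (∫⁻ y in ball (z i) (R i), g y ∂τ) / μ (ball (z i) (R i)) * ENNReal.ofReal (R i ^ s) *
              ∫⁻ x in ball (z i) (R i), G x ∂ν := by gcongr
          _ = _ := by simp only [div_eq_mul_inv]; ring
    _ ≤ L * (K * ((C1 * H1 * ∫⁻ x, g x ^ a ∂τ) ^ (1 / a) * (C2 * H2 * ∫⁻ x, G x ^ b' ∂ν) ^ (1 / b'))) := by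
        rw [ENNReal.tsum_mul_left]; gcongr
    _ = _ := by
        rw [ENNReal.mul_rpow_of_nonneg (C2 * H2) _ (by positivity)]; ring


lemma doub3 {μ : Measure X} {D : ℝ≥0∞}
    (hD : ∀ (x : X) (r : ℝ), 0 < r → μ (ball x (2 * r)) ≤ D * μ (ball x r)) (x : X) {r : ℝ}
    (hr : 0 < r) : μ (ball x (8 * r)) ≤ D ^ 3 * μ (ball x r) := by
  have h1 := hD x r hr
  have h2 := hD x (2 * r) (by positivity)
  have h3 := hD x (2 * (2 * r)) (by positivity)
  have e : 8 * r = 2 * (2 * (2 * r)) := by ring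
  rw [e]
  calc _ ≤ D * (D * (D * μ (ball x r))) := h3.trans (mul_le_mul' le_rfl (h2.trans (mul_le_mul' le_rfl h1)))
    _ = _ := by ring

lemma Om_anti {μ : Measure X} {f : X → ℝ≥0∞} {l l' : ℝ≥0∞} (h : l ≤ l') : Om μ f l' ⊆ Om μ f l := by
  intro x hx
  rw [mem_Om] at *
  obtain ⟨z, r, h1, h2, h3⟩ := hx
  exact ⟨z, r, h1, (mul_le_mul' h le_rfl).trans_lt h2, h3⟩

lemma riesz_le_sum {μ : Measure X} {D : ℝ≥0∞} {s : ℝ} (hs : 0 < s)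
    (hD : ∀ (x : X) (r : ℝ), 0 < r → μ (ball x (2 * r)) ≤ D * μ (ball x r))
    (hμ : BallsPosFinite μ)
    (f : X → ℝ≥0∞) (hf : Measurable f) (x : X) : rieszPotential μ s f x ≤
      ∑' j : ℤ, D * (ENNReal.ofReal (((2 : ℝ) ^ j) ^ s) *
        ((∫⁻ y in ball x ((2 : ℝ) ^ j), f y ∂μ) / μ (ball x ((2 : ℝ) ^ j)))) := by
  have e : ∀ j : ℤ, D * (ENNReal.ofReal (((2 : ℝ) ^ j) ^ s) *
        ((∫⁻ y in ball x ((2 : ℝ) ^ j), f y ∂μ) / μ (ball x ((2 : ℝ) ^ j)))) =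
      ∫⁻ y, (D * (ENNReal.ofReal (((2 : ℝ) ^ j) ^ s) / μ (ball x ((2 : ℝ) ^ j)))) *
        (ball x ((2 : ℝ) ^ j)).indicator f y ∂μ := by
    intro j
    rw [lintegral_const_mul _ (hf.indicator measurableSet_ball), lintegral_indicator measurableSet_ball]
    simp only [div_eq_mul_inv]; ring
  simp_rw [e]
  rw [← lintegral_tsum fun j => ((hf.indicator measurableSet_ball).const_mul _).aemeasurable]
  refine lintegral_mono fun y => ?_
  rcases eq_or_ne x y with rfl | hxy
  · simp [Real.zero_rpow hs.ne']
  have hd : 0 < dist x y := dist_pos.2 hxy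
  obtain ⟨n, hn1, hn2⟩ := exists_mem_Ico_zpow hd (y := (2 : ℝ)) (by norm_num)
  refine le_trans ?_ (ENNReal.le_tsum (n + 1))
  have hy : y ∈ ball x ((2 : ℝ) ^ (n + 1)) := by rw [mem_ball, dist_comm]; exact hn2
  rw [indicator_of_mem hy]
  have hp : (0 : ℝ) < 2 ^ n := by positivity
  have e2 : (2 : ℝ) ^ (n + 1) = 2 * 2 ^ n := by rw [zpow_add₀ (by norm_num)]; ring
  have h1 : μ (ball x ((2 : ℝ) ^ (n + 1))) ≤ D * μ (ball x (dist x y)) := by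
    rw [e2]
    exact (hD x _ hp).trans (mul_le_mul' le_rfl (measure_mono (ball_subset_ball hn1)))
  have h2 : (μ (ball x (dist x y)))⁻¹ ≤ D * (μ (ball x ((2 : ℝ) ^ (n + 1))))⁻¹ := by
    have hb := hμ x (dist x y) hd
    have hb2 := hμ x ((2 : ℝ) ^ (n + 1)) (by positivity)
    rw [← div_eq_mul_inv, ENNReal.le_div_iff_mul_le (Or.inl hb2.1.ne') (Or.inl hb2.2.ne), mul_comm,
      ← div_eq_mul_inv]
    exact ENNReal.div_le_of_le_mul h1
  calc _ = f y * ENNReal.ofReal (dist x y ^ s) * (μ (ball x (dist x y)))⁻¹ := by rw [div_eq_mul_inv]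
    _ ≤ f y * ENNReal.ofReal (((2 : ℝ) ^ (n + 1)) ^ s) * (D * (μ (ball x ((2 : ℝ) ^ (n + 1))))⁻¹) := by
      gcongr
    _ = _ := by simp only [div_eq_mul_inv]; ring

lemma domination [Nonempty X] {μ : Measure X} (hμ : BallsPosFinite μ) {D : ℝ≥0∞} (hDt : D ≠ ∞)
    (hD : ∀ (x : X) (r : ℝ), 0 < r → μ (ball x (2 * r)) ≤ D * μ (ball x r)) {s : ℝ} (hs : 0 < s) :
    ∃ A C : ℝ≥0∞, C ≠ ∞ ∧ ∀ f : X → ℝ≥0∞, Measurable f →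
      (∀ (x : X) (r : ℝ), 0 < r → ∫⁻ y in ball x r, f y ∂μ ≠ ∞) →
      ∀ S : Set X, (∀ l : ℝ≥0∞, l ≠ 0 → ∃ R : ℝ, ∀ x ∈ S, ∀ r : ℝ, 0 < r →
        l * μ (ball x r) < ∫⁻ y in ball x r, f y ∂μ → r ≤ R) →
      ∃ (U : Set (ℤ × X)) (J : ℤ × X → ℤ) (E : ℤ × X → Set X), U.Countable ∧
        (∀ i ∈ U, MeasurableSet (E i)) ∧ U.PairwiseDisjoint E ∧
        (∀ i ∈ U, E i ⊆ ball i.2 ((2 : ℝ) ^ (J i + 3))) ∧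
        (∀ i ∈ U, μ (ball i.2 ((2 : ℝ) ^ (J i + 3))) ≤ (2 * D ^ 3) * μ (E i)) ∧
        (∀ i ∈ U, A ^ i.1 * μ (ball i.2 ((2 : ℝ) ^ (J i + 3))) ≤
          D ^ 3 * ∫⁻ y in ball i.2 ((2 : ℝ) ^ (J i + 3)), f y ∂μ) ∧
        ∀ x ∈ S, rieszPotential μ s f x ≤ C * ∑' i : U, (ball (i : ℤ × X).2 ((2 : ℝ) ^ (J i + 3))).indicator
          (fun _ => A ^ (i : ℤ × X).1 * ENNReal.ofReal (((2 : ℝ) ^ (J i + 3)) ^ s)) x := by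
  have hp : ∀ j : ℤ, (0 : ℝ) < 2 ^ j := fun j => by positivity
  have h5 : ∀ (x : X) (r : ℝ), 0 < r → μ (ball x (5 * r)) ≤ D ^ 3 * μ (ball x r) := fun x r hr =>
    (measure_mono (ball_subset_ball (by linarith))).trans (doub3 hD x hr)
  set A : ℝ≥0∞ := 2 * (D ^ 3 * D ^ 3) + D ^ 3 + 2 with hA
  have hAt : A ≠ ∞ := by
    have : D ^ 3 ≠ ∞ := ENNReal.pow_ne_top hDt
    exact ENNReal.add_ne_top.2 ⟨ENNReal.add_ne_top.2 ⟨ENNReal.mul_ne_top (by norm_num) (ENNReal.mul_ne_top this this), this⟩, by norm_num⟩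
  have hA1 : 1 < A := lt_of_lt_of_le (by norm_num : (1 : ℝ≥0∞) < 2) le_add_self
  have hA0 : A ≠ 0 := (zero_lt_one.trans hA1).ne'
  have hAD : D ^ 3 ≤ A := by rw [hA, add_assoc]; exact le_add_of_le_right le_self_add
  have hAD2 : 2 * (D ^ 3 * D ^ 3) ≤ A := by rw [hA, add_assoc]; exact le_self_add
  have hz0 : ∀ l : ℤ, A ^ l ≠ 0 := fun l => (ENNReal.zpow_pos hA0 hAt l).ne'
  have hzt : ∀ l : ℤ, A ^ l ≠ ∞ := fun l => (ENNReal.zpow_lt_top hA0 hAt l).ne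
  have hy1 : (1 : ℝ≥0∞) < ENNReal.ofReal ((2 : ℝ) ^ s) := by
    rw [← ENNReal.ofReal_one, ENNReal.ofReal_lt_ofReal_iff (by positivity)]
    exact Real.one_lt_rpow (by norm_num) hs
  have hys : ∀ j : ℤ, ENNReal.ofReal (((2 : ℝ) ^ j) ^ s) = ENNReal.ofReal ((2 : ℝ) ^ s) ^ j := by
    intro j
    rw [← ENNReal.rpow_intCast, ENNReal.ofReal_rpow_of_pos (by positivity)]
    congr 1
    rw [← Real.rpow_intCast, ← Real.rpow_mul (by norm_num), ← Real.rpow_mul (by norm_num), mul_comm]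
  obtain ⟨cg, hcg, -, hcgm⟩ := zgeom hy1 ENNReal.ofReal_ne_top
  refine ⟨A, D * (A * cg), ENNReal.mul_ne_top hDt (ENNReal.mul_ne_top hAt hcg), ?_⟩
  intro f hf hfin S hS
  let P : ℤ → X → ℤ → Prop := fun k x j =>
    A ^ k * μ (ball x ((2 : ℝ) ^ j)) < ∫⁻ y in ball x ((2 : ℝ) ^ j), f y ∂μ
  let t : ℤ → Set X := fun k => {x | x ∈ S ∧ ∃ j, P k x j}
  have hJ : ∀ i : ℤ × X, ∃ J, i.2 ∈ t i.1 → P i.1 i.2 J ∧ ∀ j, P i.1 i.2 j → j ≤ J := by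
    intro i
    by_cases hi : i.2 ∈ t i.1
    · obtain ⟨R, hR⟩ := hS (A ^ i.1) (hz0 _)
      obtain ⟨m, hm⟩ := pow_unbounded_of_one_lt R (one_lt_two)
      obtain ⟨J, hJ⟩ := Int.exists_greatest_of_bdd (P := P i.1 i.2) ⟨(m : ℤ), fun j hj => by
        have h1 := (hR _ hi.1 _ (hp j) hj).trans_lt hm
        rw [← zpow_natCast, zpow_lt_zpow_iff_right₀ (by norm_num)] at h1
        exact h1.le⟩ hi.2
      exact ⟨J, fun _ => hJ⟩
    · exact ⟨0, fun h => absurd h hi⟩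
  choose J hJ using hJ
  have hV : ∀ k : ℤ, ∃ u ⊆ t k, u.PairwiseDisjoint (fun x => ball x ((2 : ℝ) ^ J (k, x))) ∧
      ∀ a ∈ t k, ∃ b ∈ u, (ball a ((2 : ℝ) ^ J (k, a)) ∩ ball b ((2 : ℝ) ^ J (k, b))).Nonempty ∧
        (2 : ℝ) ^ J (k, a) ≤ 2 * (2 : ℝ) ^ J (k, b) := by
    intro k
    obtain ⟨R, hR⟩ := hS (A ^ k) (hz0 _)
    exact Vitali.exists_disjoint_subfamily_covering_enlargement
      (fun x => ball x ((2 : ℝ) ^ J (k, x))) (t k) (fun x => (2 : ℝ) ^ J (k, x)) 2 (by norm_num)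
      (fun a _ => (hp _).le) R (fun a ha => hR a ha.1 _ (hp _) (hJ (k, a) ha).1)
      (fun a _ => ⟨a, mem_ball_self (hp _)⟩)
  choose u hut hud hcov using hV
  let U : Set (ℤ × X) := {i | i.2 ∈ u i.1}
  let E : ℤ × X → Set X := fun i => ball i.2 ((2 : ℝ) ^ J i) \ Om μ f (A ^ (i.1 + 1))
  have hUJ : ∀ i ∈ U, P i.1 i.2 (J i) ∧ ∀ j, P i.1 i.2 j → j ≤ J i := fun i hi => hJ i (hut _ hi)
  have h8 : ∀ j : ℤ, (2 : ℝ) ^ (j + 3) = 8 * 2 ^ j := by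
    intro j; rw [zpow_add₀ (by norm_num)]; norm_num; ring
  have h4 : ∀ j : ℤ, (2 : ℝ) ^ (j + 2) = 4 * 2 ^ j := by
    intro j; rw [zpow_add₀ (by norm_num)]; norm_num; ring
  have hmeasE : ∀ i : ℤ × X, MeasurableSet (E i) := fun i =>
    measurableSet_ball.diff (isOpen_Om _ _ _).measurableSet
  have hhalf : ∀ i ∈ U, μ (ball i.2 ((2 : ℝ) ^ J i)) ≤ 2 * μ (E i) := by
    intro i hi
    obtain ⟨hPi, hmax⟩ := hUJ i hi
    set B := ball i.2 ((2 : ℝ) ^ J i) with hB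
    have hBt : μ B ≠ ∞ := (hμ _ _ (hp _)).2.ne
    have hsub : B ∩ Om μ f (A ^ (i.1 + 1)) ⊆
        Om μ ((ball i.2 ((2 : ℝ) ^ (J i + 2))).indicator f) (A ^ (i.1 + 1)) := by
      rintro y ⟨hyB, hyO⟩
      rw [mem_Om] at hyO ⊢
      obtain ⟨z, r, hr, hzr, hyz⟩ := hyO
      rw [hB, mem_ball] at hyB
      rw [mem_ball] at hyz
      have hzx : dist z i.2 < r + 2 ^ J i := by
        have := dist_triangle z y i.2
        rw [dist_comm z y] at this
        linarith
      have hrsmall : r < 2 ^ J i := by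
        by_contra hcon
        push Not at hcon
        obtain ⟨n, hn1, hn2⟩ := exists_mem_Ioc_zpow (x := 3 * r) (y := (2 : ℝ)) (by positivity) (by norm_num)
        have e2 : (2 : ℝ) ^ (n + 1) = 2 * 2 ^ n := by rw [zpow_add₀ (by norm_num)]; ring
        have hgt : J i < n + 1 := by
          have : (2 : ℝ) ^ J i < 2 ^ (n + 1) := by linarith [hp (J i)]
          rwa [zpow_lt_zpow_iff_right₀ (by norm_num)] at this
        have hnot : ¬ P i.1 i.2 (n + 1) := fun h => absurd (hmax _ h) (not_le.2 hgt)
        simp only [P, not_lt] at hnot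
        have s1 : ball z r ⊆ ball i.2 ((2 : ℝ) ^ (n + 1)) := by
          intro w hw
          rw [mem_ball] at *
          have := dist_triangle w z i.2
          linarith
        have s2 : ball i.2 ((2 : ℝ) ^ (n + 1)) ⊆ ball z (8 * r) := by
          intro w hw
          rw [mem_ball] at *
          have := dist_triangle w i.2 z
          rw [dist_comm i.2 z] at this
          linarith
        have : ∫⁻ y in ball z r, f y ∂μ ≤ A ^ (i.1 + 1) * μ (ball z r) := by
          calc _ ≤ ∫⁻ y in ball i.2 ((2 : ℝ) ^ (n + 1)), f y ∂μ := lintegral_mono_set s1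
            _ ≤ A ^ i.1 * μ (ball i.2 ((2 : ℝ) ^ (n + 1))) := hnot
            _ ≤ A ^ i.1 * (D ^ 3 * μ (ball z r)) :=
              mul_le_mul' le_rfl ((measure_mono s2).trans (doub3 hD z hr))
            _ ≤ A ^ i.1 * (A * μ (ball z r)) := by gcongr
            _ = _ := by rw [ENNReal.zpow_add hA0 hAt, zpow_one]; ring
        exact absurd hzr (not_lt.2 this)
      refine ⟨z, r, hr, ?_, hyz⟩
      have s1 : ball z r ⊆ ball i.2 ((2 : ℝ) ^ (J i + 2)) := by
        intro w hw
        rw [mem_ball] at *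
        have := dist_triangle w z i.2
        rw [h4]
        linarith [hp (J i)]
      rw [setLIntegral_indicator measurableSet_ball, inter_eq_right.2 s1]
      exact hzr
    have hw := weak_type hμ h5 ((ball i.2 ((2 : ℝ) ^ (J i + 2))).indicator f) (A ^ (i.1 + 1))
    rw [lintegral_indicator measurableSet_ball] at hw
    have hnot : ¬ P i.1 i.2 (J i + 2) := fun h => absurd (hmax _ h) (by omega)
    simp only [P, not_lt] at hnot
    have hb4 : μ (ball i.2 ((2 : ℝ) ^ (J i + 2))) ≤ D ^ 3 * μ B := by
      refine (measure_mono (ball_subset_ball ?_)).trans (doub3 hD i.2 (hp (J i)))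
      rw [h4]; linarith [hp (J i)]
    have hsmall : 2 * μ (B ∩ Om μ f (A ^ (i.1 + 1))) ≤ μ B := by
      have h1 : A ^ (i.1 + 1) * (2 * μ (B ∩ Om μ f (A ^ (i.1 + 1)))) ≤ A ^ (i.1 + 1) * μ B := by
        calc _ = 2 * (A ^ (i.1 + 1) * μ (B ∩ Om μ f (A ^ (i.1 + 1)))) := by ring
          _ ≤ 2 * (D ^ 3 * (A ^ i.1 * (D ^ 3 * μ B))) := by
            refine mul_le_mul' le_rfl (le_trans (mul_le_mul' le_rfl (measure_mono hsub)) (hw.trans ?_))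
            exact mul_le_mul' le_rfl (hnot.trans (mul_le_mul' le_rfl hb4))
          _ = A ^ i.1 * (2 * (D ^ 3 * D ^ 3)) * μ B := by ring
          _ ≤ A ^ i.1 * A * μ B := by gcongr
          _ = _ := by rw [ENNReal.zpow_add hA0 hAt, zpow_one]
      exact (ENNReal.mul_le_mul_iff_right (hz0 _) (hzt _)).1 h1
    have hsplit : μ B ≤ μ (E i) + μ (B ∩ Om μ f (A ^ (i.1 + 1))) := by
      have := measure_inter_add_diff (μ := μ) B (isOpen_Om μ f (A ^ (i.1 + 1))).measurableSet
      rw [← this, add_comm]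
    have h2 : μ B + μ B ≤ 2 * μ (E i) + μ B := by
      calc μ B + μ B = 2 * μ B := by ring
        _ ≤ 2 * (μ (E i) + μ (B ∩ Om μ f (A ^ (i.1 + 1)))) := mul_le_mul' le_rfl hsplit
        _ = 2 * μ (E i) + 2 * μ (B ∩ Om μ f (A ^ (i.1 + 1))) := by ring
        _ ≤ _ := by gcongr
    exact (ENNReal.add_le_add_iff_right hBt).1 h2
  refine ⟨U, J, E, ?_, fun i _ => hmeasE i, ?_, ?_, ?_, ?_, ?_⟩
  · have : U = ⋃ k : ℤ, (fun x => (k, x)) '' u k := by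
      ext ⟨k, x⟩; simp [U]
    rw [this]
    exact countable_iUnion fun k => (countable_of_disjoint hμ (u k) (fun x => x) _ (fun _ _ => hp _) (hud k)).image _
  · have hlt : ∀ i ∈ U, ∀ i' ∈ U, i.1 < i'.1 → Disjoint (E i) (E i') := by
      intro i hi i' hi' hlt
      rw [Set.disjoint_left]
      rintro y ⟨-, hy⟩ ⟨hy', -⟩
      refine hy (Om_anti (ENNReal.zpow_le_of_le hA1.le (by omega : i.1 + 1 ≤ i'.1)) ?_)
      rw [mem_Om]
      exact ⟨_, _, hp _, (hUJ i' hi').1, hy'⟩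
    intro i hi i' hi' hne
    rcases lt_trichotomy i.1 i'.1 with h | h | h
    · exact hlt i hi i' hi' h
    · have hne2 : i.2 ≠ i'.2 := fun h2 => hne (Prod.ext h h2)
      have hi2 : i'.2 ∈ u i.1 := by rw [h]; exact hi'
      have := hud i.1 hi hi2 hne2
      simp only [Function.onFun] at this
      refine Disjoint.mono diff_subset diff_subset ?_
      have e : (i.1, i'.2) = i' := by rw [h]
      rw [e] at this
      exact this
    · exact (hlt i' hi' i hi h).symm
  · intro i hi
    refine diff_subset.trans (ball_subset_ball ?_)
    rw [h8]; linarith [hp (J i)]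
  · intro i hi
    rw [h8]
    calc _ ≤ D ^ 3 * μ (ball i.2 ((2 : ℝ) ^ J i)) := doub3 hD _ (hp _)
      _ ≤ D ^ 3 * (2 * μ (E i)) := mul_le_mul' le_rfl (hhalf i hi)
      _ = _ := by ring
  · intro i hi
    calc _ ≤ A ^ i.1 * (D ^ 3 * μ (ball i.2 ((2 : ℝ) ^ J i))) := by
          rw [h8]; exact mul_le_mul' le_rfl (doub3 hD _ (hp _))
      _ = D ^ 3 * (A ^ i.1 * μ (ball i.2 ((2 : ℝ) ^ J i))) := by ring
      _ ≤ D ^ 3 * ∫⁻ y in ball i.2 ((2 : ℝ) ^ J i), f y ∂μ := mul_le_mul' le_rfl (hUJ i hi).1.le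
      _ ≤ _ := by
        refine mul_le_mul' le_rfl (lintegral_mono_set (ball_subset_ball ?_))
        rw [h8]; linarith [hp (J i)]
  · intro x hx
    refine (riesz_le_sum hs hD hμ f hf x).trans ?_
    rw [ENNReal.tsum_mul_left, mul_assoc]
    refine mul_le_mul' le_rfl ?_
    calc _ ≤ ∑' j : ℤ, ∑' i : U, (ball (i : ℤ × X).2 ((2 : ℝ) ^ (J i + 3))).indicator
          (fun _ => A * A ^ (i : ℤ × X).1 * (if j ≤ J i + 3 then ENNReal.ofReal ((2 : ℝ) ^ s) ^ j else 0)) x := by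
          refine ENNReal.tsum_le_tsum fun j => ?_
          set av := (∫⁻ y in ball x ((2 : ℝ) ^ j), f y ∂μ) / μ (ball x ((2 : ℝ) ^ j)) with hav
          have hb := hμ x _ (hp j)
          rcases eq_or_ne av 0 with h0 | h0
          · rw [h0, mul_zero]; exact zero_le
          have hat : av ≠ ∞ := ENNReal.div_ne_top (hfin x _ (hp j)) hb.1.ne'
          obtain ⟨k, hk1, hk2⟩ := ENNReal.exists_mem_Ioc_zpow h0 hat hA1 hAt
          have hPk : P k x j := by
            rw [hav, ENNReal.lt_div_iff_mul_lt (Or.inl hb.1.ne') (Or.inl hb.2.ne)] at hk1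
            exact hk1
          have hxt : x ∈ t k := ⟨hx, j, hPk⟩
          obtain ⟨b, hbu, ⟨w, hw1, hw2⟩, hab⟩ := hcov k x hxt
          have hjJ : j ≤ J (k, x) := (hJ (k, x) hxt).2 j hPk
          have hbU : (k, b) ∈ U := hbu
          refine le_trans ?_ (ENNReal.le_tsum (⟨(k, b), hbU⟩ : U))
          have hxb : x ∈ ball b ((2 : ℝ) ^ (J (k, b) + 3)) := by
            rw [mem_ball] at *
            have := dist_triangle x w b
            rw [dist_comm x w] at this
            rw [h8]
            linarith [hp (J (k, b))]
          have hle : j ≤ J (k, b) + 3 := by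
            have : (2 : ℝ) ^ J (k, x) < 2 ^ (J (k, b) + 3) := by rw [h8]; linarith [hp (J (k, b))]
            rw [zpow_lt_zpow_iff_right₀ (by norm_num)] at this
            omega
          rw [indicator_of_mem hxb, if_pos hle, hys]
          rw [ENNReal.zpow_add hA0 hAt, zpow_one] at hk2
          calc _ ≤ ENNReal.ofReal ((2 : ℝ) ^ s) ^ j * (A ^ k * A) := mul_le_mul' le_rfl hk2
            _ = _ := by ring
      _ = ∑' i : U, (ball (i : ℤ × X).2 ((2 : ℝ) ^ (J i + 3))).indicator
          (fun _ => A * A ^ (i : ℤ × X).1 * ∑' j : ℤ, (if j ≤ J i + 3 then ENNReal.ofReal ((2 : ℝ) ^ s) ^ j else 0)) x := by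
          rw [ENNReal.tsum_comm]
          congr 1; ext i
          by_cases hxi : x ∈ ball (i : ℤ × X).2 ((2 : ℝ) ^ (J i + 3))
          · simp only [indicator_of_mem hxi]; rw [ENNReal.tsum_mul_left]
          · simp only [indicator_of_notMem hxi]; simp
      _ ≤ _ := by
          rw [← ENNReal.tsum_mul_left]
          refine ENNReal.tsum_le_tsum fun i => ?_
          by_cases hxi : x ∈ ball (i : ℤ × X).2 ((2 : ℝ) ^ (J i + 3))
          · simp only [indicator_of_mem hxi]
            rw [hys]
            calc _ ≤ A * A ^ (i : ℤ × X).1 * (cg * ENNReal.ofReal ((2 : ℝ) ^ s) ^ (J i + 3)) :=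
                  mul_le_mul' le_rfl (hcgm _)
              _ = _ := by ring
          · simp only [indicator_of_notMem hxi]; exact zero_le


/-- abstract A-infinity relation -/
def AI (μ ν : Measure X) : Prop := ∀ L : ℝ≥0∞, L ≠ ∞ → ∃ C : ℝ≥0∞, C ≠ ∞ ∧ ∀ (x : X) (r : ℝ), 0 < r →
  ∀ E : Set X, MeasurableSet E → E ⊆ ball x r → μ (ball x r) ≤ L * μ E → ν (ball x r) ≤ C * ν E

lemma AI.doub {μ ν : Measure X} (h : AI μ ν) {D : ℝ≥0∞} (hDt : D ≠ ∞)
    (hD : ∀ (x : X) (r : ℝ), 0 < r → μ (ball x (2 * r)) ≤ D * μ (ball x r)) :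
    ∃ C : ℝ≥0∞, C ≠ ∞ ∧ ∀ (x : X) (r : ℝ), 0 < r → ν (ball x (5 * r)) ≤ C * ν (ball x r) := by
  obtain ⟨C, hC, h⟩ := h (D ^ 3) (ENNReal.pow_ne_top hDt)
  refine ⟨C, hC, fun x r hr => h x (5 * r) (by positivity) _ measurableSet_ball
    (ball_subset_ball (by linarith)) ?_⟩
  exact (measure_mono (ball_subset_ball (by linarith))).trans (doub3 hD x hr)

lemma core [Nonempty X] {μ ν τ : Measure X} (hμ : BallsPosFinite μ) (hν : BallsPosFinite ν)
    (hτ : BallsPosFinite τ) {D : ℝ≥0∞} (hDt : D ≠ ∞)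
    (hD : ∀ (x : X) (r : ℝ), 0 < r → μ (ball x (2 * r)) ≤ D * μ (ball x r))
    (aν : AI μ ν) (aτ : AI μ τ)
    {s a a' b b' : ℝ} (hs : 0 < s) (haa : a.HolderConjugate a')
    (hbb : b.HolderConjugate b') (hab : a ≤ b) {K : ℝ≥0∞} (hK : K ≠ ∞)
    (hmix : ∀ (x : X) (r : ℝ), 0 < r → ENNReal.ofReal (r ^ s) * ν (ball x r) ^ (1 / b) *
      τ (ball x r) ^ (1 / a') ≤ K * μ (ball x r)) :
    ∃ C : ℝ≥0∞, C ≠ ∞ ∧ ∀ f g : X → ℝ≥0∞, Measurable f → Measurable g →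
      (∀ (x : X) (r : ℝ), 0 < r → ∫⁻ y in ball x r, f y ∂μ = ∫⁻ y in ball x r, g y ∂τ) →
      ∫⁻ x, g x ^ a ∂τ ≠ ∞ →
      ∫⁻ x, rieszPotential μ s f x ^ b ∂ν ≤ (C * (∫⁻ x, g x ^ a ∂τ) ^ (1 / a)) ^ b := by
  have ha := haa.lt
  have hb := hbb.lt
  have ha0 : 0 < a := by linarith
  have hb0 : 0 < b := by linarith
  have ha'0 : 0 < a' := by linarith [haa.symm.lt]
  have hb'0 : 0 < b' := by linarith [hbb.symm.lt]
  obtain ⟨dν, hdν, hdν'⟩ := aν.doub hDt hD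
  obtain ⟨dτ, hdτ, hdτ'⟩ := aτ.doub hDt hD
  obtain ⟨H1, hH1t, hH1⟩ := HL hτ hdτ hdτ' ha
  obtain ⟨H2, hH2t, hH2⟩ := HL hν hdν hdν' hbb.symm.lt
  have hD3 : D ^ 3 ≠ ∞ := ENNReal.pow_ne_top hDt
  obtain ⟨C1, hC1t, hC1⟩ := aτ (2 * D ^ 3) (ENNReal.mul_ne_top (by norm_num) hD3)
  obtain ⟨C2, hC2t, hC2⟩ := aν (2 * D ^ 3) (ENNReal.mul_ne_top (by norm_num) hD3)
  obtain ⟨A, Cd, hCd, hdom⟩ := domination hμ hDt hD hs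
  refine ⟨Cd * (D ^ 3 * K * (C1 * H1) ^ (1 / a) * (C2 * H2) ^ (1 / b')), ?_, ?_⟩
  · refine ENNReal.mul_ne_top hCd (ENNReal.mul_ne_top (ENNReal.mul_ne_top (ENNReal.mul_ne_top hD3 hK) ?_) ?_)
    · exact ENNReal.rpow_ne_top_of_nonneg (by positivity) (ENNReal.mul_ne_top hC1t hH1t)
    · exact ENNReal.rpow_ne_top_of_nonneg (by positivity) (ENNReal.mul_ne_top hC2t hH2t)
  intro f g hf hg hfg hN
  set N := (∫⁻ x, g x ^ a ∂τ) ^ (1 / a) with hNdef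
  have hNt : N ≠ ∞ := ENNReal.rpow_ne_top_of_nonneg (by positivity) hN
  have hhol : ∀ (x : X) (r : ℝ), 0 < r → ∫⁻ y in ball x r, f y ∂μ ≤ N * τ (ball x r) ^ (1 / a') := by
    intro x r hr
    rw [hfg x r hr]
    have := ENNReal.lintegral_mul_le_Lp_mul_Lq (τ.restrict (ball x r)) haa (f := g) (g := fun _ => 1)
      hg.aemeasurable measurable_const.aemeasurable
    simp only [Pi.mul_apply, mul_one, ENNReal.one_rpow, lintegral_one, Measure.restrict_apply, MeasurableSet.univ, univ_inter] at this
    refine this.trans (mul_le_mul' (ENNReal.rpow_le_rpow (setLIntegral_le_lintegral _ _) (by positivity)) le_rfl)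
  have hfin : ∀ (x : X) (r : ℝ), 0 < r → ∫⁻ y in ball x r, f y ∂μ ≠ ∞ := fun x r hr =>
    ne_top_of_le_ne_top (ENNReal.mul_ne_top hNt
      (ENNReal.rpow_ne_top_of_nonneg (by positivity) (hτ x r hr).2.ne)) (hhol x r hr)
  obtain ⟨x0⟩ := id ‹Nonempty X›
  have hloc : ∀ n : ℕ, ∫⁻ x in ball x0 (n + 1), rieszPotential μ s f x ^ b ∂ν ≤
      (Cd * (D ^ 3 * K * (C1 * H1) ^ (1 / a) * (C2 * H2) ^ (1 / b')) * N) ^ b := by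
    intro n
    have hn1 : (0 : ℝ) < n + 1 := by positivity
    obtain ⟨U, J, E, hUc, hEm, hEd, hEs, hEμ, hAf, hpt⟩ := hdom f hf hfin (ball x0 (n + 1)) (by
      intro l hl
      set om := ν (ball x0 (n + 1)) ^ (1 / b) with hom
      have hom0 : om ≠ 0 := (ENNReal.rpow_pos (hν x0 _ hn1).1 (hν x0 _ hn1).2.ne).ne'
      have homt : om ≠ ∞ := ENNReal.rpow_ne_top_of_nonneg (by positivity) (hν x0 _ hn1).2.ne
      set B := (N * K) / (l * om) with hB
      have hBt : B ≠ ∞ := ENNReal.div_ne_top (ENNReal.mul_ne_top hNt hK) (mul_ne_zero hl hom0)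
      refine ⟨max (2 * (n + 1)) (B.toReal ^ (1 / s)), fun x hx r hr hlt => ?_⟩
      rcases le_total r (2 * (n + 1)) with h | h
      · exact h.trans (le_max_left _ _)
      refine le_trans ?_ (le_max_right _ _)
      have hsub : ball x0 (n + 1) ⊆ ball x r := by
        intro y hy
        rw [mem_ball] at *
        have := dist_triangle y x0 x
        rw [dist_comm x0 x] at this
        linarith
      have hb1 := hμ x r hr
      have hlt' : l ≠ ∞ := by
        rintro rfl
        rw [ENNReal.top_mul hb1.1.ne'] at hlt
        exact not_top_lt hlt
      have h1 : (ENNReal.ofReal (r ^ s) * (l * om)) * μ (ball x r) ≤ (N * K) * μ (ball x r) := by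
        calc _ = ENNReal.ofReal (r ^ s) * om * (l * μ (ball x r)) := by ring
          _ ≤ ENNReal.ofReal (r ^ s) * ν (ball x r) ^ (1 / b) * (N * τ (ball x r) ^ (1 / a')) := by
            refine mul_le_mul' (mul_le_mul' le_rfl ?_) (hlt.le.trans (hhol x r hr))
            exact ENNReal.rpow_le_rpow (measure_mono hsub) (by positivity)
          _ = N * (ENNReal.ofReal (r ^ s) * ν (ball x r) ^ (1 / b) * τ (ball x r) ^ (1 / a')) := by ring
          _ ≤ N * (K * μ (ball x r)) := mul_le_mul' le_rfl (hmix x r hr)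
          _ = _ := by ring
      have h2 := (ENNReal.mul_le_mul_iff_left hb1.1.ne' hb1.2.ne).1 h1
      have h3 : ENNReal.ofReal (r ^ s) ≤ B :=
        (ENNReal.le_div_iff_mul_le (Or.inl (mul_ne_zero hl hom0)) (Or.inl (ENNReal.mul_ne_top hlt' homt))).2 h2
      have h4 : r ^ s ≤ B.toReal := (ENNReal.ofReal_le_iff_le_toReal hBt).1 h3
      calc r = (r ^ s) ^ (1 / s) := by
            rw [← Real.rpow_mul hr.le, mul_one_div_cancel hs.ne', Real.rpow_one]
        _ ≤ _ := by gcongr)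
    have : Countable U := hUc.to_subtype
    have hpos : ∀ i : U, (0 : ℝ) < 2 ^ (J i + 3) := fun i => by positivity
    have hsp := sparse_bound hμ hν hτ haa hbb hab hmix hH1 hH2 (fun i : U => (i : ℤ × X).2)
      (fun i : U => (2 : ℝ) ^ (J i + 3)) hpos (fun i : U => E i) (fun i => hEm i i.2)
      (fun i i' hne => hEd i.2 i'.2 (fun h => hne (Subtype.ext h))) (fun i => hEs i i.2)
      (fun i => hC1 _ _ (hpos i) _ (hEm i i.2) (hEs i i.2) (hEμ i i.2))
      (fun i => hC2 _ _ (hpos i) _ (hEm i i.2) (hEs i i.2) (hEμ i i.2))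
      g hg (fun i : U => A ^ (i : ℤ × X).1) (D ^ 3)
      (fun i => by rw [← hfg _ _ (hpos i)]; exact hAf i i.2)
    set T : X → ℝ≥0∞ := fun x => ∑' i : U, (ball (i : ℤ × X).2 ((2 : ℝ) ^ (J i + 3))).indicator
          (fun _ => A ^ (i : ℤ × X).1 * ENNReal.ofReal (((2 : ℝ) ^ (J i + 3)) ^ s)) x with hT
    have hTm : Measurable T := Measurable.tsum fun i => measurable_const.indicator measurableSet_ball
    calc _ ≤ ∫⁻ x in ball x0 (n + 1), Cd ^ b * T x ^ b ∂ν := by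
          refine setLIntegral_mono ((hTm.pow_const _).const_mul _) fun x hx => ?_
          rw [← ENNReal.mul_rpow_of_nonneg _ _ hb0.le]
          exact ENNReal.rpow_le_rpow (hpt x hx) hb0.le
      _ ≤ ∫⁻ x, Cd ^ b * T x ^ b ∂ν := setLIntegral_le_lintegral _ _
      _ = Cd ^ b * ∫⁻ x, T x ^ b ∂ν := lintegral_const_mul _ (hTm.pow_const _)
      _ ≤ Cd ^ b * _ := mul_le_mul' le_rfl hsp
      _ = _ := by
          rw [← ENNReal.mul_rpow_of_nonneg _ _ hb0.le, ENNReal.mul_rpow_of_nonneg (C1 * H1) _ (by positivity)]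
          congr 1; rw [hNdef]; ring
  obtain ⟨φ, hφm, hφle, hφ⟩ := exists_measurable_le_lintegral_eq ν (fun x => rieszPotential μ s f x ^ b)
  rw [hφ]
  have hun : (⋃ n : ℕ, ball x0 ((n : ℝ) + 1)) = univ := by
    rw [eq_univ_iff_forall]
    intro x
    obtain ⟨n, hn⟩ := exists_nat_gt (dist x x0)
    exact mem_iUnion.2 ⟨n, by rw [mem_ball]; linarith⟩
  rw [← setLIntegral_univ, ← hun, setLIntegral_iUnion_of_directed]
  · refine iSup_le fun n => le_trans (lintegral_mono fun x => hφle x) (hloc n)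
  · refine directed_of_isDirected_le ?_
    intro n m hnm
    refine ball_subset_ball ?_
    have : (n : ℝ) ≤ m := by exact_mod_cast hnm
    linarith

lemma weight_balls {μ : Measure X} (hμ : BallsPosFinite μ) {w : X → ℝ≥0∞} (hw : IsWeight μ w) :
    BallsPosFinite (μ.withDensity w) := by
  intro x r hr
  rw [withDensity_apply _ measurableSet_ball]
  refine ⟨?_, lt_top_iff_ne_top.2 (hw.2.2 x r hr)⟩
  rw [pos_iff_ne_zero, Ne, setLIntegral_eq_zero_iff measurableSet_ball hw.1]
  intro h0
  have h1 : ∀ᵐ y ∂μ, y ∉ ball x r := by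
    filter_upwards [h0, hw.2.1] with y hy hy2 hmem
    exact hy2.1.ne' (hy hmem)
  have h2 : μ (ball x r) = 0 := by
    rw [measure_eq_zero_iff_ae_notMem]; exact h1
  exact (hμ x r hr).1.ne' h2

/-- the elementary A_P estimate -/
lemma AI_of_est {μ : Measure X} (hμ : BallsPosFinite μ) {w : X → ℝ≥0∞} {P A : ℝ} (hP : 0 < P)
    (h : ∀ (x : X) (r : ℝ), 0 < r → ∀ E : Set X, MeasurableSet E → E ⊆ ball x r →
      μ E ^ P * ∫⁻ y in ball x r, w y ∂μ ≤ ENNReal.ofReal A * μ (ball x r) ^ P * ∫⁻ y in E, w y ∂μ) :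
    AI μ (μ.withDensity w) := by
  intro L hL
  refine ⟨L ^ P * ENNReal.ofReal A, ENNReal.mul_ne_top (ENNReal.rpow_ne_top_of_nonneg hP.le hL)
    ENNReal.ofReal_ne_top, ?_⟩
  intro x r hr E hE hEs hLE
  rw [withDensity_apply _ measurableSet_ball, withDensity_apply _ hE]
  have hb := hμ x r hr
  have h0 : μ (ball x r) ^ P ≠ 0 := (ENNReal.rpow_pos hb.1 hb.2.ne).ne'
  have ht : μ (ball x r) ^ P ≠ ∞ := ENNReal.rpow_ne_top_of_nonneg hP.le hb.2.ne
  refine (ENNReal.mul_le_mul_iff_right h0 ht).1 ?_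
  calc _ ≤ (L * μ E) ^ P * ∫⁻ y in ball x r, w y ∂μ := by gcongr
    _ = L ^ P * (μ E ^ P * ∫⁻ y in ball x r, w y ∂μ) := by
      rw [ENNReal.mul_rpow_of_nonneg _ _ hP.le]; ring
    _ ≤ L ^ P * (ENNReal.ofReal A * μ (ball x r) ^ P * ∫⁻ y in E, w y ∂μ) := mul_le_mul' le_rfl (h x r hr E hE hEs)
    _ = _ := by ring

lemma AI_A1 {μ : Measure X} (hμ : BallsPosFinite μ) {w : X → ℝ≥0∞} (h : MemA1 μ w) :
    AI μ (μ.withDensity w) := by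
  obtain ⟨hw, A, hA, h⟩ := h
  refine AI_of_est (P := 1) (A := A) hμ one_pos ?_
  intro x r hr E hE hEs
  simp only [ENNReal.rpow_one]
  have hb := hμ x r hr
  set W := ∫⁻ y in ball x r, w y ∂μ with hW
  have h1 : ∀ᵐ y ∂(μ.restrict (ball x r)), W ≤ ENNReal.ofReal A * μ (ball x r) * w y := by
    filter_upwards [ae_le_essSup (f := fun y => (w y)⁻¹) (μ := μ.restrict (ball x r)),
      ae_restrict_of_ae hw.2.1] with y hy hy2
    have h2 : W / μ (ball x r) * (w y)⁻¹ ≤ ENNReal.ofReal A := (mul_le_mul' le_rfl hy).trans (h x r hr)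
    rw [← div_eq_mul_inv, ENNReal.div_le_iff hy2.1.ne' hy2.2, ENNReal.div_le_iff hb.1.ne' hb.2.ne] at h2
    calc W ≤ _ := h2
      _ = _ := by ring
  have h3 : ∀ᵐ y ∂(μ.restrict E), W ≤ ENNReal.ofReal A * μ (ball x r) * w y :=
    ae_restrict_of_ae_restrict_of_subset hEs h1
  calc μ E * W = ∫⁻ y in E, W ∂μ := by simp [mul_comm]
    _ ≤ ∫⁻ y in E, ENNReal.ofReal A * μ (ball x r) * w y ∂μ := lintegral_mono_ae h3
    _ = _ := lintegral_const_mul _ hw.1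

lemma AI_Ap {μ : Measure X} (hμ : BallsPosFinite μ) {w : X → ℝ≥0∞} {P : ℝ} (hP : 1 < P)
    (h : MemAp μ w P) : AI μ (μ.withDensity w) := by
  obtain ⟨hw, A, hA, h⟩ := h
  have hP0 : 0 < P := by linarith
  have hP1 : 0 < P - 1 := by linarith
  refine AI_of_est (P := P) (A := A) hμ hP0 ?_
  intro x r hr E hE hEs
  have hb := hμ x r hr
  set W := ∫⁻ y in ball x r, w y ∂μ with hW
  set V := ∫⁻ y in ball x r, w y ^ (-(1 / (P - 1))) ∂μ with hV
  have hcj := Real.HolderConjugate.conjExponent hP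
  have h1 : μ E ≤ (∫⁻ y in E, w y ∂μ) ^ (1 / P) * V ^ (1 / P.conjExponent) := by
    have := ENNReal.lintegral_mul_le_Lp_mul_Lq (μ.restrict E) hcj
      (f := fun y => w y ^ (1 / P)) (g := fun y => w y ^ (-(1 / P)))
      (hw.1.pow_const _).aemeasurable (hw.1.pow_const _).aemeasurable
    have e1 : ∫⁻ y in E, ((fun y => w y ^ (1 / P)) * (fun y => w y ^ (-(1 / P)))) y ∂μ = μ E := by
      have : ∫⁻ y in E, ((fun y => w y ^ (1 / P)) * (fun y => w y ^ (-(1 / P)))) y ∂μ = ∫⁻ y in E, 1 ∂μ := by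
        refine lintegral_congr_ae ?_
        filter_upwards [ae_restrict_of_ae hw.2.1] with y hy
        simp only [Pi.mul_apply]
        rw [← ENNReal.rpow_add _ _ hy.1.ne' hy.2, add_neg_cancel, ENNReal.rpow_zero]
      rw [this]; simp
    rw [e1] at this
    refine this.trans (mul_le_mul' (le_of_eq ?_) (ENNReal.rpow_le_rpow ?_ ?_))
    · congr 2; ext y; rw [← ENNReal.rpow_mul, one_div_mul_cancel hP0.ne', ENNReal.rpow_one]
    · refine le_trans (le_of_eq ?_) (lintegral_mono_set hEs)
      congr 1; ext y; rw [← ENNReal.rpow_mul]; congr 1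
      rw [Real.conjExponent]; field_simp
    · exact one_div_nonneg.2 hcj.symm.nonneg
  have h2 : μ E ^ P ≤ (∫⁻ y in E, w y ∂μ) * V ^ (P - 1) := by
    calc μ E ^ P ≤ ((∫⁻ y in E, w y ∂μ) ^ (1 / P) * V ^ (1 / P.conjExponent)) ^ P := by gcongr
      _ = _ := by
        rw [ENNReal.mul_rpow_of_nonneg _ _ hP0.le, ← ENNReal.rpow_mul, ← ENNReal.rpow_mul,
          one_div_mul_cancel hP0.ne', ENNReal.rpow_one]
        congr 2
        rw [Real.conjExponent]; field_simp
  have hA' := h x r hr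
  have h3 : W * V ^ (P - 1) ≤ ENNReal.ofReal A * μ (ball x r) ^ P := by
    have hm0 : μ (ball x r) ^ (P - 1) ≠ 0 := (ENNReal.rpow_pos hb.1 hb.2.ne).ne'
    have hmt : μ (ball x r) ^ (P - 1) ≠ ∞ := ENNReal.rpow_ne_top_of_nonneg hP1.le hb.2.ne
    rw [ENNReal.div_rpow_of_nonneg _ _ hP1.le, ← mul_div_assoc, ENNReal.div_le_iff hm0 hmt,
      ENNReal.mul_comm_div, mul_div_assoc', ENNReal.div_le_iff hb.1.ne' hb.2.ne] at hA'
    calc _ ≤ _ := hA'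
      _ = _ := by
        have : μ (ball x r) ^ P = μ (ball x r) ^ (P - 1) * μ (ball x r) := by
          nth_rewrite 3 [← ENNReal.rpow_one (μ (ball x r))]
          rw [← ENNReal.rpow_add _ _ hb.1.ne' hb.2.ne]; congr 1; ring
        rw [this]; ring
  calc μ E ^ P * W ≤ (∫⁻ y in E, w y ∂μ) * V ^ (P - 1) * W := by gcongr
    _ = (W * V ^ (P - 1)) * ∫⁻ y in E, w y ∂μ := by ring
    _ ≤ _ := by gcongr

lemma AI_of_mem {μ : Measure X} (hμ : BallsPosFinite μ) {w : X → ℝ≥0∞}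
    (h : MemA1 μ w ∨ ∃ P : ℝ, 1 < P ∧ MemAp μ w P) : AI μ (μ.withDensity w) ∧ IsWeight μ w := by
  rcases h with h | ⟨P, hP, h⟩
  · exact ⟨AI_A1 hμ h, h.1⟩
  · exact ⟨AI_Ap hμ hP h, h.1⟩


theorem rieszPotential_two_weight_bounded [Nontrivial X]
    (μ : Measure X) (s : ℝ) (hs : 0 < s)
    (hsa : StandingAssumptions μ) (hballs : BallsPosFinite μ) (hdbl : Doubling μ)
    (hrev : ReverseDoubling μ s)
    (Q c : ℝ) (hQ : s < Q) (hc : 0 < c)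
    (hlow : ∀ (x : X) (r : ℝ), 1 ≤ r → ENNReal.ofReal (c * r ^ Q) ≤ μ (ball x r))
    (t p q : ℝ) (ht : 0 < t) (htp : t < p) (hpq : p ≤ q)
    (w v : X → ℝ≥0∞) (hw : IsWeight μ w) (hv : IsWeight μ v)
    (hwA : MemA1 μ w ∨ ∃ P : ℝ, 1 < P ∧ MemAp μ w P)
    (hhA : MemA1 μ (fun x => v x ^ (t / (t - p))) ∨
      ∃ P : ℝ, 1 < P ∧ MemAp μ (fun x => v x ^ (t / (t - p))) P)
    (K : ℝ) (hK : 0 < K)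
    (hmix : ∀ (x : X) (r : ℝ), 0 < r →
      ENNReal.ofReal (r ^ s) * (∫⁻ y in ball x r, w y ∂μ) ^ (t / q) *
        (∫⁻ y in ball x r, v y ^ (t / (t - p)) ∂μ) ^ ((p - t) / p) ≤
        ENNReal.ofReal K * μ (ball x r)) :
    ∃ C : ℝ, 0 < C ∧ ∀ f : X → ℝ≥0∞, Measurable f →
      (∫⁻ x, rieszPotential μ s f x ^ (q / t) * w x ∂μ) ^ (t / q) ≤
        ENNReal.ofReal C * (∫⁻ x, f x ^ (p / t) * v x ∂μ) ^ (t / p) := by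
  obtain ⟨D, hD0, hD⟩ := hdbl
  obtain ⟨aν, -⟩ := AI_of_mem hballs hwA
  obtain ⟨aτ, hσ⟩ := AI_of_mem hballs hhA
  have hp : 0 < p := ht.trans htp
  have hq : 0 < q := hp.trans_le hpq
  have ha1 : 1 < p / t := (one_lt_div ht).2 htp
  have hb1 : 1 < q / t := (one_lt_div ht).2 (htp.trans_le hpq)
  have haa := Real.HolderConjugate.conjExponent ha1
  have hbb := Real.HolderConjugate.conjExponent hb1
  have e1 : 1 / (q / t) = t / q := one_div_div q t
  have e2 : 1 / (p / t) = t / p := one_div_div p t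
  have hpt : p - t ≠ 0 := (sub_pos.2 htp).ne'
  have htp' : t - p ≠ 0 := (sub_neg.2 htp).ne
  have e3 : 1 / (p / t).conjExponent = (p - t) / p := by
    have h := haa.inv_add_inv_eq_one
    have h2 : (p / t).conjExponent⁻¹ = 1 - (p / t)⁻¹ := by linarith
    rw [one_div, h2]
    field_simp
  obtain ⟨C, hC, key⟩ := core hballs (weight_balls hballs hw) (weight_balls hballs hσ)
    (D := ENNReal.ofReal D) ENNReal.ofReal_ne_top hD aν aτ hs haa hbb
    (div_le_div_of_nonneg_right hpq ht.le) (K := ENNReal.ofReal K) ENNReal.ofReal_ne_top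
    (by
      intro x r hr
      rw [withDensity_apply _ measurableSet_ball, withDensity_apply _ measurableSet_ball, e1, e3]
      exact hmix x r hr)
  have hCp : 0 < C.toReal + 1 := by positivity
  refine ⟨C.toReal + 1, hCp, fun f hf => ?_⟩
  by_cases htop : ∫⁻ x, f x ^ (p / t) * v x ∂μ = ∞
  · rw [htop, ENNReal.top_rpow_of_pos (by positivity), ENNReal.mul_top]
    · exact le_top
    · exact (ENNReal.ofReal_pos.2 hCp).ne'
  have hgm : Measurable (fun x => f x * v x ^ (-(t / (t - p)))) :=
    hf.mul (hv.1.pow_const _)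
  have hgint : ∫⁻ x, (f x * v x ^ (-(t / (t - p)))) ^ (p / t)
      ∂(μ.withDensity fun x => v x ^ (t / (t - p))) = ∫⁻ x, f x ^ (p / t) * v x ∂μ := by
    rw [lintegral_withDensity_eq_lintegral_mul _ hσ.1 (hgm.pow_const _)]
    refine lintegral_congr_ae ?_
    filter_upwards [hv.2.1] with x hx
    simp only [Pi.mul_apply]
    rw [ENNReal.mul_rpow_of_nonneg _ _ (by positivity), ← ENNReal.rpow_mul, mul_left_comm,
      ← ENNReal.rpow_add _ _ hx.1.ne' hx.2]
    have : t / (t - p) + -(t / (t - p)) * (p / t) = 1 := by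
      field_simp
      ring
    rw [this, ENNReal.rpow_one]
  have := key f (fun x => f x * v x ^ (-(t / (t - p)))) hf hgm (by
      intro x r hr
      rw [setLIntegral_withDensity_eq_setLIntegral_mul _ hσ.1 hgm measurableSet_ball]
      refine lintegral_congr_ae (ae_restrict_of_ae ?_)
      filter_upwards [hv.2.1] with y hy
      simp only [Pi.mul_apply]
      rw [mul_left_comm, ← ENNReal.rpow_add _ _ hy.1.ne' hy.2]
      simp) (by rw [hgint]; exact htop)
  rw [hgint, lintegral_withDensity_eq_lintegral_mul_non_measurable _ hw.1
    (hw.2.1.mono fun x hx => hx.2.lt_top)] at this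
  have h2 := ENNReal.rpow_le_rpow this (show 0 ≤ t / q by positivity)
  rw [← ENNReal.rpow_mul, div_mul_div_cancel₀ ht.ne', div_self hq.ne', ENNReal.rpow_one, e2] at h2
  have h3 : C ≤ ENNReal.ofReal (C.toReal + 1) :=
    (ENNReal.ofReal_toReal hC).symm.le.trans (ENNReal.ofReal_le_ofReal (by linarith))
  calc _ = (∫⁻ a, (w * fun x => rieszPotential μ s f x ^ (q / t)) a ∂μ) ^ (t / q) := by
        congr 1
        refine lintegral_congr fun x => ?_
        simp [mul_comm]
    _ ≤ _ := h2
    _ ≤ _ := by gcongr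

end
end ApDistance
end
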